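/- Let p₁, p₂ be two distinct points in ℝ², let θ₁ be a positive integer, and let θ₂ > 0 be a real number that is not an integer. Let u solve the singular Liouville equation Δu + 2e^u = 4π(θ₁−1)δ_{p₁} + 4π(θ₂−1)δ_{p₂} in the classical sense (u is C² on ℝ² ∖ {p₁, p₂}, Δu + 2e^u = 0 there, and for each i ∈ {1,2} the function x ↦ u(x) − 2(θᵢ−1)log|x−pᵢ| is bounded near pᵢ), with ∫_{ℝ²} e^u < ∞. Then there exists θ₃ > 0 such that (1/(2π)) ∫_{ℝ²} e^u = θ₁ + θ₂ + θ₃ − 1, and moreover there exists a nonnegative integer m with m ≤ θ₁ − 1 and m + θ₁ odd such that either θ₂ + θ₃ = m or |θ₂ − θ₃| = m. -/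

import Mathlib

noncomputable section
open Real MeasureTheory Metric Filter Topology

/-- The plane `ℝ²` with the Euclidean metric. -/
abbrev E2 := EuclideanSpace ℝ (Fin 2)

/-- The Euclidean Laplacian on `ℝ²`: `Δu = ∂²u/∂x₁² + ∂²u/∂x₂²`. -/
noncomputable def lap (u : E2 → ℝ) (x : E2) : ℝ :=
  ∑ i : Fin 2, fderiv ℝ (fun y => fderiv ℝ u y (EuclideanSpace.single i 1)) x
    (EuclideanSpace.single i 1)

/-- The Wirtinger derivative `∂f/∂z`. -/
def dz (f : ℂ → ℂ) (z : ℂ) : ℂ := (fderiv ℝ f z 1 - Complex.I * fderiv ℝ f z Complex.I) / 2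

/-- The Wirtinger derivative `∂f/∂z̄`. -/
def dzb (f : ℂ → ℂ) (z : ℂ) : ℂ := (fderiv ℝ f z 1 + Complex.I * fderiv ℝ f z Complex.I) / 2

lemma fderiv_eq_wirtinger (f : ℂ → ℂ) (z v : ℂ) :
    fderiv ℝ f z v = v * dz f z + starRingEnd ℂ v * dzb f z := by
  have h : v = v.re • (1 : ℂ) + v.im • Complex.I := by simp
  have h1 : fderiv ℝ f z v
      = (v.re : ℂ) * fderiv ℝ f z 1 + (v.im : ℂ) * fderiv ℝ f z Complex.I := by
    conv_lhs => rw [h]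
    rw [map_add, map_smul, map_smul]; simp
  have h2 : v = (v.re : ℂ) + v.im * Complex.I := (Complex.re_add_im v).symm
  have h3 : starRingEnd ℂ v = (v.re : ℂ) - v.im * Complex.I := by
    apply Complex.ext <;> simp
  rw [h1, h3, dz, dzb]
  have hI : Complex.I ^ 2 = -1 := Complex.I_sq
  linear_combination ((v.im : ℂ) * fderiv ℝ f z Complex.I) * hI
    - (fderiv ℝ f z 1 - Complex.I * fderiv ℝ f z Complex.I) / 2 * h2

lemma dz_eq_of_eventuallyEq {f g : ℂ → ℂ} {z : ℂ} (h : f =ᶠ[𝓝 z] g) : dz f z = dz g z := by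
  rw [dz, dz, h.fderiv_eq]

lemma dzb_eq_of_eventuallyEq {f g : ℂ → ℂ} {z : ℂ} (h : f =ᶠ[𝓝 z] g) : dzb f z = dzb g z := by
  rw [dzb, dzb, h.fderiv_eq]

lemma dz_const (c z : ℂ) : dz (fun _ => c) z = 0 := by simp [dz]
lemma dzb_const (c z : ℂ) : dzb (fun _ => c) z = 0 := by simp [dzb]

lemma dz_add {f g : ℂ → ℂ} {z : ℂ} (hf : DifferentiableAt ℝ f z) (hg : DifferentiableAt ℝ g z) :
    dz (fun w => f w + g w) z = dz f z + dz g z := by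
  simp only [dz, fderiv_fun_add hf hg, add_apply]; ring

lemma dzb_add {f g : ℂ → ℂ} {z : ℂ} (hf : DifferentiableAt ℝ f z) (hg : DifferentiableAt ℝ g z) :
    dzb (fun w => f w + g w) z = dzb f z + dzb g z := by
  simp only [dzb, fderiv_fun_add hf hg, add_apply]; ring

lemma dz_sub {f g : ℂ → ℂ} {z : ℂ} (hf : DifferentiableAt ℝ f z) (hg : DifferentiableAt ℝ g z) :
    dz (fun w => f w - g w) z = dz f z - dz g z := by
  simp only [dz, fderiv_fun_sub hf hg, sub_apply]; ring

lemma dzb_sub {f g : ℂ → ℂ} {z : ℂ} (hf : DifferentiableAt ℝ f z) (hg : DifferentiableAt ℝ g z) :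
    dzb (fun w => f w - g w) z = dzb f z - dzb g z := by
  simp only [dzb, fderiv_fun_sub hf hg, sub_apply]; ring

lemma dz_mul {f g : ℂ → ℂ} {z : ℂ} (hf : DifferentiableAt ℝ f z) (hg : DifferentiableAt ℝ g z) :
    dz (fun w => f w * g w) z = dz f z * g z + f z * dz g z := by
  simp only [dz, fderiv_fun_mul hf hg, add_apply,
    smul_apply, smul_eq_mul]; ring

lemma dzb_mul {f g : ℂ → ℂ} {z : ℂ} (hf : DifferentiableAt ℝ f z) (hg : DifferentiableAt ℝ g z) :
    dzb (fun w => f w * g w) z = dzb f z * g z + f z * dzb g z := by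
  simp only [dzb, fderiv_fun_mul hf hg, add_apply,
    smul_apply, smul_eq_mul]; ring

lemma dz_of_holomorphic {f : ℂ → ℂ} {z : ℂ} (hf : DifferentiableAt ℂ f z) :
    dz f z = deriv f z := by
  rw [dz, hf.fderiv_restrictScalars ℝ]
  simp only [ContinuousLinearMap.coe_restrictScalars', fderiv_eq_smul_deriv, smul_eq_mul]
  linear_combination (-deriv f z / 2) * Complex.I_sq

lemma dzb_of_holomorphic {f : ℂ → ℂ} {z : ℂ} (hf : DifferentiableAt ℂ f z) :
    dzb f z = 0 := by
  rw [dzb, hf.fderiv_restrictScalars ℝ]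
  simp only [ContinuousLinearMap.coe_restrictScalars', fderiv_eq_smul_deriv, smul_eq_mul]
  linear_combination (deriv f z / 2) * Complex.I_sq

lemma differentiableAt_of_dzb_eq_zero {f : ℂ → ℂ} {z : ℂ} (hf : DifferentiableAt ℝ f z)
    (h : dzb f z = 0) : DifferentiableAt ℂ f z := by
  rw [differentiableAt_complex_iff_differentiableAt_real]
  refine ⟨hf, ?_⟩
  simp [fderiv_eq_wirtinger, h]

lemma differentiableAt_conj {f : ℂ → ℂ} {z : ℂ} (hf : DifferentiableAt ℝ f z) :
    DifferentiableAt ℝ (fun w => starRingEnd ℂ (f w)) z :=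
  Complex.conjCLE.differentiableAt.comp z hf

lemma fderiv_conj_apply {f : ℂ → ℂ} {z : ℂ} (hf : DifferentiableAt ℝ f z) (v : ℂ) :
    fderiv ℝ (fun w => starRingEnd ℂ (f w)) z v = starRingEnd ℂ (fderiv ℝ f z v) := by
  have := (Complex.conjCLE.toContinuousLinearMap.hasFDerivAt.comp z hf.hasFDerivAt).fderiv
  have h2 : (fun w => starRingEnd ℂ (f w)) = (Complex.conjCLE.toContinuousLinearMap ∘ f) := by
    ext w; simp
  rw [h2, this]; simp

lemma dz_conj {f : ℂ → ℂ} {z : ℂ} (hf : DifferentiableAt ℝ f z) :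
    dz (fun w => starRingEnd ℂ (f w)) z = starRingEnd ℂ (dzb f z) := by
  simp [dz, dzb, fderiv_conj_apply hf, sub_eq_add_neg, map_ofNat]

lemma dzb_conj {f : ℂ → ℂ} {z : ℂ} (hf : DifferentiableAt ℝ f z) :
    dzb (fun w => starRingEnd ℂ (f w)) z = starRingEnd ℂ (dz f z) := by
  simp [dz, dzb, fderiv_conj_apply hf, sub_eq_add_neg, map_ofNat]

/-- Chain rule with a holomorphic outer function. -/
lemma fderiv_holomorphic_comp {g f : ℂ → ℂ} {z : ℂ} (hg : DifferentiableAt ℂ g (f z))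
    (hf : DifferentiableAt ℝ f z) (v : ℂ) :
    fderiv ℝ (fun w => g (f w)) z v = deriv g (f z) * fderiv ℝ f z v := by
  have := ((hg.hasFDerivAt.restrictScalars ℝ).comp z hf.hasFDerivAt).fderiv
  have h2 : (fun w => g (f w)) = g ∘ f := rfl
  rw [h2, this]; simp [mul_comm]

lemma dz_holomorphic_comp {g f : ℂ → ℂ} {z : ℂ} (hg : DifferentiableAt ℂ g (f z))
    (hf : DifferentiableAt ℝ f z) : dz (fun w => g (f w)) z = deriv g (f z) * dz f z := by
  simp only [dz, fderiv_holomorphic_comp hg hf]; ring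

/-- Chain rule with a holomorphic inner function. -/
lemma fderiv_comp_holomorphic {g f : ℂ → ℂ} {z : ℂ} (hg : DifferentiableAt ℝ g (f z))
    (hf : DifferentiableAt ℂ f z) (v : ℂ) :
    fderiv ℝ (fun w => g (f w)) z v = fderiv ℝ g (f z) (deriv f z * v) := by
  have := (hg.hasFDerivAt.comp z (hf.hasFDerivAt.restrictScalars ℝ)).fderiv
  have h2 : (fun w => g (f w)) = g ∘ f := rfl
  rw [h2, this]; simp [mul_comm]

lemma dz_comp_holomorphic {g f : ℂ → ℂ} {z : ℂ} (hg : DifferentiableAt ℝ g (f z))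
    (hf : DifferentiableAt ℂ f z) : dz (fun w => g (f w)) z = deriv f z * dz g (f z) := by
  rw [dz]
  simp only [fderiv_comp_holomorphic hg hf, fderiv_eq_wirtinger g, map_mul, map_one, Complex.conj_I]
  linear_combination (-(deriv f z) * dz g (f z) / 2
    + starRingEnd ℂ (deriv f z) * dzb g (f z) / 2) * Complex.I_sq

lemma dzb_comp_holomorphic {g f : ℂ → ℂ} {z : ℂ} (hg : DifferentiableAt ℝ g (f z))
    (hf : DifferentiableAt ℂ f z) :
    dzb (fun w => g (f w)) z = starRingEnd ℂ (deriv f z) * dzb g (f z) := by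
  rw [dzb]
  simp only [fderiv_comp_holomorphic hg hf, fderiv_eq_wirtinger g, map_mul, map_one, Complex.conj_I]
  linear_combination ((deriv f z) * dz g (f z) / 2
    - starRingEnd ℂ (deriv f z) * dzb g (f z) / 2) * Complex.I_sq

lemma contDiffOn_fderiv_apply {f : ℂ → ℂ} {Ω : Set ℂ} (hΩ : IsOpen Ω) {k : ℕ}
    (hf : ContDiffOn ℝ (k + 1) f Ω) (v : ℂ) : ContDiffOn ℝ k (fun z => fderiv ℝ f z v) Ω :=
  (hf.fderiv_of_isOpen hΩ le_rfl).clm_apply contDiffOn_const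

lemma ContDiffOn.dz {f : ℂ → ℂ} {Ω : Set ℂ} (hΩ : IsOpen Ω) {k : ℕ}
    (hf : ContDiffOn ℝ (k + 1) f Ω) : ContDiffOn ℝ k (dz f) Ω :=
  ((contDiffOn_fderiv_apply hΩ hf 1).sub
    (contDiffOn_const.mul (contDiffOn_fderiv_apply hΩ hf Complex.I))).div_const 2

lemma ContDiffOn.dzb {f : ℂ → ℂ} {Ω : Set ℂ} (hΩ : IsOpen Ω) {k : ℕ}
    (hf : ContDiffOn ℝ (k + 1) f Ω) : ContDiffOn ℝ k (dzb f) Ω :=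
  ((contDiffOn_fderiv_apply hΩ hf 1).add
    (contDiffOn_const.mul (contDiffOn_fderiv_apply hΩ hf Complex.I))).div_const 2

lemma ContDiffOn.differentiableAt_of_isOpen {f : ℂ → ℂ} {Ω : Set ℂ} (hΩ : IsOpen Ω) {k : ℕ}
    (hf : ContDiffOn ℝ (k + 1) f Ω) {z : ℂ} (hz : z ∈ Ω) : DifferentiableAt ℝ f z :=
  (hf.contDiffAt (hΩ.mem_nhds hz)).differentiableAt (by positivity)

/-- A function whose Wirtinger derivatives are of class `C^k` is of class `C^(k+1)`. -/
lemma contDiffOn_succ_of_wirtinger {f : ℂ → ℂ} {Ω : Set ℂ} (hΩ : IsOpen Ω) {k : ℕ}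
    (hf : DifferentiableOn ℝ f Ω) (h1 : ContDiffOn ℝ k (dz f) Ω) (h2 : ContDiffOn ℝ k (dzb f) Ω) :
    ContDiffOn ℝ (k + 1) f Ω := by
  rw [contDiffOn_succ_iff_fderiv_of_isOpen hΩ]
  refine ⟨hf, by simp, ?_⟩
  rw [contDiffOn_clm_apply]
  intro v
  simp_rw [fderiv_eq_wirtinger]
  exact (contDiffOn_const.mul h1).add (contDiffOn_const.mul h2)

/-- The Wirtinger derivatives commute on functions of class `C^2`. -/
lemma dz_dzb_comm {f : ℂ → ℂ} {Ω : Set ℂ} (hΩ : IsOpen Ω)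
    (hf : ContDiffOn ℝ 2 f Ω) {z : ℂ} (hz : z ∈ Ω) : dz (dzb f) z = dzb (dz f) z := by
  have hd : DifferentiableAt ℝ (fderiv ℝ f) z :=
    (((hf.fderiv_of_isOpen hΩ (m := 1) (by norm_num)).contDiffAt (hΩ.mem_nhds hz))).differentiableAt
      (by norm_num)
  have hsym : IsSymmSndFDerivAt ℝ f z :=
    (hf.contDiffAt (hΩ.mem_nhds hz)).isSymmSndFDerivAt (by simp)
  have hap : ∀ v w, fderiv ℝ (fun y => fderiv ℝ f y v) z w = fderiv ℝ (fderiv ℝ f) z w v := by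
    intro v w
    rw [fderiv_clm_apply hd (differentiableAt_const v)]; simp
  have hdv : ∀ v, DifferentiableAt ℝ (fun y => fderiv ℝ f y v) z := fun v =>
    hd.clm_apply (differentiableAt_const v)
  have e1 : ∀ w, fderiv ℝ (dz f) z w = (fderiv ℝ (fderiv ℝ f) z w 1
      - Complex.I * fderiv ℝ (fderiv ℝ f) z w Complex.I) / 2 := by
    intro w
    have : dz f = fun y => (fderiv ℝ f y 1 - Complex.I * fderiv ℝ f y Complex.I) * (1/2) := by
      ext y; simp [dz, div_eq_mul_inv]
    rw [this, fderiv_mul_const (by fun_prop), fderiv_fun_sub (hdv 1) (by fun_prop),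
      fderiv_const_mul (hdv _)]
    simp [hap]; ring
  have e2 : ∀ w, fderiv ℝ (dzb f) z w = (fderiv ℝ (fderiv ℝ f) z w 1
      + Complex.I * fderiv ℝ (fderiv ℝ f) z w Complex.I) / 2 := by
    intro w
    have : dzb f = fun y => (fderiv ℝ f y 1 + Complex.I * fderiv ℝ f y Complex.I) * (1/2) := by
      ext y; simp [dzb, div_eq_mul_inv]
    rw [this, fderiv_mul_const (by fun_prop), fderiv_fun_add (hdv 1) (by fun_prop),
      fderiv_const_mul (hdv _)]
    simp [hap]; ring
  rw [dz, dzb, e1, e1, e2, e2, hsym.eq 1 Complex.I]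
  ring

lemma dz_ofReal (u : ℂ → ℝ) {z : ℂ} (hu : DifferentiableAt ℝ u z) :
    starRingEnd ℂ (dz (fun w => (u w : ℂ)) z) = dzb (fun w => (u w : ℂ)) z := by
  have h : DifferentiableAt ℝ (fun w => (u w : ℂ)) z :=
    Complex.ofRealCLM.differentiableAt.comp z hu
  rw [← dzb_conj h]; simp

/-- The point of the circle of centre `c` and radius `exp t` at angle `θ`. -/
def cpt (c : ℂ) (t θ : ℝ) : ℂ := c + Complex.exp (t + θ * Complex.I)

/-- The unnormalised mean of `g` over the circle of centre `c` and radius `exp t`. -/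
def cm {E : Type*} [NormedAddCommGroup E] [NormedSpace ℝ E] (c : ℂ) (g : ℂ → E) (t : ℝ) : E :=
  ∫ θ in -π..π, g (cpt c t θ)

lemma cpt_sub (c : ℂ) (t θ : ℝ) : cpt c t θ - c = Complex.exp (t + θ * Complex.I) := by
  simp [cpt]

lemma norm_cpt_sub (c : ℂ) (t θ : ℝ) : ‖cpt c t θ - c‖ = exp t := by
  rw [cpt_sub, Complex.norm_exp]; simp

lemma cpt_mem_sphere (c : ℂ) (t θ : ℝ) : cpt c t θ ∈ sphere c (exp t) := by
  rw [mem_sphere, dist_eq_norm, norm_cpt_sub]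

lemma continuous_cpt_uncurry (c : ℂ) : Continuous (fun p : ℝ × ℝ => cpt c p.1 p.2) := by
  unfold cpt; fun_prop

lemma continuous_cpt (c : ℂ) (t : ℝ) : Continuous (cpt c t) := by
  unfold cpt; fun_prop

lemma cpt_add_two_pi (c : ℂ) (t θ : ℝ) : cpt c t (θ + 2 * π) = cpt c t θ := by
  simp only [cpt]
  rw [show ((t : ℂ) + ((θ + 2 * π : ℝ) : ℂ) * Complex.I)
    = (t + θ * Complex.I) + 2 * π * Complex.I by push_cast; ring, Complex.exp_add,
    Complex.exp_two_pi_mul_I, mul_one]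

lemma cpt_pi (c : ℂ) (t : ℝ) : cpt c t π = cpt c t (-π) := by
  rw [← cpt_add_two_pi c t (-π)]; congr 1; ring

lemma continuous_comp_cpt {E : Type*} [TopologicalSpace E] {c : ℂ} {t : ℝ} {g : ℂ → E}
    (hg : ContinuousOn g (sphere c (exp t))) : Continuous (fun θ => g (cpt c t θ)) :=
  hg.comp_continuous (continuous_cpt c t) (cpt_mem_sphere c t)

lemma intervalIntegrable_comp_cpt {E : Type*} [NormedAddCommGroup E] {c : ℂ} {t : ℝ}
    {g : ℂ → E} (hg : ContinuousOn g (sphere c (exp t))) :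
    IntervalIntegrable (fun θ => g (cpt c t θ)) volume (-π) π :=
  (continuous_comp_cpt hg).intervalIntegrable _ _

section
variable {E : Type*} [NormedAddCommGroup E] [NormedSpace ℝ E] {c : ℂ} {t : ℝ} {f g : ℂ → E}

lemma cm_congr (h : ∀ z ∈ sphere c (exp t), f z = g z) : cm c f t = cm c g t := by
  simp only [cm, h _ (cpt_mem_sphere c t _)]

lemma cm_add (hf : ContinuousOn f (sphere c (exp t))) (hg : ContinuousOn g (sphere c (exp t))) :
    cm c (fun z => f z + g z) t = cm c f t + cm c g t :=
  intervalIntegral.integral_add (intervalIntegrable_comp_cpt hf) (intervalIntegrable_comp_cpt hg)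

lemma cm_sub (hf : ContinuousOn f (sphere c (exp t))) (hg : ContinuousOn g (sphere c (exp t))) :
    cm c (fun z => f z - g z) t = cm c f t - cm c g t :=
  intervalIntegral.integral_sub (intervalIntegrable_comp_cpt hf) (intervalIntegrable_comp_cpt hg)

lemma cm_const [CompleteSpace E] (a : E) : cm c (fun _ => a) t = (2 * π) • a := by
  simp only [cm, intervalIntegral.integral_const]; congr 1; ring

lemma cm_const_mul (a : ℂ) (f : ℂ → ℂ) : cm c (fun z => a * f z) t = a * cm c f t :=
  intervalIntegral.integral_const_mul _ _

lemma cm_const_mul_real (a : ℝ) (f : ℂ → ℝ) : cm c (fun z => a * f z) t = a * cm c f t :=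
  intervalIntegral.integral_const_mul _ _

lemma norm_cm_le {C : ℝ} (h : ∀ z ∈ sphere c (exp t), ‖f z‖ ≤ C) : ‖cm c f t‖ ≤ 2 * π * C := by
  refine (intervalIntegral.norm_integral_le_of_norm_le_const
    (fun θ _ => h _ (cpt_mem_sphere c t θ))).trans (le_of_eq ?_)
  rw [abs_of_nonneg (by linarith [pi_pos])]; ring

lemma cm_mono {f g : ℂ → ℝ} (hf : ContinuousOn f (sphere c (exp t)))
    (hg : ContinuousOn g (sphere c (exp t))) (h : ∀ z ∈ sphere c (exp t), f z ≤ g z) :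
    cm c f t ≤ cm c g t :=
  intervalIntegral.integral_mono_on (by linarith [pi_pos]) (intervalIntegrable_comp_cpt hf)
    (intervalIntegrable_comp_cpt hg) (fun θ _ => h _ (cpt_mem_sphere c t θ))

lemma cm_ofReal (u : ℂ → ℝ) : cm c (fun z => (u z : ℂ)) t = ((cm c u t : ℝ) : ℂ) :=
  intervalIntegral.integral_ofReal

end

lemma hasDerivAt_cpt_fst (c : ℂ) (t θ : ℝ) :
    HasDerivAt (fun s => cpt c s θ) (cpt c t θ - c) t := by
  have h1 : HasDerivAt (fun s : ℝ => (s : ℂ) + θ * Complex.I) 1 t :=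
    (Complex.ofRealCLM.hasDerivAt).add_const _
  rw [cpt_sub]
  simpa [cpt] using (h1.cexp).const_add c

lemma hasDerivAt_cpt_snd (c : ℂ) (t θ : ℝ) :
    HasDerivAt (fun s => cpt c t s) (Complex.I * (cpt c t θ - c)) θ := by
  have h1 : HasDerivAt (fun s : ℝ => (t : ℂ) + s * Complex.I) Complex.I θ := by
    simpa using ((Complex.ofRealCLM.hasDerivAt (x := θ)).mul_const Complex.I).const_add (t : ℂ)
  rw [cpt_sub, mul_comm]
  simpa [cpt] using (h1.cexp).const_add c

/-- The two radial-type derivatives of `g` have the same circle means. -/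
lemma cm_dz_eq_cm_dzb {g : ℂ → ℂ} {Ω : Set ℂ} (hΩ : IsOpen Ω) (hg : ContDiffOn ℝ 1 g Ω)
    {c : ℂ} {t : ℝ} (hs : sphere c (exp t) ⊆ Ω) :
    cm c (fun z => (z - c) * dz g z) t = cm c (fun z => starRingEnd ℂ (z - c) * dzb g z) t := by
  have hd : ∀ θ, HasDerivAt (fun s => g (cpt c t s))
      (Complex.I * ((cpt c t θ - c) * dz g (cpt c t θ)
        - starRingEnd ℂ (cpt c t θ - c) * dzb g (cpt c t θ))) θ := by
    intro θ
    have hgd : DifferentiableAt ℝ g (cpt c t θ) :=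
      ContDiffOn.differentiableAt_of_isOpen (k := 0) hΩ (by simpa using hg)
        (hs (cpt_mem_sphere c t θ))
    have := hgd.hasFDerivAt.comp_hasDerivAt θ (hasDerivAt_cpt_snd c t θ)
    refine this.congr_deriv ?_
    rw [fderiv_eq_wirtinger, map_mul, Complex.conj_I]; ring
  have c1 : ContinuousOn (dz g) (sphere c (exp t)) :=
    (ContDiffOn.dz (k := 0) hΩ (by simpa using hg)).continuousOn.mono hs
  have c2 : ContinuousOn (dzb g) (sphere c (exp t)) :=
    (ContDiffOn.dzb (k := 0) hΩ (by simpa using hg)).continuousOn.mono hs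
  have c3 : ContinuousOn (fun z => (z - c) * dz g z) (sphere c (exp t)) :=
    (continuousOn_id.sub continuousOn_const).mul c1
  have c4 : ContinuousOn (fun z => starRingEnd ℂ (z - c) * dzb g z) (sphere c (exp t)) :=
    (Complex.continuous_conj.comp_continuousOn (continuousOn_id.sub continuousOn_const)).mul c2
  have := intervalIntegral.integral_eq_sub_of_hasDerivAt (a := -π) (b := π) (fun θ _ => hd θ)
    ((intervalIntegrable_comp_cpt (c3.sub c4)).const_mul Complex.I)
  rw [cpt_pi, sub_self, intervalIntegral.integral_const_mul] at this
  have h2 := (mul_eq_zero.1 this).resolve_left Complex.I_ne_zero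
  rw [intervalIntegral.integral_sub (intervalIntegrable_comp_cpt c3)
    (intervalIntegrable_comp_cpt c4)] at h2
  exact sub_eq_zero.1 h2

lemma hasDerivAt_cm_of_hasDerivAt {g G : ℂ → ℂ} {Ω : Set ℂ} (hΩ : IsOpen Ω)
    (hg : ContinuousOn g Ω) (kG : ContinuousOn G Ω) {c : ℂ} {t : ℝ}
    (hd : ∀ s θ, cpt c s θ ∈ Ω → HasDerivAt (fun s => g (cpt c s θ)) (G (cpt c s θ)) s)
    (hs : sphere c (exp t) ⊆ Ω) : HasDerivAt (cm c g) (cm c G t) t := by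
  set V : Set (ℝ × ℝ) := (fun p : ℝ × ℝ => cpt c p.1 p.2) ⁻¹' Ω with hV
  have hVo : IsOpen V := hΩ.preimage (continuous_cpt_uncurry c)
  have hK : IsCompact (({t} : Set ℝ) ×ˢ Set.Icc (-π) π) := isCompact_singleton.prod isCompact_Icc
  have hKV : (({t} : Set ℝ) ×ˢ Set.Icc (-π) π) ⊆ V := by
    rintro ⟨s, θ⟩ ⟨h1, -⟩
    simp only [Set.mem_singleton_iff] at h1
    subst h1
    exact hs (cpt_mem_sphere c s θ)
  obtain ⟨δ, hδ, hsub⟩ := hK.exists_cthickening_subset_open hVo hKV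
  have hcomp : IsCompact (cthickening δ (({t} : Set ℝ) ×ˢ Set.Icc (-π) π)) := hK.cthickening
  have hcont : ContinuousOn (fun p : ℝ × ℝ => G (cpt c p.1 p.2))
      (cthickening δ (({t} : Set ℝ) ×ˢ Set.Icc (-π) π)) :=
    kG.comp (continuous_cpt_uncurry c).continuousOn hsub
  obtain ⟨C, hC⟩ := hcomp.exists_bound_of_continuousOn hcont
  have hmem : ∀ θ ∈ Set.uIoc (-π) π, ∀ s ∈ ball t δ,
      (s, θ) ∈ cthickening δ (({t} : Set ℝ) ×ˢ Set.Icc (-π) π) := by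
    intro θ hθ s hs'
    rw [Set.uIoc_of_le (by linarith [pi_pos])] at hθ
    refine mem_cthickening_of_dist_le (s, θ) (t, θ) δ _ ⟨rfl, hθ.1.le, hθ.2⟩ ?_
    rw [Prod.dist_eq]
    simp [(mem_ball.1 hs').le]
  have hm : ∀ᶠ s in 𝓝 t, AEStronglyMeasurable (fun θ => g (cpt c s θ))
      (volume.restrict (Set.uIoc (-π) π)) := by
    filter_upwards [ball_mem_nhds t hδ] with s hs'
    refine ContinuousOn.aestronglyMeasurable (fun θ hθ => ?_) measurableSet_uIoc
    have : ContinuousAt g (cpt c s θ) :=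
      hg.continuousAt (hΩ.mem_nhds (hsub (hmem θ hθ s hs')))
    exact (this.comp (f := cpt c s) (continuous_cpt c s).continuousAt).continuousWithinAt
  have hm' := (continuous_comp_cpt (kG.mono hs)).aestronglyMeasurable
    (μ := volume.restrict (Set.uIoc (-π) π))
  have key := intervalIntegral.hasDerivAt_integral_of_dominated_loc_of_deriv_le
    (F := fun s θ => g (cpt c s θ)) (F' := fun s θ => G (cpt c s θ)) (x₀ := t) (a := -π) (b := π)
    (μ := volume) (bound := fun _ => C) (ball_mem_nhds t hδ)
    hm
    (intervalIntegrable_comp_cpt (hg.mono hs))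
    hm'
    (ae_of_all _ fun θ hθ s hs' => hC _ (hmem θ hθ s hs'))
    intervalIntegrable_const
    (ae_of_all _ fun θ hθ s hs' => hd s θ (hsub (hmem θ hθ s hs')))
  exact key.2

lemma hasDerivAt_cm {g : ℂ → ℂ} {Ω : Set ℂ} (hΩ : IsOpen Ω) (hg : ContDiffOn ℝ 1 g Ω)
    {c : ℂ} {t : ℝ} (hs : sphere c (exp t) ⊆ Ω) :
    HasDerivAt (cm c g) (2 * cm c (fun z => (z - c) * dz g z) t) t := by
  have k1 : ContinuousOn (dz g) Ω := (ContDiffOn.dz (k := 0) hΩ (by simpa using hg)).continuousOn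
  have k2 : ContinuousOn (dzb g) Ω := (ContDiffOn.dzb (k := 0) hΩ (by simpa using hg)).continuousOn
  set G : ℂ → ℂ := fun z => (z - c) * dz g z + starRingEnd ℂ (z - c) * dzb g z with hG
  have k3 : ContinuousOn (fun z => (z - c) * dz g z) Ω :=
    (continuousOn_id.sub continuousOn_const).mul k1
  have k4 : ContinuousOn (fun z => starRingEnd ℂ (z - c) * dzb g z) Ω :=
    (Complex.continuous_conj.comp_continuousOn (continuousOn_id.sub continuousOn_const)).mul k2
  have kG : ContinuousOn G Ω := k3.add k4
  have hd : ∀ s θ, cpt c s θ ∈ Ω → HasDerivAt (fun s => g (cpt c s θ)) (G (cpt c s θ)) s := by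
    intro s θ h
    have hgd : DifferentiableAt ℝ g (cpt c s θ) :=
      ContDiffOn.differentiableAt_of_isOpen (k := 0) hΩ (by simpa using hg) h
    have := hgd.hasFDerivAt.comp_hasDerivAt s (hasDerivAt_cpt_fst c s θ)
    refine this.congr_deriv ?_
    rw [fderiv_eq_wirtinger]
  have h3 : cm c G t = 2 * cm c (fun z => (z - c) * dz g z) t := by
    rw [hG, cm_add (k3.mono hs) (k4.mono hs), ← cm_dz_eq_cm_dzb hΩ hg hs]; ring
  rw [← h3]
  exact hasDerivAt_cm_of_hasDerivAt hΩ hg.continuousOn kG hd hs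

lemma cpt_log {r : ℝ} (hr : 0 < r) (c : ℂ) (θ : ℝ) :
    cpt c (Real.log r) θ = Complex.polarCoord.symm (r, θ) + c := by
  rw [Complex.polarCoord_symm_apply, cpt, Complex.exp_add, ← Complex.ofReal_exp, Real.exp_log hr,
    Complex.exp_mul_I]
  push_cast; ring

lemma integrableOn_polarCoord_symm {E : Type*} [NormedAddCommGroup E] [NormedSpace ℝ E]
    {f : ℂ → E} (hf : Integrable f) :
    IntegrableOn (fun p : ℝ × ℝ => p.1 • f (Complex.polarCoord.symm p)) polarCoord.target := by
  have h1 : Integrable (fun p : ℝ × ℝ => f (Complex.measurableEquivRealProd.symm p)) :=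
    (Complex.volume_preserving_equiv_real_prod.symm).integrable_comp_of_integrable hf
  have h2 : IntegrableOn (fun p : ℝ × ℝ => f (Complex.measurableEquivRealProd.symm p))
      (polarCoord.symm '' polarCoord.target) := h1.integrableOn
  rw [integrableOn_image_iff_integrableOn_abs_det_fderiv_smul volume
    polarCoord.open_target.measurableSet
    (fun p _ => (hasFDerivAt_polarCoord_symm p).hasFDerivWithinAt) polarCoord.symm.injOn] at h2
  refine h2.congr_fun (fun p hp => ?_) polarCoord.open_target.measurableSet
  have : 0 < p.1 := hp.1
  simp only [det_fderivPolarCoordSymm, abs_of_pos this]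
  rfl

/-- Integration in logarithmic polar coordinates. -/
lemma integrable_integral_cm {E : Type*} [NormedAddCommGroup E] [NormedSpace ℝ E]
    {f : ℂ → E} (hf : Integrable f) (c : ℂ) :
    Integrable (fun t => exp (2 * t) • cm c f t) ∧ ∫ t, exp (2 * t) • cm c f t = ∫ z, f z := by
  set F : ℂ → E := fun z => f (z + c) with hF
  have hFi : Integrable F := hf.comp_add_right c
  have hFe : ∫ z, F z = ∫ z, f z := integral_add_right_eq_self f c
  have hi := integrableOn_polarCoord_symm hFi
  have he := Complex.integral_comp_polarCoord_symm F
  rw [polarCoord_target] at hi he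
  rw [Measure.volume_eq_prod, IntegrableOn, ← Measure.prod_restrict] at hi
  rw [Measure.volume_eq_prod, ← Measure.prod_restrict, integral_prod _ hi] at he
  have hi2 := hi.integral_prod_left
  have hin : ∀ r ∈ Set.Ioi (0:ℝ), (∫ θ in Set.Ioo (-π) π, r • F (Complex.polarCoord.symm (r, θ)))
      = r • cm c f (Real.log r) := by
    intro r hr
    rw [integral_smul, cm, intervalIntegral.integral_of_le (by linarith [pi_pos]),
      integral_Ioc_eq_integral_Ioo]
    simp only [cpt_log hr, hF]
  have hi3 : IntegrableOn (fun r => r • cm c f (Real.log r)) (Set.Ioi 0) :=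
    IntegrableOn.congr_fun hi2 hin measurableSet_Ioi
  have he3 : ∫ r in Set.Ioi (0:ℝ), r • cm c f (Real.log r) = ∫ z, f z := by
    rw [← hFe, ← he]
    exact (setIntegral_congr_fun measurableSet_Ioi hin).symm
  have him : Real.exp '' Set.univ = Set.Ioi 0 := by rw [Set.image_univ, Real.range_exp]
  rw [← him] at hi3 he3
  have hder : ∀ x ∈ Set.univ, HasDerivWithinAt Real.exp (Real.exp x) Set.univ x :=
    fun x _ => (Real.hasDerivAt_exp x).hasDerivWithinAt
  rw [integrableOn_image_iff_integrableOn_abs_deriv_smul MeasurableSet.univ hder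
    Real.exp_injective.injOn, integrableOn_univ] at hi3
  rw [integral_image_eq_integral_abs_deriv_smul MeasurableSet.univ hder
    Real.exp_injective.injOn, setIntegral_univ] at he3
  have hfin : (fun x => |Real.exp x| • Real.exp x • cm c f (Real.log (Real.exp x)))
      = fun t => exp (2 * t) • cm c f t := by
    ext t
    rw [abs_of_pos (Real.exp_pos t), Real.log_exp, smul_smul, ← Real.exp_add, two_mul]
  rw [hfin] at hi3 he3
  exact ⟨hi3, he3⟩

/-- If the circle means of a nonnegative function are at least `2 π a`, its integral over the disc
is at least `π R² a`. -/
lemma le_setIntegral_ball_of_cm {f : ℂ → ℝ} {c : ℂ} {R a : ℝ} (hR : 0 < R)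
    (hf : IntegrableOn f (ball c R)) (h : ∀ t, exp t < R → 2 * π * a ≤ cm c f t) :
    π * R ^ 2 * a ≤ ∫ z in ball c R, f z := by
  have hi : Integrable ((ball c R).indicator f) := hf.integrable_indicator measurableSet_ball
  obtain ⟨h1, h2⟩ := integrable_integral_cm hi c
  rw [integral_indicator measurableSet_ball] at h2
  rw [← h2]
  have hcm : ∀ t, cm c ((ball c R).indicator f) t
      = if t < Real.log R then cm c f t else 0 := by
    intro t
    split_ifs with ht
    · apply cm_congr
      intro z hz
      refine Set.indicator_of_mem ?_ _
      rw [mem_ball, mem_sphere.1 hz]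
      exact (Real.lt_log_iff_exp_lt hR).1 ht
    · have : ∀ z ∈ sphere c (exp t), (ball c R).indicator f z = (fun _ => (0:ℝ)) z := by
        intro z hz
        refine Set.indicator_of_notMem ?_ _
        rw [mem_ball, mem_sphere.1 hz, ← Real.lt_log_iff_exp_lt hR]
        exact ht
      rw [cm_congr this, cm_const, smul_zero]
  have h3 : ∀ t, (Set.Iio (Real.log R)).indicator (fun t => 2 * π * a * exp (2 * t)) t
      ≤ exp (2 * t) • cm c ((ball c R).indicator f) t := by
    intro t
    rw [hcm, smul_eq_mul]
    by_cases ht : t < Real.log R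
    · rw [Set.indicator_of_mem (Set.mem_Iio.2 ht), if_pos ht, mul_comm]
      exact mul_le_mul_of_nonneg_left (h t ((Real.lt_log_iff_exp_lt hR).1 ht)) (exp_pos _).le
    · rw [Set.indicator_of_notMem (by simpa using ht), if_neg ht, mul_zero]
  have h4 : IntegrableOn (fun t => 2 * π * a * exp (2 * t)) (Set.Iic (Real.log R)) :=
    (integrableOn_exp_mul_Iic two_pos _).const_mul _
  have h4' := h4.mono_set Set.Iio_subset_Iic_self
  refine le_trans (le_of_eq ?_) (integral_mono (h4'.integrable_indicator measurableSet_Iio) h1 h3)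
  rw [integral_indicator measurableSet_Iio, ← integral_Iic_eq_integral_Iio, integral_const_mul,
    integral_exp_mul_Iic two_pos, mul_comm 2 (Real.log R), Real.exp_mul, Real.exp_log hR]
  norm_num; ring

/-- If the circle means of a nonnegative function are at most `B`, its integral over an annulus
is at most `Bb²/2`. -/
lemma setIntegral_annulus_le {f : ℂ → ℝ} {c : ℂ} {a b B : ℝ} (hb : 0 < b)
    (hB : 0 ≤ B)
    (hf : IntegrableOn f (ball c b \ closedBall c a))
    (h : ∀ t, a < exp t → exp t < b → cm c f t ≤ B) :
    ∫ z in ball c b \ closedBall c a, f z ≤ B * b ^ 2 / 2 := by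
  have hms : MeasurableSet (ball c b \ closedBall c a) :=
    measurableSet_ball.diff measurableSet_closedBall
  have hi : Integrable ((ball c b \ closedBall c a).indicator f) := hf.integrable_indicator hms
  obtain ⟨h1, h2⟩ := integrable_integral_cm hi c
  rw [integral_indicator hms] at h2
  rw [← h2]
  have hcm : ∀ t, cm c ((ball c b \ closedBall c a).indicator f) t
      = if a < exp t ∧ exp t < b then cm c f t else 0 := by
    intro t
    split_ifs with ht
    · apply cm_congr
      intro z hz
      refine Set.indicator_of_mem ?_ _
      rw [Set.mem_sdiff, mem_ball, mem_closedBall, mem_sphere.1 hz]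
      exact ⟨ht.2, not_le.2 ht.1⟩
    · have : ∀ z ∈ sphere c (exp t),
          (ball c b \ closedBall c a).indicator f z = (fun _ => (0:ℝ)) z := by
        intro z hz
        refine Set.indicator_of_notMem ?_ _
        rw [Set.mem_sdiff, mem_ball, mem_closedBall, mem_sphere.1 hz, not_le]
        exact fun h => ht ⟨h.2, h.1⟩
      rw [cm_congr this, cm_const, smul_zero]
  have h3 : ∀ t, exp (2 * t) • cm c ((ball c b \ closedBall c a).indicator f) t ≤
      (Set.Iic (Real.log b)).indicator (fun t => B * exp (2 * t)) t := by
    intro t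
    rw [hcm, smul_eq_mul]
    by_cases ht : a < exp t ∧ exp t < b
    · rw [Set.indicator_of_mem (Set.mem_Iic.2 ((Real.lt_log_iff_exp_lt hb).2 ht.2).le),
        if_pos ht, mul_comm]
      exact mul_le_mul_of_nonneg_right (h t ht.1 ht.2) (exp_pos _).le
    · rw [if_neg ht, mul_zero]
      exact Set.indicator_nonneg (fun t _ => by positivity) _
  have h4 : IntegrableOn (fun t => B * exp (2 * t)) (Set.Iic (Real.log b)) :=
    (integrableOn_exp_mul_Iic two_pos _).const_mul _
  refine le_trans (integral_mono h1 (h4.integrable_indicator measurableSet_Iic) h3) (le_of_eq ?_)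
  rw [integral_indicator measurableSet_Iic, integral_const_mul,
    integral_exp_mul_Iic two_pos, mul_comm 2 (Real.log b), Real.exp_mul, Real.exp_log hb]
  norm_num; ring

section
variable {f : ℂ → ℂ} {Ω : Set ℂ}

lemma ContDiffOn.continuousOn_dz (hf : ContDiffOn ℝ 1 f Ω) (hΩ : IsOpen Ω) :
    ContinuousOn (_root_.dz f) Ω := (ContDiffOn.dz (k := 0) hΩ (by simpa using hf)).continuousOn

lemma ContDiffOn.continuousOn_dzb (hf : ContDiffOn ℝ 1 f Ω) (hΩ : IsOpen Ω) :
    ContinuousOn (_root_.dzb f) Ω := (ContDiffOn.dzb (k := 0) hΩ (by simpa using hf)).continuousOn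

lemma ContDiffOn.dz_two (hf : ContDiffOn ℝ 2 f Ω) (hΩ : IsOpen Ω) :
    ContDiffOn ℝ 1 (_root_.dz f) Ω :=
  ContDiffOn.dz (k := 1) hΩ (by norm_num; exact hf)

lemma ContDiffOn.dz_three (hf : ContDiffOn ℝ 3 f Ω) (hΩ : IsOpen Ω) :
    ContDiffOn ℝ 2 (_root_.dz f) Ω :=
  ContDiffOn.dz (k := 2) hΩ (by norm_num; exact hf)

lemma ContDiffOn.dzb_three (hf : ContDiffOn ℝ 3 f Ω) (hΩ : IsOpen Ω) :
    ContDiffOn ℝ 2 (_root_.dzb f) Ω :=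
  ContDiffOn.dzb (k := 2) hΩ (by norm_num; exact hf)

lemma ContDiffOn.differentiableAt_of_mem {E F : Type*} [NormedAddCommGroup E] [NormedSpace ℝ E]
    [NormedAddCommGroup F] [NormedSpace ℝ F] {g : E → F} {Ω : Set E}
    (hg : ContDiffOn ℝ 1 g Ω) (hΩ : IsOpen Ω) {z : E} (hz : z ∈ Ω) : DifferentiableAt ℝ g z :=
  (hg.contDiffAt (hΩ.mem_nhds hz)).differentiableAt one_ne_zero

end

lemma ContDiffOn.complexOfReal {u : ℂ → ℝ} {Ω : Set ℂ} {k : WithTop ℕ∞} (hu : ContDiffOn ℝ k u Ω) :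
    ContDiffOn ℝ k (fun z => (u z : ℂ)) Ω :=
  Complex.ofRealCLM.contDiff.comp_contDiffOn hu

/-- The Laplacian of a real function on the complex plane. -/
def lapC (u : ℂ → ℝ) (z : ℂ) : ℝ := (4 * dzb (dz (fun w => (u w : ℂ))) z).re

/-- The logarithmic radial derivative of the circle means. -/
def cmd (c : ℂ) (u : ℂ → ℝ) (t : ℝ) : ℝ :=
  2 * (cm c (fun z => (z - c) * dz (fun w => (u w : ℂ)) z) t).re

section
variable {u : ℂ → ℝ} {Ω : Set ℂ} {c : ℂ} {t : ℝ}

lemma ofReal_lapC (hΩ : IsOpen Ω) (hu : ContDiffOn ℝ 2 u Ω) {z : ℂ} (hz : z ∈ Ω) :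
    (lapC u z : ℂ) = 4 * dzb (dz (fun w => (u w : ℂ))) z := by
  have hC := hu.complexOfReal
  have h1 : DifferentiableAt ℝ (dz (fun w => (u w : ℂ))) z :=
    (hC.dz_two hΩ).differentiableAt_of_mem hΩ hz
  have h2 : (fun w => starRingEnd ℂ (dz (fun w => (u w : ℂ)) w)) =ᶠ[𝓝 z]
      dzb (fun w => (u w : ℂ)) := by
    filter_upwards [hΩ.mem_nhds hz] with w hw
    exact dz_ofReal u ((hu.of_le (by norm_num)).differentiableAt_of_mem hΩ hw)
  have h3 : starRingEnd ℂ (dzb (dz (fun w => (u w : ℂ))) z) = dzb (dz (fun w => (u w : ℂ))) z := by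
    rw [← dz_conj h1, dz_eq_of_eventuallyEq h2, dz_dzb_comm hΩ hC hz]
  rw [lapC]
  refine Complex.conj_eq_iff_re.1 ?_
  rw [map_mul, h3, map_ofNat]

lemma continuousOn_lapC (hΩ : IsOpen Ω) (hu : ContDiffOn ℝ 2 u Ω) : ContinuousOn (lapC u) Ω :=
  Complex.continuous_re.comp_continuousOn
    (continuousOn_const.mul ((hu.complexOfReal.dz_two hΩ).continuousOn_dzb hΩ))

lemma hasDerivAt_re_comp {f : ℝ → ℂ} {f' : ℂ} {t : ℝ} (h : HasDerivAt f f' t) :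
    HasDerivAt (fun s => (f s).re) f'.re t :=
  Complex.reCLM.hasFDerivAt.comp_hasDerivAt t h

lemma hasDerivAt_cm_real (hΩ : IsOpen Ω) (hu : ContDiffOn ℝ 1 u Ω)
    (hs : sphere c (exp t) ⊆ Ω) : HasDerivAt (cm c u) (cmd c u t) t := by
  have h := hasDerivAt_re_comp (hasDerivAt_cm hΩ hu.complexOfReal hs)
  have h2 : (fun s => (cm c (fun z => (u z : ℂ)) s).re) = cm c u := by
    ext s; rw [cm_ofReal, Complex.ofReal_re]
  rw [h2] at h
  exact h.congr_deriv (by simp [cmd])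

lemma contDiffOn_mul_sub {p : ℂ → ℂ} (hp : ContDiffOn ℝ 1 p Ω) (c : ℂ) :
    ContDiffOn ℝ 1 (fun z => (z - c) * p z) Ω :=
  (contDiffOn_id.sub contDiffOn_const).mul hp

lemma dzb_holomorphic_mul {g p : ℂ → ℂ} {z : ℂ} (hg : DifferentiableAt ℂ g z)
    (hp : DifferentiableAt ℝ p z) : dzb (fun w => g w * p w) z = g z * dzb p z := by
  rw [dzb_mul (hg.restrictScalars ℝ) hp, dzb_of_holomorphic hg]; simp

/-- The logarithmic radial derivative of circle means of `(z - c) p`. -/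
lemma hasDerivAt_cm_sub_mul (hΩ : IsOpen Ω) {p : ℂ → ℂ} (hp : ContDiffOn ℝ 1 p Ω)
    (hs : sphere c (exp t) ⊆ Ω) :
    HasDerivAt (cm c (fun z => (z - c) * p z)) (2 * exp (2 * t) * cm c (dzb p) t) t := by
  have h1 := contDiffOn_mul_sub hp c
  have h := hasDerivAt_cm hΩ h1 hs
  rw [cm_dz_eq_cm_dzb hΩ h1 hs] at h
  refine h.congr_deriv ?_
  rw [mul_assoc, ← cm_const_mul (exp (2 * t) : ℂ)]
  congr 1
  apply cm_congr
  intro z hz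
  have hd : DifferentiableAt ℂ (fun w : ℂ => w - c) z := by fun_prop
  rw [dzb_holomorphic_mul hd (hp.differentiableAt_of_mem hΩ (hs hz)), ← mul_assoc,
    mul_comm (starRingEnd ℂ (z - c)), Complex.mul_conj, Complex.normSq_eq_norm_sq,
    ← dist_eq_norm, mem_sphere.1 hz, two_mul, Real.exp_add, ← pow_two]

lemma hasDerivAt_cmd (hΩ : IsOpen Ω) (hu : ContDiffOn ℝ 2 u Ω)
    (hs : sphere c (exp t) ⊆ Ω) :
    HasDerivAt (cmd c u) (exp (2 * t) * cm c (lapC u) t) t := by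
  have hp := hu.complexOfReal.dz_two hΩ
  have h := (hasDerivAt_re_comp (hasDerivAt_cm_sub_mul hΩ hp hs)).const_mul 2
  refine h.congr_deriv ?_
  have h4 : 4 * cm c (dzb (dz (fun w => (u w : ℂ)))) t = ((cm c (lapC u) t : ℝ) : ℂ) := by
    rw [← cm_const_mul, ← cm_ofReal]
    exact cm_congr fun z hz => (ofReal_lapC hΩ hu (hs hz)).symm
  have h5 := congrArg Complex.re h4
  rw [Complex.ofReal_re] at h5
  rw [← h5, show (2 : ℂ) * (exp (2 * t) : ℂ) = ((2 * exp (2 * t) : ℝ) : ℂ) by push_cast; ring,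
    Complex.re_ofReal_mul, show (4 : ℂ) = ((4 : ℝ) : ℂ) by norm_num, Complex.re_ofReal_mul]
  ring

end

/-- The circle means tend to the value at the centre. -/
lemma tendsto_cm_atBot {E : Type*} [NormedAddCommGroup E] [NormedSpace ℝ E] [CompleteSpace E]
    {g : ℂ → E} {c : ℂ} {R : ℝ} (hR : 0 < R) (hg : ContinuousOn g (ball c R)) :
    Tendsto (cm c g) atBot (𝓝 ((2 * π) • g c)) := by
  rw [Metric.tendsto_nhds]
  intro ε hε
  have hc : ContinuousAt g c := hg.continuousAt (ball_mem_nhds c hR)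
  obtain ⟨δ, hδ, h⟩ := Metric.continuousAt_iff.1 hc (ε / (4 * π)) (by positivity)
  filter_upwards [(tendsto_exp_atBot).eventually (gt_mem_nhds hδ),
    (tendsto_exp_atBot).eventually (gt_mem_nhds hR)] with t ht ht2
  have hsub : sphere c (exp t) ⊆ ball c R := fun z hz => by
    rw [mem_ball, mem_sphere.1 hz]; exact ht2
  rw [dist_eq_norm, ← cm_const (c := c) (t := t), ← cm_sub (hg.mono hsub) continuousOn_const]
  refine (norm_cm_le (C := ε / (4 * π)) fun z hz => ?_).trans_lt ?_
  · rw [← dist_eq_norm]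
    exact (h (by rw [mem_sphere.1 hz]; exact ht)).le
  · have := pi_pos
    rw [show 2 * π * (ε / (4 * π)) = ε / 2 by field_simp; ring]; linarith

lemma sphere_subset_ball' {c : ℂ} {R t : ℝ} (h : exp t < R) : sphere c (exp t) ⊆ ball c R :=
  fun z hz => by rw [mem_ball, mem_sphere.1 hz]; exact h

lemma tendsto_cm_sub_mul_atBot {g : ℂ → ℂ} {c : ℂ} {R : ℝ} (hR : 0 < R)
    (hg : ContinuousOn g (ball c R)) :
    Tendsto (cm c (fun z => (z - c) * g z)) atBot (𝓝 0) := by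
  have := tendsto_cm_atBot hR (g := fun z => (z - c) * g z)
    ((continuousOn_id.sub continuousOn_const).mul hg)
  simpa using this

lemma monotoneOn_Iio_of_hasDerivAt {f f' : ℝ → ℝ} {a : ℝ} (h : ∀ s < a, HasDerivAt f (f' s) s)
    (h0 : ∀ s < a, 0 ≤ f' s) : MonotoneOn f (Set.Iio a) := by
  apply monotoneOn_of_deriv_nonneg (convex_Iio _)
  · exact fun s hs => (h s hs).continuousAt.continuousWithinAt
  · intro s hs
    rw [interior_Iio] at hs
    exact (h s hs).differentiableAt.differentiableWithinAt
  · intro s hs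
    rw [interior_Iio] at hs
    rw [(h s hs).deriv]
    exact h0 s hs

lemma le_of_monotoneOn_Iio_of_tendsto {f : ℝ → ℝ} {a l t : ℝ} (hf : MonotoneOn f (Set.Iio a))
    (hl : Tendsto f atBot (𝓝 l)) (ht : t < a) : l ≤ f t := by
  refine le_of_tendsto hl ?_
  filter_upwards [eventually_le_atBot t] with s hs
  exact hf (hs.trans_lt ht) ht hs

lemma cm_nonneg {f : ℂ → ℝ} {c : ℂ} {t : ℝ} (h : ∀ z ∈ sphere c (exp t), 0 ≤ f z) :
    0 ≤ cm c f t :=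
  intervalIntegral.integral_nonneg (by linarith [pi_pos]) fun θ _ => h _ (cpt_mem_sphere c t θ)

/-- The logarithmic radial derivative of circle means of a subharmonic function is nonnegative. -/
lemma cmd_nonneg {u : ℂ → ℝ} {c : ℂ} {R : ℝ} (hu : ContDiffOn ℝ 2 u (ball c R))
    (hl : ∀ z ∈ ball c R, 0 ≤ lapC u z) {t : ℝ} (ht : exp t < R) : 0 ≤ cmd c u t := by
  have hR : 0 < R := (exp_pos t).trans ht
  have hsub : ∀ s < Real.log R, sphere c (exp s) ⊆ ball c R := fun s hs =>
    sphere_subset_ball' ((Real.lt_log_iff_exp_lt hR).1 hs)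
  have hmono : MonotoneOn (cmd c u) (Set.Iio (Real.log R)) :=
    monotoneOn_Iio_of_hasDerivAt (fun s hs => hasDerivAt_cmd isOpen_ball hu (hsub s hs))
      fun s hs => mul_nonneg (exp_pos _).le (cm_nonneg fun z hz => hl z (hsub s hs hz))
  refine le_of_monotoneOn_Iio_of_tendsto hmono ?_ ((Real.lt_log_iff_exp_lt hR).2 ht)
  have h1 := tendsto_cm_sub_mul_atBot hR
    ((hu.of_le (by norm_num)).complexOfReal.continuousOn_dz isOpen_ball)
  have h2 := ((Complex.continuous_re.tendsto 0).comp h1).const_mul 2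
  simp only [Complex.zero_re, mul_zero] at h2
  exact h2

/-- Sub-mean value property. -/
lemma le_cm_of_subharmonic {u : ℂ → ℝ} {c : ℂ} {R : ℝ} (hu : ContDiffOn ℝ 2 u (ball c R))
    (hl : ∀ z ∈ ball c R, 0 ≤ lapC u z) {t : ℝ} (ht : exp t < R) : 2 * π * u c ≤ cm c u t := by
  have hR : 0 < R := (exp_pos t).trans ht
  have hmono : MonotoneOn (cm c u) (Set.Iio (Real.log R)) :=
    monotoneOn_Iio_of_hasDerivAt (fun s hs => hasDerivAt_cm_real isOpen_ball
      (hu.of_le (by norm_num)) (sphere_subset_ball' ((Real.lt_log_iff_exp_lt hR).1 hs)))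
      fun s hs => cmd_nonneg hu hl ((Real.lt_log_iff_exp_lt hR).1 hs)
  exact le_of_monotoneOn_Iio_of_tendsto hmono (tendsto_cm_atBot hR hu.continuousOn)
    ((Real.lt_log_iff_exp_lt hR).2 ht)

/-- Some circle mean of `∂p` is controlled by the size of `p`. -/
lemma exists_re_cm_dz_le {p : ℂ → ℂ} {c : ℂ} {R G : ℝ} (hR : 0 < R)
    (hp : ContDiffOn ℝ 1 p (ball c R)) (hG : ∀ z ∈ ball c R, ‖p z‖ ≤ G) (ω : ℂ) (hω : ‖ω‖ = 1) :
    ∃ t, exp t < R / 2 ∧ (ω * cm c (dz p) t).re ≤ 2 * π * (9 * G / R) := by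
  have hG0 : 0 ≤ G := (norm_nonneg _).trans (hG c (mem_ball_self hR))
  have hconjC : ContDiff ℝ 1 (fun z : ℂ => starRingEnd ℂ (z - c)) :=
    Complex.conjCLE.contDiff.comp (contDiff_id.sub contDiff_const)
  set q : ℂ → ℂ := fun z => starRingEnd ℂ (z - c) * p z with hq
  have hqC : ContDiffOn ℝ 1 q (ball c R) := hconjC.contDiffOn.mul hp
  have hder : ∀ t, exp t < R → HasDerivAt (fun s => (ω * cm c q s).re)
      (2 * exp (2 * t) * (ω * cm c (dz p) t).re) t := by
    intro t ht
    have hs := sphere_subset_ball' (c := c) ht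
    have h1 := hasDerivAt_re_comp ((hasDerivAt_cm isOpen_ball hqC hs).const_mul ω)
    refine h1.congr_deriv ?_
    have h2 : cm c (fun z => (z - c) * dz q z) t = (exp (2 * t) : ℝ) * cm c (dz p) t := by
      rw [← cm_const_mul]
      apply cm_congr
      intro z hz
      have hd : DifferentiableAt ℂ (fun w : ℂ => w - c) z := by fun_prop
      have hd2 := differentiableAt_conj (hd.restrictScalars ℝ)
      rw [hq, dz_mul hd2 (hp.differentiableAt_of_mem isOpen_ball (hs hz)),
        dz_conj (hd.restrictScalars ℝ), dzb_of_holomorphic hd, map_zero, zero_mul, zero_add,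
        ← mul_assoc, Complex.mul_conj, Complex.normSq_eq_norm_sq,
        ← dist_eq_norm, mem_sphere.1 hz, two_mul, Real.exp_add, ← pow_two]
    rw [h2, show ω * (2 * (((exp (2 * t) : ℝ) : ℂ) * cm c (dz p) t))
      = ((2 * exp (2 * t) : ℝ) : ℂ) * (ω * cm c (dz p) t) by push_cast; ring,
      Complex.re_ofReal_mul]
  have hb : ∀ t, exp t < R → |(ω * cm c q t).re| ≤ 2 * π * (exp t * G) := by
    intro t ht
    refine (Complex.abs_re_le_norm _).trans ?_
    rw [norm_mul, hω, one_mul]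
    refine norm_cm_le fun z hz => ?_
    rw [norm_mul, RCLike.norm_conj, ← dist_eq_norm, mem_sphere.1 hz]
    exact mul_le_mul_of_nonneg_left (hG z (sphere_subset_ball' ht hz)) (exp_pos t).le
  have he1 : exp (Real.log (R / 4)) = R / 4 := Real.exp_log (by positivity)
  have he2 : exp (Real.log (R / 2)) = R / 2 := Real.exp_log (by positivity)
  have hlt : Real.log (R / 4) < Real.log (R / 2) := Real.log_lt_log (by positivity) (by linarith)
  have hin : ∀ t ≤ Real.log (R / 2), exp t < R := fun t ht =>
    (exp_le_exp.2 ht).trans_lt (by rw [he2]; linarith)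
  obtain ⟨t, ht, hslope⟩ := exists_hasDerivAt_eq_slope (fun s => (ω * cm c q s).re)
    (fun t => 2 * exp (2 * t) * (ω * cm c (dz p) t).re) hlt
    (fun s hs => (hder s (hin s hs.2)).continuousAt.continuousWithinAt)
    (fun s hs => hder s (hin s hs.2.le))
  refine ⟨t, by rw [← he2]; exact exp_lt_exp.2 ht.2, ?_⟩
  have hdiff : Real.log (R / 2) - Real.log (R / 4) = Real.log 2 := by
    rw [← Real.log_div (by positivity) (by positivity)]; congr 1; field_simp; norm_num
  rw [hdiff] at hslope
  have hl2 := Real.log_two_gt_d9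
  have h1 := abs_le.1 (hb _ (hin _ le_rfl))
  have h2 := abs_le.1 (hb _ (hin _ hlt.le))
  rw [he2] at h1
  rw [he1] at h2
  have het : R / 4 < exp t := by rw [← he1]; exact exp_lt_exp.2 ht.1
  have hexp : exp (2 * t) = exp t ^ 2 := by rw [two_mul, Real.exp_add, pow_two]
  set X := (ω * cm c (dz p) t).re
  by_cases hX : X ≤ 0
  · exact hX.trans (by have := pi_pos; positivity)
  push Not at hX
  rw [eq_div_iff (by positivity), hexp] at hslope
  have h3 : 2 * (R / 4) ^ 2 * X * Real.log 2 ≤ 2 * exp t ^ 2 * X * Real.log 2 := by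
    have : 0 ≤ Real.log 2 := by positivity
    gcongr
  have h4 : 2 * (R / 4) ^ 2 * X * (2 / 3) ≤ 2 * (R / 4) ^ 2 * X * Real.log 2 := by
    gcongr; linarith
  have h5 : 2 * (R / 4) ^ 2 * X * (2 / 3) ≤ 2 * π * (3 / 4 * R * G) := by linarith
  rw [show 2 * π * (9 * G / R) = (2 * π * (9 * G * R)) / R ^ 2 by field_simp,
    le_div_iff₀ (by positivity)]
  nlinarith

/-- Interior gradient estimate. -/
lemma norm_dz_le {u : ℂ → ℝ} {c : ℂ} {R M K a : ℝ} (hR : 0 < R)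
    (hu : ContDiffOn ℝ 2 u (ball c R)) (hM : ∀ z ∈ ball c R, |u z - a| ≤ M)
    (hK : ∀ z ∈ ball c R, |lapC u z| ≤ K) :
    ‖dz (fun w => (u w : ℂ)) c‖ ≤ 9 * M / R + K * R / 4 := by
  set p := dz (fun w => (u w : ℂ)) with hpdef
  have hK0 : 0 ≤ K := (abs_nonneg _).trans (hK c (mem_ball_self hR))
  have hM0 : 0 ≤ M := (abs_nonneg _).trans (hM c (mem_ball_self hR))
  have hpC : ContDiffOn ℝ 1 p (ball c R) := hu.complexOfReal.dz_two isOpen_ball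
  obtain ⟨ω, hn, hω⟩ := RCLike.exists_norm_eq_mul_self (p c)
  have hωp : (ω * p c).re = ‖p c‖ := by rw [← hω]; exact Complex.ofReal_re _
  have hv : ∀ z, dz (fun w => (u w : ℂ) - a) z = p z := by
    intro z
    simp only [hpdef, dz, fderiv_sub_const]
  obtain ⟨t, ht, hle⟩ := exists_re_cm_dz_le (p := fun z => (u z : ℂ) - a) hR
    ((hu.of_le (by norm_num)).complexOfReal.sub contDiffOn_const)
    (fun z hz => by rw [← Complex.ofReal_sub, Complex.norm_real]; exact hM z hz) ω hn
  have hcm : cm c (dz (fun w => (u w : ℂ) - a)) t = cm c p t := cm_congr fun z _ => hv z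
  rw [hcm] at hle
  have hlt : exp t < R := by linarith
  have hder : ∀ s < Real.log R, HasDerivAt (fun s => (ω * cm c p s).re + π * K * exp s)
      ((ω * (2 * cm c (fun z => starRingEnd ℂ (z - c) * dzb p z) s)).re + π * K * exp s) s := by
    intro s hs
    have hsub := sphere_subset_ball' (c := c) ((Real.lt_log_iff_exp_lt hR).1 hs)
    have h1 := (hasDerivAt_cm isOpen_ball hpC hsub).const_mul ω
    rw [cm_dz_eq_cm_dzb isOpen_ball hpC hsub] at h1
    exact (hasDerivAt_re_comp h1).add ((Real.hasDerivAt_exp s).const_mul _)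
  have hmono := monotoneOn_Iio_of_hasDerivAt hder (fun s hs => by
    have hsub := sphere_subset_ball' (c := c) ((Real.lt_log_iff_exp_lt hR).1 hs)
    have h1 : ‖cm c (fun z => starRingEnd ℂ (z - c) * dzb p z) s‖
        ≤ 2 * π * (exp s * (K / 4)) := by
      refine norm_cm_le fun z hz => ?_
      rw [norm_mul, RCLike.norm_conj, ← dist_eq_norm, mem_sphere.1 hz]
      refine mul_le_mul_of_nonneg_left ?_ (exp_pos s).le
      have h2 := congrArg norm (ofReal_lapC isOpen_ball hu (hsub hz))
      rw [Complex.norm_real, norm_mul, Real.norm_eq_abs] at h2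
      have h3 := hK z (hsub hz)
      rw [h2] at h3
      norm_num at h3
      linarith
    have h2 := Complex.abs_re_le_norm (ω * (2 * cm c (fun z => starRingEnd ℂ (z - c) * dzb p z) s))
    rw [norm_mul, norm_mul, hn, one_mul, Complex.norm_ofNat] at h2
    have h3 := (abs_le.1 h2).1
    linarith)
  have hlim : Tendsto (fun s => (ω * cm c p s).re + π * K * exp s) atBot
      (𝓝 ((ω * ((2 * π : ℝ) • p c)).re + π * K * 0)) := by
    refine Tendsto.add ?_ (tendsto_exp_atBot.const_mul _)
    exact (Complex.continuous_re.tendsto _).comp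
      ((tendsto_cm_atBot hR hpC.continuousOn).const_mul ω)
  have hfin := le_of_monotoneOn_Iio_of_tendsto hmono hlim ((Real.lt_log_iff_exp_lt hR).2 hlt)
  rw [mul_smul_comm, Complex.smul_re, hωp, smul_eq_mul] at hfin
  have h6 : π * K * exp t ≤ π * K * (R / 2) := by
    have := pi_pos; gcongr
  have hpi := pi_pos
  have h7 : 2 * π * ‖p c‖ ≤ 2 * π * (9 * M / R + K * R / 4) := by
    have : 2 * π * (9 * M / R + K * R / 4) = 2 * π * (9 * M / R) + π * K * (R / 2) := by ring
    linarith
  exact le_of_mul_le_mul_left h7 (by positivity)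

/-- Interior estimate for a holomorphic function of the form `∂p - q`. -/
lemma norm_le_of_dz_eq {p q S : ℂ → ℂ} {c : ℂ} {R G Q : ℝ} (hR : 0 < R)
    (hp : ContDiffOn ℝ 1 p (ball c R)) (hG : ∀ z ∈ ball c R, ‖p z‖ ≤ G)
    (hq : ContinuousOn q (ball c R)) (hQ : ∀ z ∈ ball c R, ‖q z‖ ≤ Q)
    (hS : DifferentiableOn ℂ S (ball c R))
    (hSp : ∀ z ∈ ball c R, S z = dz p z - q z) :
    ‖S c‖ ≤ 9 * G / R + Q := by
  obtain ⟨ω, hn, hω⟩ := RCLike.exists_norm_eq_mul_self (S c)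
  have hωp : (ω * S c).re = ‖S c‖ := by rw [← hω]; exact Complex.ofReal_re _
  have hSC : ContDiffOn ℝ 1 S (ball c R) :=
    (hS.contDiffOn (n := 1) isOpen_ball).restrict_scalars ℝ
  obtain ⟨t, ht, hle⟩ := exists_re_cm_dz_le hR hp hG ω hn
  have hlt : exp t < R := by linarith
  have hder : ∀ s < Real.log R, HasDerivAt (fun s => (ω * cm c S s).re) 0 s := by
    intro s hs
    have hsub := sphere_subset_ball' (c := c) ((Real.lt_log_iff_exp_lt hR).1 hs)
    have h1 := (hasDerivAt_cm isOpen_ball hSC hsub).const_mul ω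
    have h0 : cm c (fun z => starRingEnd ℂ (z - c) * dzb S z) s = cm c (fun _ => (0 : ℂ)) s :=
      cm_congr fun z hz => by
        rw [dzb_of_holomorphic (hS.differentiableAt (isOpen_ball.mem_nhds (hsub hz))), mul_zero]
    rw [cm_dz_eq_cm_dzb isOpen_ball hSC hsub, h0, cm_const, smul_zero, mul_zero, mul_zero] at h1
    exact hasDerivAt_re_comp h1
  have hmono := monotoneOn_Iio_of_hasDerivAt hder (fun s hs => le_rfl)
  have hlim : Tendsto (fun s => (ω * cm c S s).re) atBot (𝓝 ((ω * ((2 * π : ℝ) • S c)).re)) :=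
    (Complex.continuous_re.tendsto _).comp
      ((tendsto_cm_atBot hR hSC.continuousOn).const_mul ω)
  have hfin := le_of_monotoneOn_Iio_of_tendsto hmono hlim ((Real.lt_log_iff_exp_lt hR).2 hlt)
  rw [mul_smul_comm, Complex.smul_re, hωp, smul_eq_mul] at hfin
  have hsub := sphere_subset_ball' (c := c) hlt
  have hcm : cm c S t = cm c (dz p) t - cm c q t := by
    have hc2 : ContinuousOn q (sphere c (exp t)) := hq.mono hsub
    rw [← cm_sub ((hp.continuousOn_dz isOpen_ball).mono hsub) hc2]
    exact cm_congr fun z hz => hSp z (hsub hz)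
  have hsq : ‖cm c q t‖ ≤ 2 * π * Q :=
    norm_cm_le fun z hz => hQ z (hsub hz)
  have h2 := Complex.abs_re_le_norm (ω * cm c q t)
  rw [norm_mul, hn, one_mul] at h2
  have h3 := (abs_le.1 h2).1
  rw [hcm, mul_sub, Complex.sub_re] at hfin
  have h7 : 2 * π * ‖S c‖ ≤ 2 * π * (9 * G / R + Q) := by linarith
  exact le_of_mul_le_mul_left h7 (by have := pi_pos; positivity)

/-- Stokes' formula on a rectangle. -/
lemma rect_stokes {f : ℂ → ℂ} {Ω : Set ℂ} (hΩ : IsOpen Ω) (hf : ContDiffOn ℝ 1 f Ω) {z w : ℂ}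
    (hR : Set.uIcc z.re w.re ×ℂ Set.uIcc z.im w.im ⊆ Ω) :
    (∫ x : ℝ in z.re..w.re, f (x + z.im * Complex.I))
      - (∫ x : ℝ in z.re..w.re, f (x + w.im * Complex.I))
      + Complex.I * (∫ y : ℝ in z.im..w.im, f (w.re + y * Complex.I))
      - Complex.I * (∫ y : ℝ in z.im..w.im, f (z.re + y * Complex.I))
      = ∫ x : ℝ in z.re..w.re, ∫ y : ℝ in z.im..w.im,
          2 * Complex.I * dzb f (x + y * Complex.I) := by
  have he : ∀ p, Complex.I • fderiv ℝ f p 1 - fderiv ℝ f p Complex.I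
      = 2 * Complex.I * dzb f p := by
    intro p
    rw [dzb, smul_eq_mul]
    linear_combination (-fderiv ℝ f p Complex.I) * Complex.I_sq
  have hcpt : IsCompact (Set.uIcc z.re w.re ×ℂ Set.uIcc z.im w.im) :=
    isCompact_uIcc.reProdIm isCompact_uIcc
  have := Complex.integral_boundary_rect_of_differentiableOn_real f z w
    (fun p hp => (hf.differentiableAt_of_mem hΩ (hR hp)).differentiableWithinAt)
    (by
      simp_rw [he]
      exact (continuousOn_const.mul ((hf.continuousOn_dzb hΩ).mono hR)).integrableOn_compact hcpt)
  simp only [he] at this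
  simpa only [smul_eq_mul] using this

lemma hasDerivAt_horizontal {g : ℂ → ℂ} {x y : ℝ}
    (hg : DifferentiableAt ℝ g (x + y * Complex.I)) :
    HasDerivAt (fun s : ℝ => g (s + y * Complex.I))
      (dz g (x + y * Complex.I) + dzb g (x + y * Complex.I)) x := by
  have h1 : HasDerivAt (fun s : ℝ => (s : ℂ) + y * Complex.I) 1 x :=
    (Complex.ofRealCLM.hasDerivAt).add_const _
  refine (hg.hasFDerivAt.comp_hasDerivAt x h1).congr_deriv ?_
  rw [fderiv_eq_wirtinger]; simp

lemma hasDerivAt_vertical {g : ℂ → ℂ} {x y : ℝ}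
    (hg : DifferentiableAt ℝ g (x + y * Complex.I)) :
    HasDerivAt (fun s : ℝ => g (x + s * Complex.I))
      (Complex.I * (dz g (x + y * Complex.I) - dzb g (x + y * Complex.I))) y := by
  have h1 : HasDerivAt (fun s : ℝ => (x : ℂ) + s * Complex.I) Complex.I y := by
    simpa using ((Complex.ofRealCLM.hasDerivAt (x := y)).mul_const Complex.I).const_add (x : ℂ)
  refine (hg.hasFDerivAt.comp_hasDerivAt y h1).congr_deriv ?_
  rw [fderiv_eq_wirtinger, Complex.conj_I]; ring

lemma intervalIntegral_conj (f : ℝ → ℂ) (a b : ℝ) :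
    ∫ x in a..b, starRingEnd ℂ (f x) = starRingEnd ℂ (∫ x in a..b, f x) := by
  simp only [intervalIntegral, integral_conj, map_sub]

/-- The boundary integral of `∂g` on a rectangle. -/
lemma rect_dz {g : ℂ → ℂ} {Ω : Set ℂ} (hΩ : IsOpen Ω) (hg : ContDiffOn ℝ 1 g Ω)
    (hh : ContDiffOn ℝ 1 (dzb g) Ω) {z w : ℂ}
    (hR : Set.uIcc z.re w.re ×ℂ Set.uIcc z.im w.im ⊆ Ω) :
    (∫ x : ℝ in z.re..w.re, dz g (x + z.im * Complex.I))
      - (∫ x : ℝ in z.re..w.re, dz g (x + w.im * Complex.I))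
      + Complex.I * (∫ y : ℝ in z.im..w.im, dz g (w.re + y * Complex.I))
      - Complex.I * (∫ y : ℝ in z.im..w.im, dz g (z.re + y * Complex.I))
      = ∫ x : ℝ in z.re..w.re, ∫ y : ℝ in z.im..w.im,
          2 * Complex.I * dz (dzb g) (x + y * Complex.I) := by
  have mem : ∀ x ∈ Set.uIcc z.re w.re, ∀ y ∈ Set.uIcc z.im w.im, (x + y * Complex.I : ℂ) ∈ Ω := by
    intro x hx y hy
    apply hR
    rw [Complex.mem_reProdIm]
    simpa using ⟨hx, hy⟩
  have c1 := hg.continuousOn_dz hΩ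
  have c2 := hh.continuousOn
  have hor : ∀ {p : ℂ → ℂ}, ContinuousOn p Ω → ∀ y ∈ Set.uIcc z.im w.im,
      IntervalIntegrable (fun x : ℝ => p (x + y * Complex.I)) volume z.re w.re := by
    intro p hp y hy
    refine ContinuousOn.intervalIntegrable (hp.comp ?_ fun x hx => mem x hx y hy)
    fun_prop
  have ver : ∀ {p : ℂ → ℂ}, ContinuousOn p Ω → ∀ x ∈ Set.uIcc z.re w.re,
      IntervalIntegrable (fun y : ℝ => p (x + y * Complex.I)) volume z.im w.im := by
    intro p hp x hx
    refine ContinuousOn.intervalIntegrable (hp.comp ?_ fun y hy => mem x hx y hy)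
    fun_prop
  have H : ∀ y ∈ Set.uIcc z.im w.im, (∫ x : ℝ in z.re..w.re, dz g (x + y * Complex.I))
      + (∫ x : ℝ in z.re..w.re, dzb g (x + y * Complex.I))
      = g (w.re + y * Complex.I) - g (z.re + y * Complex.I) := by
    intro y hy
    rw [← intervalIntegral.integral_add (hor c1 y hy) (hor c2 y hy)]
    exact intervalIntegral.integral_eq_sub_of_hasDerivAt
      (fun x hx => hasDerivAt_horizontal (hg.differentiableAt_of_mem hΩ (mem x hx y hy)))
      ((hor c1 y hy).add (hor c2 y hy))
  have Vt : ∀ x ∈ Set.uIcc z.re w.re, Complex.I * ((∫ y : ℝ in z.im..w.im, dz g (x + y * Complex.I))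
      - (∫ y : ℝ in z.im..w.im, dzb g (x + y * Complex.I)))
      = g (x + w.im * Complex.I) - g (x + z.im * Complex.I) := by
    intro x hx
    rw [← intervalIntegral.integral_sub (ver c1 x hx) (ver c2 x hx),
      ← intervalIntegral.integral_const_mul]
    exact intervalIntegral.integral_eq_sub_of_hasDerivAt
      (fun y hy => hasDerivAt_vertical (hg.differentiableAt_of_mem hΩ (mem x hx y hy)))
      (((ver c1 x hx).sub (ver c2 x hx)).const_mul _)
  have hconj : ContDiffOn ℝ 1 (fun p => starRingEnd ℂ (dzb g p)) Ω :=
    Complex.conjCLE.contDiff.comp_contDiffOn hh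
  have hst := congrArg (starRingEnd ℂ) (rect_stokes hΩ hconj hR)
  simp only [intervalIntegral_conj, map_sub, map_add, map_mul, Complex.conj_conj,
    Complex.conj_I] at hst
  have hI : starRingEnd ℂ (∫ x : ℝ in z.re..w.re, ∫ y : ℝ in z.im..w.im,
      2 * Complex.I * dzb (fun p => starRingEnd ℂ (dzb g p)) (x + y * Complex.I))
      = - ∫ x : ℝ in z.re..w.re, ∫ y : ℝ in z.im..w.im,
          2 * Complex.I * dz (dzb g) (x + y * Complex.I) := by
    simp only [← intervalIntegral_conj, ← intervalIntegral.integral_neg]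
    refine intervalIntegral.integral_congr fun x hx =>
      intervalIntegral.integral_congr fun y hy => ?_
    rw [dzb_conj (hh.differentiableAt_of_mem hΩ (mem x hx y hy))]
    simp [map_ofNat]
  rw [hI] at hst
  have h1 := H _ (Set.left_mem_uIcc)
  have h2 := H _ (Set.right_mem_uIcc)
  have h3 := Vt _ (Set.left_mem_uIcc)
  have h4 := Vt _ (Set.right_mem_uIcc)
  linear_combination h1 - h2 + h4 - h3 - hst

/-- The Schwarzian-type quantity `∂²u - (∂u)²/2`. -/
def schw (u : ℂ → ℝ) (z : ℂ) : ℂ :=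
  dz (dz (fun w => (u w : ℂ))) z - dz (fun w => (u w : ℂ)) z ^ 2 / 2

section
variable {u : ℂ → ℝ} {Ω : Set ℂ}

lemma dz_exp_real {z : ℂ} (hu : DifferentiableAt ℝ u z) (a : ℂ) :
    dz (fun w => Complex.exp (a * u w)) z
      = a * dz (fun w => (u w : ℂ)) z * Complex.exp (a * u z) := by
  have h : DifferentiableAt ℝ (fun w => (u w : ℂ)) z :=
    Complex.ofRealCLM.differentiableAt.comp z hu
  have h2 : HasDerivAt (fun x : ℂ => Complex.exp (a * x)) (Complex.exp (a * u z) * a) (u z) := by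
    simpa using ((hasDerivAt_id ((u z : ℂ))).const_mul a).cexp
  rw [dz_holomorphic_comp (g := fun x => Complex.exp (a * x)) h2.differentiableAt h, h2.deriv]
  ring

lemma contDiffOn_exp_real {k : WithTop ℕ∞} (hu : ContDiffOn ℝ k u Ω) (a : ℂ) :
    ContDiffOn ℝ k (fun w => Complex.exp (a * u w)) Ω :=
  (contDiffOn_const.mul hu.complexOfReal).cexp

lemma dzb_dz_of_liouville (hΩ : IsOpen Ω) (hu : ContDiffOn ℝ 2 u Ω)
    (hl : ∀ z ∈ Ω, lapC u z = -2 * exp (u z)) {z : ℂ} (hz : z ∈ Ω) :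
    dzb (dz (fun w => (u w : ℂ))) z = -(1 / 2) * Complex.exp (1 * u z) := by
  have h := ofReal_lapC hΩ hu hz
  rw [hl z hz] at h
  push_cast at h
  rw [one_mul]
  linear_combination -h / 4

/-- For a solution of Liouville's equation `∂²u - (∂u)²/2` is holomorphic. -/
lemma differentiableOn_schw (hΩ : IsOpen Ω) (hu : ContDiffOn ℝ 2 u Ω)
    (hl : ∀ z ∈ Ω, lapC u z = -2 * exp (u z)) : DifferentiableOn ℂ (schw u) Ω := by
  set g := dz (fun w => (u w : ℂ)) with hgdef
  have hg : ContDiffOn ℝ 1 g Ω := hu.complexOfReal.dz_two hΩ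
  have hE : ContDiffOn ℝ 2 (fun z => -(1 / 2 : ℂ) * Complex.exp (1 * u z)) Ω :=
    contDiffOn_const.mul (contDiffOn_exp_real hu 1)
  have heq : ∀ z ∈ Ω, dzb g z = -(1 / 2) * Complex.exp (1 * u z) := fun z hz =>
    dzb_dz_of_liouville hΩ hu hl hz
  have hh : ContDiffOn ℝ 1 (dzb g) Ω := (hE.of_le (by norm_num)).congr heq
  have hu1 : ∀ z ∈ Ω, DifferentiableAt ℝ u z := fun z hz =>
    (hu.of_le (by norm_num)).differentiableAt_of_mem hΩ hz
  have hdzh : ∀ z ∈ Ω, dz (dzb g) z = g z * dzb g z := by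
    intro z hz
    have hev : dzb g =ᶠ[𝓝 z] fun z => -(1 / 2 : ℂ) * Complex.exp (1 * u z) := by
      filter_upwards [hΩ.mem_nhds hz] with w hw using heq w hw
    rw [dz_eq_of_eventuallyEq hev, dz_mul (differentiableAt_const _)
      (((contDiffOn_exp_real hu 1).of_le (by norm_num)).differentiableAt_of_mem hΩ hz),
      dz_const, dz_exp_real (hu1 z hz), heq z hz]
    ring
  have hsq : ContDiffOn ℝ 1 (fun z => g z * g z) Ω := hg.mul hg
  have hdsq : ∀ z ∈ Ω, dzb (fun z => g z * g z) z = 2 * (g z * dzb g z) := by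
    intro z hz
    have := hg.differentiableAt_of_mem hΩ hz
    rw [dzb_mul this this]; ring
  have hcont : ContinuousOn (schw u) Ω :=
    (hg.continuousOn_dz hΩ).sub ((hg.continuousOn.pow 2).div_const 2)
  refine (Complex.isConservativeOn_and_continuousOn_iff_isDifferentiableOn hΩ).1 ⟨?_, hcont⟩
  intro z w hR
  have hR' : Set.uIcc z.re w.re ×ℂ Set.uIcc z.im w.im ⊆ Ω := hR
  rw [← add_eq_zero_iff_eq_neg, Complex.wedgeIntegral_add_wedgeIntegral_eq]
  have mem : ∀ x ∈ Set.uIcc z.re w.re, ∀ y ∈ Set.uIcc z.im w.im, (x + y * Complex.I : ℂ) ∈ Ω := by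
    intro x hx y hy
    apply hR'
    rw [Complex.mem_reProdIm]
    simpa using ⟨hx, hy⟩
  have hor : ∀ {p : ℂ → ℂ}, ContinuousOn p Ω → ∀ y ∈ Set.uIcc z.im w.im,
      IntervalIntegrable (fun x : ℝ => p (x + y * Complex.I)) volume z.re w.re := by
    intro p hp y hy
    refine ContinuousOn.intervalIntegrable (hp.comp ?_ fun x hx => mem x hx y hy)
    fun_prop
  have ver : ∀ {p : ℂ → ℂ}, ContinuousOn p Ω → ∀ x ∈ Set.uIcc z.re w.re,
      IntervalIntegrable (fun y : ℝ => p (x + y * Complex.I)) volume z.im w.im := by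
    intro p hp x hx
    refine ContinuousOn.intervalIntegrable (hp.comp ?_ fun y hy => mem x hx y hy)
    fun_prop
  have c1 := hg.continuousOn_dz hΩ
  have c2 : ContinuousOn (fun z => g z * g z / 2) Ω := hsq.continuousOn.div_const 2
  have H : ∀ y ∈ Set.uIcc z.im w.im, (∫ x : ℝ in z.re..w.re, schw u (x + y * Complex.I))
      = (∫ x : ℝ in z.re..w.re, dz g (x + y * Complex.I))
        - (∫ x : ℝ in z.re..w.re, g (x + y * Complex.I) * g (x + y * Complex.I)) / 2 := by
    intro y hy
    rw [← intervalIntegral.integral_div,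
      ← intervalIntegral.integral_sub (hor c1 y hy) (hor c2 y hy)]
    refine intervalIntegral.integral_congr fun x _ => ?_
    simp only [schw, ← hgdef, pow_two]
  have Vt : ∀ x ∈ Set.uIcc z.re w.re, (∫ y : ℝ in z.im..w.im, schw u (x + y * Complex.I))
      = (∫ y : ℝ in z.im..w.im, dz g (x + y * Complex.I))
        - (∫ y : ℝ in z.im..w.im, g (x + y * Complex.I) * g (x + y * Complex.I)) / 2 := by
    intro x hx
    rw [← intervalIntegral.integral_div,
      ← intervalIntegral.integral_sub (ver c1 x hx) (ver c2 x hx)]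
    refine intervalIntegral.integral_congr fun x _ => ?_
    simp only [schw, ← hgdef, pow_two]
  rw [H _ Set.left_mem_uIcc, H _ Set.right_mem_uIcc, Vt _ Set.left_mem_uIcc,
    Vt _ Set.right_mem_uIcc]
  have e1 := rect_dz hΩ hg hh hR'
  have e2 := rect_stokes hΩ hsq hR'
  have e3 : (∫ x : ℝ in z.re..w.re, ∫ y : ℝ in z.im..w.im,
      2 * Complex.I * dzb (fun z => g z * g z) (x + y * Complex.I))
      = 2 * ∫ x : ℝ in z.re..w.re, ∫ y : ℝ in z.im..w.im,
        2 * Complex.I * dz (dzb g) (x + y * Complex.I) := by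
    rw [← intervalIntegral.integral_const_mul]
    refine intervalIntegral.integral_congr fun x hx => ?_
    rw [← intervalIntegral.integral_const_mul]
    refine intervalIntegral.integral_congr fun y hy => ?_
    rw [hdsq _ (mem x hx y hy), hdzh _ (mem x hx y hy)]
    ring
  rw [e3] at e2
  simp only [smul_eq_mul]
  linear_combination e1 - e2 / 2

/-- Solutions of Liouville's equation are of class `C³`. -/
lemma contDiffOn_three_of_liouville (hΩ : IsOpen Ω) (hu : ContDiffOn ℝ 2 u Ω)
    (hl : ∀ z ∈ Ω, lapC u z = -2 * exp (u z)) : ContDiffOn ℝ 3 u Ω := by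
  set uC : ℂ → ℂ := fun w => (u w : ℂ) with huC
  set g := dz uC with hgdef
  have hg : ContDiffOn ℝ 1 g Ω := hu.complexOfReal.dz_two hΩ
  have hS := (differentiableOn_schw hΩ hu hl).contDiffOn (n := 1) hΩ |>.restrict_scalars ℝ
  have hdz : ContDiffOn ℝ 1 (dz g) Ω := by
    refine (hS.add ((hg.pow 2).div_const 2)).congr fun z _ => ?_
    simp [schw, hgdef, huC]
  have hE : ContDiffOn ℝ 1 (fun z => -(1 / 2 : ℂ) * Complex.exp (1 * u z)) Ω :=
    contDiffOn_const.mul ((contDiffOn_exp_real hu 1).of_le (by norm_num))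
  have hdzb : ContDiffOn ℝ 1 (dzb g) Ω :=
    hE.congr fun z hz => dzb_dz_of_liouville hΩ hu hl hz
  have hg2 : ContDiffOn ℝ ((1 : ℕ) + 1) g Ω :=
    contDiffOn_succ_of_wirtinger hΩ
      (fun z hz => (hg.differentiableAt_of_mem hΩ hz).differentiableWithinAt)
      (by simpa using hdz) (by simpa using hdzb)
  have hg2' : ContDiffOn ℝ (2 : ℕ) g Ω := by
    have : ((1 : ℕ) : WithTop ℕ∞) + 1 = (2 : ℕ) := by norm_num
    rwa [this] at hg2
  have hb : ContDiffOn ℝ (2 : ℕ) (dzb uC) Ω :=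
    (Complex.conjCLE.contDiff.comp_contDiffOn hg2').congr fun z hz =>
      (dz_ofReal u ((hu.of_le (by norm_num)).differentiableAt_of_mem hΩ hz)).symm
  have h3 : ContDiffOn ℝ ((2 : ℕ) + 1) uC Ω :=
    contDiffOn_succ_of_wirtinger hΩ
      (fun z hz => ((hu.complexOfReal.of_le (by norm_num)).differentiableAt_of_mem hΩ
        hz).differentiableWithinAt) hg2' hb
  have h4 : ContDiffOn ℝ 3 uC Ω := by
    have : ((2 : ℕ) : WithTop ℕ∞) + 1 = 3 := by norm_num
    rwa [this] at h3
  exact (Complex.reCLM.contDiff.comp_contDiffOn h4).congr fun z _ => by simp [huC]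

end

/-- The solution `u` in the logarithmic coordinate `ζ`, where `z = c + exp (s ζ)`. -/
def endPull (u : ℂ → ℝ) (c : ℂ) (s : ℝ) (ζ : ℂ) : ℝ := u (c + Complex.exp (s * ζ)) + 2 * s * ζ.re

section
variable {u : ℂ → ℝ} {Ω V : Set ℂ} {c ζ : ℂ} {s : ℝ}

lemma hasDerivAt_exp_mul (c : ℂ) (s : ℝ) (ζ : ℂ) :
    HasDerivAt (fun ζ => c + Complex.exp (s * ζ)) (s * Complex.exp (s * ζ)) ζ := by
  have h1 : HasDerivAt (fun ζ : ℂ => (s : ℂ) * ζ) s ζ := by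
    simpa using (hasDerivAt_id ζ).const_mul (s : ℂ)
  refine (h1.cexp.const_add c).congr_deriv ?_
  ring

lemma contDiffOn_endPull {k : WithTop ℕ∞} (hu : ContDiffOn ℝ k u Ω)
    (hV : ∀ ζ ∈ V, c + Complex.exp (s * ζ) ∈ Ω) : ContDiffOn ℝ k (endPull u c s) V := by
  have h1 : ContDiff ℝ k (fun ζ : ℂ => c + Complex.exp (s * ζ)) :=
    contDiff_const.add ((contDiff_const.mul contDiff_id).cexp)
  exact (hu.comp h1.contDiffOn hV).add
    (contDiff_const.mul Complex.reCLM.contDiff).contDiffOn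

lemma dz_re (b : ℝ) (z : ℂ) : dz (fun w => ((b * w.re : ℝ) : ℂ)) z = b / 2 := by
  have h : HasFDerivAt (fun w : ℂ => ((b * w.re : ℝ) : ℂ))
      (Complex.ofRealCLM.comp (b • Complex.reCLM)) z :=
    Complex.ofRealCLM.hasFDerivAt.comp z (Complex.reCLM.hasFDerivAt.const_mul b)
  rw [dz, h.fderiv]
  simp

lemma dz_endPull (hu : DifferentiableAt ℝ u (c + Complex.exp (s * ζ))) :
    dz (fun w => (endPull u c s w : ℂ)) ζ
      = s * Complex.exp (s * ζ) * dz (fun w => (u w : ℂ)) (c + Complex.exp (s * ζ)) + s := by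
  have hφ := hasDerivAt_exp_mul c s ζ
  have huC : DifferentiableAt ℝ (fun w => (u w : ℂ)) (c + Complex.exp (s * ζ)) :=
    Complex.ofRealCLM.differentiableAt.comp _ hu
  have h1 := dz_comp_holomorphic (f := fun ζ => c + Complex.exp (s * ζ)) (z := ζ) huC
    hφ.differentiableAt
  rw [hφ.deriv] at h1
  have h2 := dz_re (2 * s) ζ
  have e : (fun w => (endPull u c s w : ℂ))
      = fun w => (u (c + Complex.exp (s * w)) : ℂ) + ((2 * s * w.re : ℝ) : ℂ) := by
    funext w; rw [endPull, Complex.ofReal_add]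
  rw [e, dz_add, h1, h2]
  · push_cast; ring
  · exact huC.comp ζ (hφ.differentiableAt.restrictScalars ℝ)
  · exact Complex.ofRealCLM.differentiableAt.comp _
      (Complex.reCLM.differentiableAt.const_mul (2 * s))

lemma isOpen_preimage_exp_mul (hΩ : IsOpen Ω) (c : ℂ) (s : ℝ) :
    IsOpen {ζ : ℂ | c + Complex.exp (s * ζ) ∈ Ω} :=
  hΩ.preimage (by fun_prop)

lemma lapC_endPull (hΩ : IsOpen Ω) (hu : ContDiffOn ℝ 2 u Ω) (hs : s * s = 1)
    (hζ : c + Complex.exp (s * ζ) ∈ Ω) :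
    lapC (endPull u c s) ζ = exp (2 * s * ζ.re) * lapC u (c + Complex.exp (s * ζ)) := by
  have hV := isOpen_preimage_exp_mul hΩ c s
  have hev : dz (fun w => (endPull u c s w : ℂ)) =ᶠ[𝓝 ζ] fun ζ =>
      s * Complex.exp (s * ζ) * dz (fun w => (u w : ℂ)) (c + Complex.exp (s * ζ)) + s := by
    filter_upwards [hV.mem_nhds hζ] with w hw
    exact dz_endPull ((hu.of_le (by norm_num)).differentiableAt_of_mem hΩ hw)
  have hφ := hasDerivAt_exp_mul c s ζ
  have hg := (hu.complexOfReal.dz_two hΩ).differentiableAt_of_mem hΩ hζ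
  have hgφ : DifferentiableAt ℝ (fun ζ => dz (fun w => (u w : ℂ)) (c + Complex.exp (s * ζ))) ζ :=
    DifferentiableAt.comp (g := dz (fun w => (u w : ℂ))) (f := fun ζ => c + Complex.exp (s * ζ))
      ζ hg
      (hφ.differentiableAt.restrictScalars ℝ)
  have hh : DifferentiableAt ℂ (fun ζ : ℂ => s * Complex.exp (s * ζ)) ζ := by fun_prop
  have hmul : DifferentiableAt ℝ (fun ζ => s * Complex.exp (s * ζ)
      * dz (fun w => (u w : ℂ)) (c + Complex.exp (s * ζ))) ζ := (hh.restrictScalars ℝ).mul hgφ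
  have h1 := dzb_comp_holomorphic (f := fun ζ => c + Complex.exp (s * ζ)) (z := ζ) hg
    hφ.differentiableAt
  rw [hφ.deriv] at h1
  have key : (lapC (endPull u c s) ζ : ℂ)
      = ((exp (2 * s * ζ.re) * lapC u (c + Complex.exp (s * ζ)) : ℝ) : ℂ) := by
    rw [ofReal_lapC hV (contDiffOn_endPull hu fun _ h => h) hζ, dzb_eq_of_eventuallyEq hev,
      dzb_add hmul (differentiableAt_const _), dzb_const,
      dzb_holomorphic_mul hh hgφ, h1, Complex.ofReal_mul, ofReal_lapC hΩ hu hζ, map_mul,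
      Complex.conj_ofReal, ← Complex.exp_conj, map_mul, Complex.conj_ofReal]
    have hs' : (s : ℂ) * s = 1 := by exact_mod_cast hs
    have he : Complex.exp (s * ζ) * Complex.exp (s * starRingEnd ℂ ζ)
        = ((exp (2 * s * ζ.re) : ℝ) : ℂ) := by
      rw [← Complex.exp_add, ← mul_add, Complex.add_conj, Complex.ofReal_exp]
      congr 1; push_cast; ring
    rw [← he]
    linear_combination (4 * Complex.exp (s * ζ) * Complex.exp (s * starRingEnd ℂ ζ)
      * dzb (dz fun w => (u w : ℂ)) (c + Complex.exp (s * ζ))) * hs'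
  exact_mod_cast key

lemma lapC_endPull_of_liouville (hΩ : IsOpen Ω) (hu : ContDiffOn ℝ 2 u Ω)
    (hl : ∀ z ∈ Ω, lapC u z = -2 * exp (u z)) (hs : s * s = 1)
    (hζ : c + Complex.exp (s * ζ) ∈ Ω) :
    lapC (endPull u c s) ζ = -2 * exp (endPull u c s ζ) := by
  rw [lapC_endPull hΩ hu hs hζ, hl _ hζ, endPull, exp_add]; ring

lemma schw_endPull (hΩ : IsOpen Ω) (hu : ContDiffOn ℝ 2 u Ω) (hs : s * s = 1)
    (hζ : c + Complex.exp (s * ζ) ∈ Ω) :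
    schw (endPull u c s) ζ
      = Complex.exp (s * ζ) ^ 2 * schw u (c + Complex.exp (s * ζ)) - 1 / 2 := by
  have hV := isOpen_preimage_exp_mul hΩ c s
  have hd : ∀ w, c + Complex.exp (s * w) ∈ Ω → DifferentiableAt ℝ u (c + Complex.exp (s * w)) :=
    fun w hw => (hu.of_le (by norm_num)).differentiableAt_of_mem hΩ hw
  have hev : dz (fun w => (endPull u c s w : ℂ)) =ᶠ[𝓝 ζ] fun ζ =>
      s * Complex.exp (s * ζ) * dz (fun w => (u w : ℂ)) (c + Complex.exp (s * ζ)) + s := by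
    filter_upwards [hV.mem_nhds hζ] with w hw
    exact dz_endPull (hd w hw)
  have hφ := hasDerivAt_exp_mul c s ζ
  have hg := (hu.complexOfReal.dz_two hΩ).differentiableAt_of_mem hΩ hζ
  have hgφ : DifferentiableAt ℝ (fun ζ => dz (fun w => (u w : ℂ)) (c + Complex.exp (s * ζ))) ζ :=
    DifferentiableAt.comp (g := dz (fun w => (u w : ℂ))) (f := fun ζ => c + Complex.exp (s * ζ))
      ζ hg
      (hφ.differentiableAt.restrictScalars ℝ)
  have hh : HasDerivAt (fun ζ : ℂ => s * Complex.exp (s * ζ)) (s * (s * Complex.exp (s * ζ)))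
      ζ := by
    simpa using (hasDerivAt_exp_mul 0 s ζ).const_mul (s : ℂ)
  have hmul : DifferentiableAt ℝ (fun ζ => s * Complex.exp (s * ζ)
      * dz (fun w => (u w : ℂ)) (c + Complex.exp (s * ζ))) ζ :=
    (hh.differentiableAt.restrictScalars ℝ).mul hgφ
  have h1 := dz_comp_holomorphic (f := fun ζ => c + Complex.exp (s * ζ)) (z := ζ) hg
    hφ.differentiableAt
  rw [hφ.deriv] at h1
  have hs' : (s : ℂ) * s = 1 := by exact_mod_cast hs
  rw [schw, dz_eq_of_eventuallyEq hev, dz_endPull (hd ζ hζ),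
      dz_add hmul (differentiableAt_const _), dz_const,
      dz_mul (hh.differentiableAt.restrictScalars ℝ) hgφ, h1, dz_of_holomorphic hh.differentiableAt,
      hh.deriv, schw]
  generalize dz (dz fun w => (u w : ℂ)) (c + Complex.exp (s * ζ)) = A
  generalize dz (fun w => (u w : ℂ)) (c + Complex.exp (s * ζ)) = B
  generalize Complex.exp (s * ζ) = E
  linear_combination (E * E * A - 1 / 2 - E ^ 2 * B ^ 2 / 2) * hs'

end

section
variable {U : ℂ → ℝ} {Ω : Set ℂ} {T l : ℝ}

lemma isOpen_re_gt (T : ℝ) : IsOpen {ζ : ℂ | T < ζ.re} :=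
  isOpen_lt continuous_const Complex.continuous_re

lemma dz_add_re {ζ : ℂ} (hU : DifferentiableAt ℝ U ζ) (b : ℝ) :
    dz (fun w => ((U w + b * w.re : ℝ) : ℂ)) ζ = dz (fun w => (U w : ℂ)) ζ + b / 2 := by
  rw [← dz_re b ζ, ← dz_add]
  · simp only [Complex.ofReal_add]
  · exact Complex.ofRealCLM.differentiableAt.comp _ hU
  · exact Complex.ofRealCLM.differentiableAt.comp _ (Complex.reCLM.differentiableAt.const_mul b)

lemma lapC_add_re (hΩ : IsOpen Ω) (hU : ContDiffOn ℝ 2 U Ω) (b : ℝ) {ζ : ℂ} (hζ : ζ ∈ Ω) :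
    lapC (fun w => U w + b * w.re) ζ = lapC U ζ := by
  have hev : dz (fun w => ((U w + b * w.re : ℝ) : ℂ))
      =ᶠ[𝓝 ζ] fun ζ => dz (fun w => (U w : ℂ)) ζ + b / 2 := by
    filter_upwards [hΩ.mem_nhds hζ] with w hw
    exact dz_add_re ((hU.of_le (by norm_num)).differentiableAt_of_mem hΩ hw) b
  rw [lapC, lapC, dzb_eq_of_eventuallyEq hev, dzb_add
    ((hU.complexOfReal.dz_two hΩ).differentiableAt_of_mem hΩ hζ) (differentiableAt_const _),
    dzb_const, add_zero]

lemma contDiffOn_add_re {k : WithTop ℕ∞} (hU : ContDiffOn ℝ k U Ω) (b : ℝ) :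
    ContDiffOn ℝ k (fun w => U w + b * w.re) Ω :=
  hU.add (contDiff_const.mul Complex.reCLM.contDiff).contDiffOn

lemma abs_re_sub_lt {ζ w : ℂ} {r : ℝ} (h : w ∈ ball ζ r) : |w.re - ζ.re| < r := by
  rw [mem_ball, dist_eq_norm] at h
  have := Complex.abs_re_le_norm (w - ζ)
  rw [Complex.sub_re] at this
  exact this.trans_lt h

lemma exists_norm_dz_add_le (hl0 : 0 < l) (hU : ContDiffOn ℝ 2 U {ζ | T < ζ.re})
    (hl : ∀ ζ : ℂ, T < ζ.re → lapC U ζ = -2 * exp (U ζ))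
    (hw : ∀ ε > (0 : ℝ), ∃ T', ∀ ζ : ℂ, T' < ζ.re → |U ζ + 2 * l * ζ.re| ≤ ε * ζ.re)
    {ε : ℝ} (hε : 0 < ε) :
    ∃ T', ∀ ζ : ℂ, T' < ζ.re → ‖dz (fun w => (U w : ℂ)) ζ + l‖ ≤ ε := by
  set δ := min (l / 3) (ε / 54) with hδ
  have hδ0 : 0 < δ := by positivity
  have hδ1 : δ ≤ l / 3 := min_le_left _ _
  have hδ2 : δ ≤ ε / 54 := min_le_right _ _
  obtain ⟨T1, hT1⟩ := hw δ hδ0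
  have hlim : Tendsto (fun t : ℝ => exp (-(l / 2) * t) * t) atTop (𝓝 0) := by
    have h1 := (tendsto_pow_mul_exp_neg_atTop_nhds_zero 1).comp
      (tendsto_id.const_mul_atTop (half_pos hl0))
    have h2 := h1.const_mul (2 / l)
    rw [mul_zero] at h2
    refine h2.congr fun t => ?_
    simp only [Function.comp, id, pow_one, neg_mul]
    field_simp
  obtain ⟨T2, hT2⟩ := eventually_atTop.1
    (hlim.eventually (gt_mem_nhds (show 0 < 2 * ε by positivity)))
  refine ⟨max (max (2 * T) (2 * T1)) (max T2 1), fun ζ hζ => ?_⟩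
  set t := ζ.re with ht
  have a1 : 2 * T < t := lt_of_le_of_lt (le_trans (le_max_left _ _) (le_max_left _ _)) hζ
  have a2 : 2 * T1 < t := lt_of_le_of_lt (le_trans (le_max_right _ _) (le_max_left _ _)) hζ
  have a3 : T2 < t := lt_of_le_of_lt (le_trans (le_max_left _ _) (le_max_right _ _)) hζ
  have a4 : 1 < t := lt_of_le_of_lt (le_trans (le_max_right _ _) (le_max_right _ _)) hζ
  have hre : ∀ w ∈ ball ζ (t / 2), t / 2 < w.re ∧ w.re < 3 * t / 2 := by
    intro w hw
    have := abs_lt.1 (abs_re_sub_lt hw)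
    constructor <;> linarith [this.1, this.2]
  have hsub : ball ζ (t / 2) ⊆ {ζ : ℂ | T < ζ.re} := fun w hw => by
    have := (hre w hw).1
    change T < w.re
    linarith
  have hb : ∀ w ∈ ball ζ (t / 2), |U w + 2 * l * w.re| ≤ δ * w.re := fun w hw =>
    hT1 w (by linarith [(hre w hw).1])
  have key := norm_dz_le (u := fun w => U w + 2 * l * w.re) (c := ζ) (R := t / 2)
    (M := δ * (3 * t / 2)) (K := 2 * exp (-(l / 2) * t)) (a := 0) (by linarith)
    (contDiffOn_add_re (hU.mono hsub) _)
    (fun w hw => by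
      rw [sub_zero]
      exact (hb w hw).trans (mul_le_mul_of_nonneg_left (hre w hw).2.le hδ0.le))
    (fun w hw => by
      rw [lapC_add_re (isOpen_re_gt T) hU _ (hsub hw), hl w (hsub hw), abs_mul,
        abs_of_pos (exp_pos _)]
      norm_num
      have h1 := (abs_le.1 (hb w hw)).2
      have h2 := (hre w hw).1
      nlinarith)
  rw [dz_add_re ((hU.of_le (by norm_num)).differentiableAt_of_mem (isOpen_re_gt T)
    (show T < ζ.re by linarith))] at key
  have e : ((2 * l : ℝ) : ℂ) / 2 = l := by push_cast; ring
  rw [e] at key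
  refine key.trans ?_
  have h3 := hT2 t a3.le
  have h4 : 9 * (δ * (3 * t / 2)) / (t / 2) = 27 * δ := by field_simp; ring
  rw [h4]
  linarith

/-- Asymptotics of a solution of Liouville's equation at a conical end. -/
lemma exists_norm_schw_add_le (hl0 : 0 < l) (hU : ContDiffOn ℝ 2 U {ζ | T < ζ.re})
    (hl : ∀ ζ : ℂ, T < ζ.re → lapC U ζ = -2 * exp (U ζ))
    (hw : ∀ ε > (0 : ℝ), ∃ T', ∀ ζ : ℂ, T' < ζ.re → |U ζ + 2 * l * ζ.re| ≤ ε * ζ.re)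
    {ε : ℝ} (hε : 0 < ε) :
    ∃ T', ∀ ζ : ℂ, T' < ζ.re → ‖schw U ζ + l ^ 2 / 2‖ ≤ ε := by
  set δ := min 1 (ε / (10 + l)) with hδ
  have hδ0 : 0 < δ := by positivity
  have hδ1 : δ ≤ 1 := min_le_left _ _
  have hδ2 : δ * (10 + l) ≤ ε := (le_div_iff₀ (by positivity)).1 (min_le_right _ _)
  obtain ⟨T1, hT1⟩ := exists_norm_dz_add_le hl0 hU hl hw hδ0
  refine ⟨max T T1 + 1, fun ζ hζ => ?_⟩
  have hre : ∀ w ∈ ball ζ 1, max T T1 < w.re := by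
    intro w hw
    have := abs_lt.1 (abs_re_sub_lt hw)
    linarith [this.1]
  have hsub : ball ζ 1 ⊆ {ζ : ℂ | T < ζ.re} := fun w hw => (le_max_left _ _).trans_lt (hre w hw)
  set g := dz (fun w => (U w : ℂ)) with hg
  have hgC : ContDiffOn ℝ 1 g (ball ζ 1) := (hU.complexOfReal.dz_two (isOpen_re_gt T)).mono hsub
  have hG : ∀ w ∈ ball ζ 1, ‖g w + l‖ ≤ δ := fun w hw =>
    hT1 w ((le_max_right _ _).trans_lt (hre w hw))
  have hpc : ContDiffOn ℝ 1 (fun w => g w + l) (ball ζ 1) := hgC.add contDiffOn_const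
  have key := norm_le_of_dz_eq (p := fun w => g w + l)
    (q := fun w => (g w + l) ^ 2 / 2 - l * (g w + l)) (S := fun w => schw U w + l ^ 2 / 2)
    (Q := δ ^ 2 / 2 + l * δ) one_pos hpc hG
    (((hpc.continuousOn.pow 2).div_const 2).sub (continuousOn_const.mul hpc.continuousOn))
    (fun w hw => by
      refine (norm_sub_le _ _).trans ?_
      have := hG w hw
      rw [norm_div, norm_pow, norm_mul, Complex.norm_ofNat, Complex.norm_real,
        norm_of_nonneg hl0.le]
      gcongr)
    (((differentiableOn_schw (isOpen_re_gt T) hU hl).mono hsub).add (differentiableOn_const _))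
    (fun w hw => by
      rw [dz_add (hgC.differentiableAt_of_mem isOpen_ball hw) (differentiableAt_const _), dz_const,
        schw]
      ring)
  refine key.trans ?_
  nlinarith

end

section
variable {u : ℂ → ℝ} {Ω : Set ℂ} {c : ℂ} {s T l : ℝ} {F : Filter ℂ}

lemma exp_mul_log_sub (hs : s * s = 1) {z : ℂ} (hz : z ≠ c) :
    Complex.exp (s * (s * Complex.log (z - c))) = z - c := by
  have hs' : (s : ℂ) * s = 1 := by exact_mod_cast hs
  rw [← mul_assoc, hs', one_mul, Complex.exp_log (sub_ne_zero.2 hz)]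

lemma end_hypothesis (hs : s * s = 1)
    (hw : ∀ ε > (0 : ℝ), ∃ T', ∀ z, z ≠ c → T' < s * Real.log ‖z - c‖ →
      |u z + 2 * (1 + l * s) * Real.log ‖z - c‖| ≤ ε * (s * Real.log ‖z - c‖)) :
    ∀ ε > (0 : ℝ), ∃ T', ∀ ζ : ℂ, T' < ζ.re →
      |endPull u c s ζ + 2 * l * ζ.re| ≤ ε * ζ.re := by
  intro ε hε
  obtain ⟨T', hT'⟩ := hw ε hε
  refine ⟨T', fun ζ hζ => ?_⟩
  have h := hT' (c + Complex.exp (s * ζ)) (by simp)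
  have e : Real.log ‖c + Complex.exp (s * ζ) - c‖ = s * ζ.re := by
    rw [add_sub_cancel_left, Complex.norm_exp, log_exp]; simp
  rw [e, ← mul_assoc, hs, one_mul] at h
  have e2 : endPull u c s ζ + 2 * l * ζ.re
      = u (c + Complex.exp (s * ζ)) + 2 * (1 + l * s) * (s * ζ.re) := by
    rw [endPull]; linear_combination (-2 * l * ζ.re) * hs
  rw [e2]
  exact h hζ

lemma tendsto_sub_mul_dz (hs : s * s = 1) (hΩ : IsOpen Ω) (hu : ContDiffOn ℝ 2 u Ω)
    (hl : ∀ z ∈ Ω, lapC u z = -2 * exp (u z)) (hl0 : 0 < l)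
    (hT : ∀ ζ : ℂ, T < ζ.re → c + Complex.exp (s * ζ) ∈ Ω)
    (hw : ∀ ε > (0 : ℝ), ∃ T', ∀ z, z ≠ c → T' < s * Real.log ‖z - c‖ →
      |u z + 2 * (1 + l * s) * Real.log ‖z - c‖| ≤ ε * (s * Real.log ‖z - c‖))
    (hF : Tendsto (fun z => s * Real.log ‖z - c‖) F atTop) (hFc : ∀ᶠ z in F, z ≠ c) :
    Tendsto (fun z => (z - c) * dz (fun w => (u w : ℂ)) z) F (𝓝 (-(1 + l * s))) := by
  have hU := contDiffOn_endPull (V := {ζ | T < ζ.re}) (s := s) hu fun ζ h => hT ζ h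
  rw [Metric.tendsto_nhds]
  intro ε hε
  obtain ⟨T', h⟩ := exists_norm_dz_add_le hl0 hU
    (fun ζ hζ => lapC_endPull_of_liouville hΩ hu hl hs (hT ζ hζ)) (end_hypothesis hs hw)
    (half_pos hε)
  filter_upwards [hF.eventually_gt_atTop T', hF.eventually_gt_atTop T, hFc] with z h1 h2 h3
  have e := exp_mul_log_sub hs h3
  have hre : ((s : ℂ) * Complex.log (z - c)).re = s * Real.log ‖z - c‖ := by
    rw [Complex.re_ofReal_mul, Complex.log_re]
  have hmem := hT (s * Complex.log (z - c)) (by rwa [hre])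
  have h4 := h (s * Complex.log (z - c)) (by rwa [hre])
  rw [dz_endPull ((hu.of_le (by norm_num)).differentiableAt_of_mem hΩ hmem), e,
    add_sub_cancel] at h4
  have hs' : (s : ℂ) * s = 1 := by exact_mod_cast hs
  have e3 : (z - c) * dz (fun w => (u w : ℂ)) z - -(1 + l * s)
      = s * (s * (z - c) * dz (fun w => (u w : ℂ)) z + s + l) := by
    linear_combination (-(z - c) * dz (fun w => (u w : ℂ)) z - 1) * hs'
  have e4 : ‖(s : ℂ)‖ = 1 := by
    have : ‖(s : ℂ)‖ * ‖(s : ℂ)‖ = 1 := by rw [← norm_mul, hs', norm_one]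
    nlinarith [norm_nonneg (s : ℂ)]
  rw [dist_eq_norm, e3, norm_mul, e4, one_mul]
  linarith

lemma tendsto_sub_sq_mul_schw (hs : s * s = 1) (hΩ : IsOpen Ω) (hu : ContDiffOn ℝ 2 u Ω)
    (hl : ∀ z ∈ Ω, lapC u z = -2 * exp (u z)) (hl0 : 0 < l)
    (hT : ∀ ζ : ℂ, T < ζ.re → c + Complex.exp (s * ζ) ∈ Ω)
    (hw : ∀ ε > (0 : ℝ), ∃ T', ∀ z, z ≠ c → T' < s * Real.log ‖z - c‖ →
      |u z + 2 * (1 + l * s) * Real.log ‖z - c‖| ≤ ε * (s * Real.log ‖z - c‖))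
    (hF : Tendsto (fun z => s * Real.log ‖z - c‖) F atTop) (hFc : ∀ᶠ z in F, z ≠ c) :
    Tendsto (fun z => (z - c) ^ 2 * schw u z) F (𝓝 ((1 - l ^ 2) / 2)) := by
  have hU := contDiffOn_endPull (V := {ζ | T < ζ.re}) (s := s) hu fun ζ h => hT ζ h
  rw [Metric.tendsto_nhds]
  intro ε hε
  obtain ⟨T', h⟩ := exists_norm_schw_add_le hl0 hU
    (fun ζ hζ => lapC_endPull_of_liouville hΩ hu hl hs (hT ζ hζ)) (end_hypothesis hs hw)
    (half_pos hε)
  filter_upwards [hF.eventually_gt_atTop T', hF.eventually_gt_atTop T, hFc] with z h1 h2 h3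
  have e := exp_mul_log_sub hs h3
  have hre : ((s : ℂ) * Complex.log (z - c)).re = s * Real.log ‖z - c‖ := by
    rw [Complex.re_ofReal_mul, Complex.log_re]
  have hmem := hT (s * Complex.log (z - c)) (by rwa [hre])
  have h4 := h (s * Complex.log (z - c)) (by rwa [hre])
  rw [schw_endPull hΩ hu hs hmem, e, add_sub_cancel] at h4
  have e3 : (z - c) ^ 2 * schw u z - (1 - (l : ℂ) ^ 2) / 2
      = (z - c) ^ 2 * schw u z - 1 / 2 + l ^ 2 / 2 := by ring
  rw [dist_eq_norm, e3]
  linarith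

lemma tendsto_neg_log_norm_sub (c : ℂ) :
    Tendsto (fun z => (-1 : ℝ) * Real.log ‖z - c‖) (𝓝[≠] c) atTop := by
  simp only [neg_one_mul]
  exact tendsto_neg_atBot_atTop.comp
    ((tendsto_log_nhdsGT_zero).comp (tendsto_norm_sub_self_nhdsNE c))

lemma tendsto_log_norm_cocompact :
    Tendsto (fun z : ℂ => (1 : ℝ) * Real.log ‖z - 0‖) (cocompact ℂ) atTop := by
  simp only [one_mul, sub_zero]
  exact tendsto_log_atTop.comp tendsto_norm_cocompact_atTop

/-- Conical behaviour at a puncture. -/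
lemma tendsto_of_puncture (hΩ : IsOpen Ω) (hu : ContDiffOn ℝ 2 u Ω)
    (hl : ∀ z ∈ Ω, lapC u z = -2 * exp (u z)) (hl0 : 0 < l) {r M : ℝ} (hr : 0 < r)
    (hsub : ∀ z, z ≠ c → ‖z - c‖ < r → z ∈ Ω)
    (hM : ∀ z, z ≠ c → ‖z - c‖ < r → |u z - 2 * (l - 1) * Real.log ‖z - c‖| ≤ M) :
    Tendsto (fun z => (z - c) * dz (fun w => (u w : ℂ)) z) (𝓝[≠] c) (𝓝 (l - 1)) ∧
    Tendsto (fun z => (z - c) ^ 2 * schw u z) (𝓝[≠] c) (𝓝 ((1 - l ^ 2) / 2)) := by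
  have hs : (-1 : ℝ) * -1 = 1 := by norm_num
  have hT : ∀ ζ : ℂ, -Real.log r < ζ.re → c + Complex.exp ((-1 : ℝ) * ζ) ∈ Ω := by
    intro ζ hζ
    refine hsub _ (by simp) ?_
    rw [add_sub_cancel_left, Complex.norm_exp, ← Real.lt_log_iff_exp_lt hr]
    simp; linarith
  have hw : ∀ ε > (0 : ℝ), ∃ T', ∀ z, z ≠ c → T' < (-1) * Real.log ‖z - c‖ →
      |u z + 2 * (1 + l * (-1)) * Real.log ‖z - c‖| ≤ ε * ((-1) * Real.log ‖z - c‖) := by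
    intro ε hε
    refine ⟨max (-Real.log r) (M / ε), fun z hz h => ?_⟩
    have h1 := (le_max_left _ _).trans_lt h
    have h2 := (le_max_right _ _).trans_lt h
    have h3 : ‖z - c‖ < r := by
      rw [← Real.log_lt_log_iff (norm_pos_iff.2 (sub_ne_zero.2 hz)) hr]; linarith
    have h4 := hM z hz h3
    rw [div_lt_iff₀ hε] at h2
    have e : u z + 2 * (1 + l * (-1)) * Real.log ‖z - c‖
        = u z - 2 * (l - 1) * Real.log ‖z - c‖ := by ring
    rw [e]
    linarith
  have hne : ∀ᶠ z in 𝓝[≠] c, z ≠ c := eventually_mem_nhdsWithin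
  constructor
  · have := tendsto_sub_mul_dz hs hΩ hu hl hl0 hT hw (tendsto_neg_log_norm_sub c) hne
    convert this using 2
    push_cast; ring
  · exact tendsto_sub_sq_mul_schw hs hΩ hu hl hl0 hT hw (tendsto_neg_log_norm_sub c) hne

/-- Conical behaviour at infinity. -/
lemma tendsto_of_end (hΩ : IsOpen Ω) (hu : ContDiffOn ℝ 2 u Ω)
    (hl : ∀ z ∈ Ω, lapC u z = -2 * exp (u z)) (hl0 : 0 < l) {r : ℝ} (hr : 0 < r)
    (hsub : ∀ z, r < ‖z‖ → z ∈ Ω)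
    (hM : ∀ ε > (0 : ℝ), ∃ T', ∀ z : ℂ, T' < Real.log ‖z‖ →
      |u z + 2 * (1 + l) * Real.log ‖z‖| ≤ ε * Real.log ‖z‖) :
    Tendsto (fun z => z ^ 2 * schw u z) (cocompact ℂ) (𝓝 ((1 - l ^ 2) / 2)) := by
  have hs : (1 : ℝ) * 1 = 1 := by norm_num
  have hT : ∀ ζ : ℂ, Real.log r < ζ.re → 0 + Complex.exp ((1 : ℝ) * ζ) ∈ Ω := by
    intro ζ hζ
    refine hsub _ ?_
    rw [zero_add, Complex.norm_exp, ← Real.log_lt_iff_lt_exp hr]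
    simpa using hζ
  have := tendsto_sub_sq_mul_schw (c := 0) hs hΩ hu hl hl0 hT (fun ε hε => by
    obtain ⟨T', h⟩ := hM ε hε
    refine ⟨T', fun z _ hz => ?_⟩
    rw [sub_zero, one_mul] at *
    rw [mul_one]
    exact h z hz) tendsto_log_norm_cocompact
    ((Set.finite_singleton (0 : ℂ)).isCompact.compl_mem_cocompact)
  simpa only [sub_zero] using this

end

section
variable {u v : ℂ → ℝ} {Ω : Set ℂ} {c z : ℂ}

lemma dz_ofReal_add (hu : DifferentiableAt ℝ u z) (hv : DifferentiableAt ℝ v z) :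
    dz (fun w => ((u w + v w : ℝ) : ℂ)) z
      = dz (fun w => (u w : ℂ)) z + dz (fun w => (v w : ℂ)) z := by
  simp only [Complex.ofReal_add]
  exact dz_add (Complex.ofRealCLM.differentiableAt.comp _ hu)
    (Complex.ofRealCLM.differentiableAt.comp _ hv)

lemma dz_ofReal_const_mul (hu : DifferentiableAt ℝ u z) (b : ℝ) :
    dz (fun w => ((b * u w : ℝ) : ℂ)) z = b * dz (fun w => (u w : ℂ)) z := by
  have hu' : DifferentiableAt ℝ (fun w => (u w : ℂ)) z :=
    Complex.ofRealCLM.differentiableAt.comp _ hu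
  simp only [Complex.ofReal_mul]
  rw [dz_mul (differentiableAt_const _) hu', dz_const,
    zero_mul, zero_add]

lemma lapC_add (hΩ : IsOpen Ω) (hu : ContDiffOn ℝ 2 u Ω) (hv : ContDiffOn ℝ 2 v Ω) (hz : z ∈ Ω) :
    lapC (fun w => u w + v w) z = lapC u z + lapC v z := by
  have hev : dz (fun w => ((u w + v w : ℝ) : ℂ)) =ᶠ[𝓝 z]
      fun ζ => dz (fun w => (u w : ℂ)) ζ + dz (fun w => (v w : ℂ)) ζ := by
    filter_upwards [hΩ.mem_nhds hz] with w hw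
    exact dz_ofReal_add ((hu.of_le (by norm_num)).differentiableAt_of_mem hΩ hw)
      ((hv.of_le (by norm_num)).differentiableAt_of_mem hΩ hw)
  rw [lapC, lapC, lapC, dzb_eq_of_eventuallyEq hev, dzb_add
    ((hu.complexOfReal.dz_two hΩ).differentiableAt_of_mem hΩ hz)
    ((hv.complexOfReal.dz_two hΩ).differentiableAt_of_mem hΩ hz), mul_add, Complex.add_re]

lemma lapC_const_mul (hΩ : IsOpen Ω) (hu : ContDiffOn ℝ 2 u Ω) (b : ℝ) (hz : z ∈ Ω) :
    lapC (fun w => b * u w) z = b * lapC u z := by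
  have hev : dz (fun w => ((b * u w : ℝ) : ℂ)) =ᶠ[𝓝 z] fun ζ => b * dz (fun w => (u w : ℂ)) ζ := by
    filter_upwards [hΩ.mem_nhds hz] with w hw
    exact dz_ofReal_const_mul ((hu.of_le (by norm_num)).differentiableAt_of_mem hΩ hw) b
  rw [lapC, lapC, dzb_eq_of_eventuallyEq hev, dzb_mul (differentiableAt_const _)
    ((hu.complexOfReal.dz_two hΩ).differentiableAt_of_mem hΩ hz), dzb_const, zero_mul, zero_add,
    mul_left_comm, Complex.re_ofReal_mul]

lemma lapC_eq_of_eventuallyEq (h : u =ᶠ[𝓝 z] v) : lapC u z = lapC v z := by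
  have hev : dz (fun w => (u w : ℂ)) =ᶠ[𝓝 z] dz (fun w => (v w : ℂ)) := by
    filter_upwards [h.eventuallyEq_nhds] with w hw
    refine dz_eq_of_eventuallyEq ?_
    filter_upwards [hw] with y hy
    rw [hy]
  rw [lapC, lapC, dzb_eq_of_eventuallyEq hev]

lemma lapC_const (b : ℝ) (z : ℂ) : lapC (fun _ => b) z = 0 := by
  have : dz (fun _ : ℂ => (b : ℂ)) = fun _ => 0 := funext fun w => dz_const _ w
  rw [lapC, this, dzb_const]; simp

lemma dz_normSq_sub (c z : ℂ) :
    dz (fun w => (Complex.normSq (w - c) : ℂ)) z = starRingEnd ℂ (z - c) := by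
  have h0 : DifferentiableAt ℝ (fun w : ℂ => w - c) z := by fun_prop
  simp only [← Complex.mul_conj]
  rw [dz_mul h0 (differentiableAt_conj h0), dz_conj h0,
    dz_of_holomorphic (by fun_prop : DifferentiableAt ℂ (fun w : ℂ => w - c) z),
    dzb_of_holomorphic (by fun_prop : DifferentiableAt ℂ (fun w : ℂ => w - c) z)]
  simp

lemma contDiff_normSq_sub (c : ℂ) {k : WithTop ℕ∞} :
    ContDiff ℝ k (fun w => Complex.normSq (w - c)) := by
  have : (fun w => Complex.normSq (w - c)) = fun w : ℂ => ‖w - c‖ ^ 2 :=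
    funext fun w => Complex.normSq_eq_norm_sq _
  rw [this]
  exact (contDiff_id.sub contDiff_const).norm_sq ℝ

lemma lapC_normSq_sub (c z : ℂ) : lapC (fun w => Complex.normSq (w - c)) z = 4 := by
  have h : dz (fun w => (Complex.normSq (w - c) : ℂ)) = fun w => starRingEnd ℂ (w - c) :=
    funext fun w => dz_normSq_sub c w
  have h0 : DifferentiableAt ℝ (fun w : ℂ => w - c) z := by fun_prop
  rw [lapC, h, dzb_conj h0,
    dz_of_holomorphic (by fun_prop : DifferentiableAt ℂ (fun w : ℂ => w - c) z)]
  simp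

lemma contDiffOn_log_norm_sub (c : ℂ) {k : WithTop ℕ∞} :
    ContDiffOn ℝ k (fun w => Real.log ‖w - c‖) {c}ᶜ := fun w hw => by
  have hw' : w - c ≠ 0 := sub_ne_zero.2 hw
  exact (((contDiff_id.sub contDiff_const).contDiffAt.norm ℝ hw').log
    (norm_ne_zero_iff.2 hw')).contDiffWithinAt

lemma dz_log_norm_sub {c z : ℂ} (hz : z ≠ c) :
    dz (fun w => (Real.log ‖w - c‖ : ℂ)) z = 1 / (2 * (z - c)) := by
  have hz' : z - c ≠ 0 := sub_ne_zero.2 hz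
  have hz'' : starRingEnd ℂ (z - c) ≠ 0 := (map_ne_zero _).2 hz'
  have hpos : 0 < Complex.normSq (z - c) := Complex.normSq_pos.2 hz'
  have e : (fun w => (Real.log ‖w - c‖ : ℂ))
      = fun w => (1 / 2 : ℂ) * Complex.log (Complex.normSq (w - c) : ℂ) := by
    funext w
    rw [← Complex.ofReal_log (Complex.normSq_nonneg _), Complex.normSq_eq_norm_sq, Real.log_pow]
    push_cast; ring
  have hs : (Complex.normSq (z - c) : ℂ) ∈ Complex.slitPlane :=
    Complex.ofReal_mem_slitPlane.2 hpos
  have hd : DifferentiableAt ℝ (fun w => (Complex.normSq (w - c) : ℂ)) z :=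
    Complex.ofRealCLM.differentiableAt.comp _
      ((contDiff_normSq_sub c (k := 1)).differentiable one_ne_zero z)
  have hl : DifferentiableAt ℝ (fun w => Complex.log (Complex.normSq (w - c) : ℂ)) z :=
    DifferentiableAt.comp (g := Complex.log) (f := fun w => (Complex.normSq (w - c) : ℂ)) z
      ((Complex.differentiableAt_log hs).restrictScalars ℝ) hd
  rw [e, dz_mul (differentiableAt_const _) hl, dz_const,
    dz_holomorphic_comp (Complex.differentiableAt_log hs) hd, dz_normSq_sub,
    (Complex.hasDerivAt_log hs).deriv, ← Complex.mul_conj]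
  field_simp
  ring

lemma lapC_log_norm_sub (hz : z ≠ c) : lapC (fun w => Real.log ‖w - c‖) z = 0 := by
  have hev : dz (fun w => (Real.log ‖w - c‖ : ℂ)) =ᶠ[𝓝 z] fun w => 1 / (2 * (w - c)) := by
    filter_upwards [isOpen_ne.mem_nhds hz] with w hw
    exact dz_log_norm_sub hw
  have hz' : z - c ≠ 0 := sub_ne_zero.2 hz
  have : DifferentiableAt ℂ (fun w => 1 / (2 * (w - c))) z := by
    refine (differentiableAt_const _).div (by fun_prop) ?_
    simpa using hz'
  rw [lapC, dzb_eq_of_eventuallyEq hev, dzb_of_holomorphic this]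
  simp

end

/-- Jensen's inequality for circle means of the exponential. -/
lemma le_cm_exp {u : ℂ → ℝ} {c : ℂ} {t a : ℝ} (hu : ContinuousOn u (sphere c (exp t)))
    (h : 2 * π * a ≤ cm c u t) : 2 * π * exp a ≤ cm c (fun z => exp (u z)) t := by
  have h1 : cm c (fun z => exp a * ((1 - a) + u z)) t ≤ cm c (fun z => exp (u z)) t := by
    refine cm_mono (continuousOn_const.mul (continuousOn_const.add hu)) hu.rexp fun z _ => ?_
    have := add_one_le_exp (u z - a)
    have h2 : exp (u z) = exp a * exp (u z - a) := by rw [← exp_add]; congr 1; ring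
    rw [h2]
    exact mul_le_mul_of_nonneg_left (by linarith) (exp_pos a).le
  have hc : cm c (fun _ : ℂ => 1 - a) t = 2 * π * (1 - a) := by rw [cm_const, smul_eq_mul]
  rw [cm_const_mul_real, cm_add continuousOn_const hu, hc] at h1
  refine le_trans ?_ h1
  have := exp_pos a
  nlinarith

lemma pi_mul_le_of_subharmonic_bound {u : ℂ → ℝ} {y : ℂ} {d ρ L : ℝ}
    (hu : ContDiffOn ℝ 2 u (ball y d)) (hl : ∀ z ∈ ball y d, -8 * L ≤ lapC u z) (hρ : 0 < ρ)
    (hρd : ρ ≤ d) (hρL : ρ ^ 2 * L ≤ 1) (hL : 0 ≤ L)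
    (hi : IntegrableOn (fun z => exp (u z)) (ball y ρ)) :
    π * ρ ^ 2 * exp (u y - 2) ≤ ∫ z in ball y ρ, exp (u z) := by
  refine le_setIntegral_ball_of_cm hρ hi fun t ht => ?_
  have hsub := sphere_subset_ball' (c := y) (ht.trans_le hρd)
  have hn : ContDiffOn ℝ 2 (fun w => 2 * L * Complex.normSq (w - y)) (ball y d) :=
    (contDiff_const.mul (contDiff_normSq_sub y)).contDiffOn
  have h1 := le_cm_of_subharmonic (u := fun w => u w + 2 * L * Complex.normSq (w - y))
    (hu.add hn) (fun z hz => by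
      rw [lapC_add isOpen_ball hu hn hz, lapC_const_mul isOpen_ball
        (contDiff_normSq_sub y).contDiffOn _ hz, lapC_normSq_sub]
      linarith [hl z hz]) (ht.trans_le hρd)
  refine le_cm_exp (hu.continuousOn.mono hsub) ?_
  have h2 : cm y (fun w => u w + 2 * L * Complex.normSq (w - y)) t ≤ cm y (fun w => u w + 2) t := by
    refine cm_mono ((hu.add hn).continuousOn.mono hsub)
      ((hu.continuousOn.mono hsub).add continuousOn_const) fun z hz => ?_
    rw [mem_sphere, dist_eq_norm] at hz
    rw [Complex.normSq_eq_norm_sq, hz]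
    have : exp t ^ 2 * L ≤ ρ ^ 2 * L := by
      have := exp_pos t
      gcongr
    linarith
  have h3 : cm y (fun _ : ℂ => (2 : ℝ)) t = 2 * π * 2 := by rw [cm_const, smul_eq_mul]
  rw [cm_add (hu.continuousOn.mono hsub) continuousOn_const, h3] at h2
  simp only [sub_self, map_zero, mul_zero, add_zero] at h1
  linarith

/-- Small energy implies an interior bound for Liouville's equation. -/
lemma sq_mul_exp_le_of_integral_le {u : ℂ → ℝ} {x : ℂ} {r r' : ℝ} (hr : 0 < r) (hr' : r < r')
    (hu : ContDiffOn ℝ 2 u (ball x r')) (hl : ∀ z ∈ ball x r', lapC u z = -2 * exp (u z))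
    (hi : ∫ z in ball x r, exp (u z) ≤ 1 / 4) : r ^ 2 * exp (u x) ≤ 4 := by
  have hsub : closedBall x r ⊆ ball x r' := closedBall_subset_ball hr'
  have hec : ContinuousOn (fun y => exp (u y)) (closedBall x r) := (hu.continuousOn.mono hsub).rexp
  have hic : IntegrableOn (fun y => exp (u y)) (closedBall x r) :=
    hec.integrableOn_compact (isCompact_closedBall x r)
  obtain ⟨y, hy, hmax⟩ := (isCompact_closedBall x r).exists_isMaxOn ⟨x, mem_closedBall_self hr.le⟩
    (f := fun y => (r - dist y x) ^ 2 * exp (u y))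
    (((continuousOn_const.sub (by fun_prop)).pow 2).mul hec)
  have hm : ∀ z ∈ closedBall x r,
      (r - dist z x) ^ 2 * exp (u z) ≤ (r - dist y x) ^ 2 * exp (u y) := fun z hz => hmax hz
  have hx := hm x (mem_closedBall_self hr.le)
  rw [dist_self, sub_zero] at hx
  refine hx.trans ?_
  set d := r - dist y x with hd
  have hd0 : 0 ≤ d := by have := mem_closedBall.1 hy; linarith
  have hdpos : 0 < d := by
    rcases hd0.eq_or_lt with h | h
    · rw [← h] at hx
      have : 0 < r ^ 2 * exp (u x) := by positivity
      simp at hx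
      linarith
    · exact h
  set L := exp (u y) with hL
  have hLpos : 0 < L := exp_pos _
  by_contra! hcon
  have hρ2 : sqrt (1 / L) ^ 2 = 1 / L := sq_sqrt (by positivity)
  have hρd : sqrt (1 / L) ≤ d / 2 := by
    refine sqrt_le_iff.2 ⟨by linarith, ?_⟩
    rw [div_le_iff₀ hLpos]; nlinarith
  have hball : ball y (d / 2) ⊆ closedBall x r := fun z hz => by
    rw [mem_ball] at hz
    rw [mem_closedBall]
    linarith [dist_triangle z y x]
  have hb : ∀ z ∈ ball y (d / 2), exp (u z) ≤ 4 * L := by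
    intro z hz
    have h1 := hm z (hball hz)
    rw [mem_ball] at hz
    have h2 : d / 2 ≤ r - dist z x := by linarith [dist_triangle z y x]
    have h3 : (d / 2) ^ 2 * exp (u z) ≤ d ^ 2 * L :=
      le_trans (mul_le_mul_of_nonneg_right (by gcongr) (exp_pos _).le) h1
    have h4 : d ^ 2 * exp (u z) ≤ d ^ 2 * (4 * L) := by linarith
    exact le_of_mul_le_mul_left h4 (by positivity)
  have hρ0 : 0 < sqrt (1 / L) := by positivity
  have key := pi_mul_le_of_subharmonic_bound (u := u) (y := y) (d := d / 2) (L := L)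
    (hu.mono (hball.trans hsub)) (fun z hz => by
      rw [hl z (hsub (hball hz))]; linarith [hb z hz]) hρ0 hρd
    (by rw [hρ2]; field_simp; rfl) hLpos.le (hic.mono_set ((ball_subset_ball hρd).trans hball))
  have hsub2 : ball y (sqrt (1 / L)) ⊆ ball x r := fun z hz => by
    rw [mem_ball] at *
    linarith [dist_triangle z y x]
  have hle : ∫ z in ball y (sqrt (1 / L)), exp (u z) ≤ ∫ z in ball x r, exp (u z) :=
    setIntegral_mono_set (hic.mono_set ball_subset_closedBall)
      (Eventually.of_forall fun z => (exp_pos _).le) hsub2.eventuallyLE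
  rw [hρ2, exp_sub, ← hL] at key
  have e2 : exp 2 < 8 := by
    have h1 : exp 2 = exp 1 * exp 1 := by rw [← exp_add]; norm_num
    rw [h1]
    have := exp_one_lt_d9
    have := exp_pos 1
    nlinarith
  have h5 : π * (1 / L) * (L / exp 2) = π / exp 2 := by field_simp
  rw [h5] at key
  have h6 : π / 8 < π / exp 2 := div_lt_div_of_pos_left pi_pos (exp_pos 2) e2
  linarith [pi_gt_three]

lemma exists_setIntegral_compl_closedBall_lt {f : ℂ → ℝ} (hf : Integrable f) {ε : ℝ} (hε : 0 < ε) :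
    ∃ r : ℝ, ∀ s : Set ℂ, (∀ z, 0 ≤ f z) → (∀ z ∈ s, r < ‖z‖) → ∫ z in s, f z < ε := by
  have h := tendsto_setIntegral_of_antitone (μ := volume) (f := f)
    (s := fun r : ℝ => (closedBall (0 : ℂ) r)ᶜ) (fun r => measurableSet_closedBall.compl)
    (fun a b hab => Set.compl_subset_compl.2 (closedBall_subset_closedBall hab))
    ⟨0, hf.integrableOn⟩
  have he : (⋂ r : ℝ, (closedBall (0 : ℂ) r)ᶜ) = ∅ := by
    ext z
    simp only [Set.mem_iInter, Set.mem_compl_iff, mem_closedBall, dist_zero_right,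
      Set.mem_empty_iff_false, iff_false, not_forall, not_not]
    exact ⟨‖z‖, le_rfl⟩
  rw [he, setIntegral_empty] at h
  obtain ⟨r, hr⟩ := (h.eventually (gt_mem_nhds hε)).exists
  refine ⟨r, fun s h0 hs => lt_of_le_of_lt ?_ hr⟩
  refine setIntegral_mono_set hf.integrableOn (Eventually.of_forall h0) ?_
  have hsub : s ⊆ (closedBall (0 : ℂ) r)ᶜ := fun z hz => by simpa using hs z hz
  exact hsub.eventuallyLE

lemma isOpen_norm_gt (R : ℝ) : IsOpen {z : ℂ | R < ‖z‖} :=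
  isOpen_lt continuous_const continuous_norm

section
variable {u : ℂ → ℝ} {R : ℝ}

lemma exists_add_log_le (hu : ContDiffOn ℝ 2 u {z | R < ‖z‖})
    (hl : ∀ z : ℂ, R < ‖z‖ → lapC u z = -2 * exp (u z)) (hi : Integrable (fun z => exp (u z))) :
    ∃ r, ∀ z : ℂ, r < ‖z‖ → u z + 2 * Real.log ‖z‖ ≤ Real.log 64 := by
  obtain ⟨r, hr⟩ := exists_setIntegral_compl_closedBall_lt hi (show (0 : ℝ) < 1 / 4 by norm_num)
  refine ⟨max 0 (2 * max r R), fun z hz => ?_⟩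
  have hz0 : 0 < ‖z‖ := (le_max_left _ _).trans_lt hz
  have hz1 : 2 * max r R < ‖z‖ := (le_max_right _ _).trans_lt hz
  have hb : ∀ w ∈ ball z (‖z‖ / 2), max r R < ‖w‖ := by
    intro w hw
    rw [mem_ball, dist_eq_norm] at hw
    have := norm_sub_norm_le z w
    rw [norm_sub_rev] at this
    linarith
  have key := sq_mul_exp_le_of_integral_le (x := z) (r := ‖z‖ / 4) (r' := ‖z‖ / 2) (by linarith)
    (by linarith) (hu.mono fun w hw => (le_max_right _ _).trans_lt (hb w hw))
    (fun w hw => hl w ((le_max_right _ _).trans_lt (hb w hw)))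
    (hr _ (fun w => (exp_pos _).le) fun w hw => (le_max_left _ _).trans_lt
      (hb w (ball_subset_ball (by linarith) hw))).le
  rw [Real.le_log_iff_exp_le (by norm_num), exp_add]
  have : exp (2 * Real.log ‖z‖) = ‖z‖ ^ 2 := by
    rw [two_mul, exp_add, exp_log hz0]; ring
  rw [this]
  linarith

/-- A Harnack type bound for nonnegative subharmonic functions near infinity. -/
lemma le_of_cm_le {B : ℝ} (hR : 1 ≤ R) (hu : ContDiffOn ℝ 2 u {z | R < ‖z‖})
    (hl : ∀ z : ℂ, R < ‖z‖ → 0 ≤ lapC u z) (h0 : ∀ z : ℂ, R < ‖z‖ → 0 ≤ u z) (hB : 0 ≤ B)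
    (h : ∀ t, R < exp t → cm 0 u t ≤ B * (1 + t)) {z : ℂ} (hz : 2 * R < ‖z‖) :
    u z ≤ 2 * B * (2 + Real.log ‖z‖) := by
  have hz0 : 0 < ‖z‖ := by linarith
  have hlog : 0 ≤ Real.log ‖z‖ := Real.log_nonneg (by linarith)
  have hb : ball z (‖z‖ / 2) ⊆ ball 0 (3 * ‖z‖ / 2) \ closedBall 0 (‖z‖ / 2) := by
    intro w hw
    rw [mem_ball, dist_eq_norm] at hw
    have h1 := norm_sub_norm_le z w
    have h2 := norm_sub_norm_le w z
    rw [norm_sub_rev] at h1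
    rw [Set.mem_sdiff, mem_ball_zero_iff, mem_closedBall_zero_iff, not_le]
    constructor <;> linarith
  have hb1 : ball (0 : ℂ) (3 * ‖z‖ / 2) \ closedBall 0 (‖z‖ / 2) ⊆ {z | R < ‖z‖} := by
    intro w hw
    rw [Set.mem_sdiff, mem_ball_zero_iff, mem_closedBall_zero_iff, not_le] at hw
    change R < ‖w‖
    linarith [hw.2]
  have hK : IsCompact (closedBall (0 : ℂ) (3 * ‖z‖ / 2) \ ball 0 (‖z‖ / 2)) :=
    (isCompact_closedBall _ _).diff isOpen_ball
  have hi : IntegrableOn u (ball (0 : ℂ) (3 * ‖z‖ / 2) \ closedBall 0 (‖z‖ / 2)) := by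
    refine IntegrableOn.mono_set (ContinuousOn.integrableOn_compact hK
      (hu.continuousOn.mono fun w hw => ?_))
      (Set.sdiff_subset_sdiff ball_subset_closedBall ball_subset_closedBall)
    rw [Set.mem_sdiff, mem_closedBall_zero_iff, mem_ball_zero_iff, not_lt] at hw
    change R < ‖w‖
    linarith [hw.2]
  have h1 := le_setIntegral_ball_of_cm (f := u) (c := z) (R := ‖z‖ / 2) (a := u z) (by linarith)
    (hi.mono_set hb) fun t ht => le_cm_of_subharmonic (R := ‖z‖ / 2) (hu.mono (hb.trans hb1))
      (fun w hw => hl w (hb1 (hb hw))) ht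
  have h2 := setIntegral_annulus_le (f := u) (c := 0) (a := ‖z‖ / 2) (b := 3 * ‖z‖ / 2)
    (B := B * (2 + Real.log ‖z‖)) (by linarith) (by positivity) hi fun t h1 h2 => by
      refine (h t (by linarith)).trans (mul_le_mul_of_nonneg_left ?_ hB)
      have h3 : t ≤ Real.log (exp 1 * ‖z‖) := by
        rw [Real.le_log_iff_exp_le (by positivity)]
        have := exp_one_gt_d9
        nlinarith
      rw [Real.log_mul (exp_pos 1).ne' hz0.ne', log_exp] at h3
      linarith
  have h3 : ∫ w in ball z (‖z‖ / 2), u w ≤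
      ∫ w in ball (0 : ℂ) (3 * ‖z‖ / 2) \ closedBall 0 (‖z‖ / 2), u w :=
    setIntegral_mono_set hi ((ae_restrict_iff' (measurableSet_ball.diff
      measurableSet_closedBall)).2 (Eventually.of_forall fun w hw => h0 w (hb1 hw))) hb.eventuallyLE
  have h4 : ‖z‖ ^ 2 * (π * u z) ≤ ‖z‖ ^ 2 * (9 / 2 * (B * (2 + Real.log ‖z‖))) := by nlinarith
  have h5 := le_of_mul_le_mul_left h4 (by positivity)
  have h6 := h0 z (by linarith)
  have h7 : 3 * u z ≤ π * u z := mul_le_mul_of_nonneg_right pi_gt_three.le h6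
  have h8 : 0 ≤ B * (2 + Real.log ‖z‖) := by positivity
  linarith

end

lemma exists_abs_sub_le_of_tendsto_deriv {f f' : ℝ → ℝ} {t₀ a : ℝ}
    (hf : ∀ t, t₀ < t → HasDerivAt f (f' t) t) (hf' : Tendsto f' atTop (𝓝 a)) {ε : ℝ} (hε : 0 < ε) :
    ∃ T, ∀ t, T < t → |f t - a * t| ≤ ε * t := by
  obtain ⟨T1, hT1⟩ := eventually_atTop.1 ((Metric.tendsto_nhds.1 hf') (ε / 2) (half_pos hε))
  set T := max (max T1 (t₀ + 1)) 0 with hT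
  have b1 : T1 ≤ T := (le_max_left _ _).trans (le_max_left _ _)
  have b2 : t₀ + 1 ≤ T := (le_max_right _ _).trans (le_max_left _ _)
  have b3 : 0 ≤ T := le_max_right _ _
  set K := |f T - a * T| with hK
  refine ⟨max T (2 * K / ε), fun t ht => ?_⟩
  have h1 : T < t := (le_max_left _ _).trans_lt ht
  have h2 : 2 * K / ε < t := (le_max_right _ _).trans_lt ht
  have h3 : ‖(f t - a * t) - (f T - a * T)‖ ≤ ε / 2 * ‖t - T‖ := by
    refine Convex.norm_image_sub_le_of_norm_hasDerivWithin_le (f := fun t => f t - a * t)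
      (f' := fun t => f' t - a) (s := Set.Ici T) (fun x hx => ?_) (fun x hx => ?_) (convex_Ici T)
      Set.self_mem_Ici h1.le
    · have hx' : T ≤ x := hx
      have h5 : HasDerivAt (fun t => a * t) a x := by simpa using (hasDerivAt_id x).const_mul a
      exact ((hf x (by linarith)).sub h5).hasDerivWithinAt
    · have hx' : T ≤ x := hx
      have := hT1 x (by linarith)
      rw [dist_eq_norm] at this
      exact this.le
  rw [norm_of_nonneg (by linarith : 0 ≤ t - T), Real.norm_eq_abs] at h3
  rw [div_lt_iff₀ hε] at h2
  have h4 := abs_sub_abs_le_abs_sub (f t - a * t) (f T - a * T)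
  nlinarith

section
variable {U : ℂ → ℝ} {T K C : ℝ}

lemma exists_norm_dz_le_mul_re (hU : ContDiffOn ℝ 2 U {ζ | T < ζ.re})
    (hK : ∀ ζ : ℂ, T < ζ.re → |lapC U ζ| ≤ K) (hC : ∀ ζ : ℂ, T < ζ.re → |U ζ| ≤ C * (2 + ζ.re))
    (hC0 : 0 < C) {ε : ℝ} (hε : 0 < ε) :
    ∃ T', ∀ ζ : ℂ, T' < ζ.re → ‖dz (fun w => (U w : ℂ)) ζ‖ ≤ ε * ζ.re := by
  set r := 36 * C / ε with hr
  have hr0 : 0 < r := by positivity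
  set b := ε / 4 * (2 + r) + K * r / 4 with hb
  refine ⟨max (T + r) (max r (2 * b / ε)), fun ζ hζ => ?_⟩
  have a1 : T + r < ζ.re := (le_max_left _ _).trans_lt hζ
  have a2 : r < ζ.re := (le_max_left _ _).trans_lt ((le_max_right _ _).trans_lt hζ)
  have a3 : 2 * b / ε < ζ.re := (le_max_right _ _).trans_lt ((le_max_right _ _).trans_lt hζ)
  have hre : ∀ w ∈ ball ζ r, T < w.re ∧ w.re < ζ.re + r := by
    intro w hw
    have := abs_lt.1 (abs_re_sub_lt hw)
    constructor <;> linarith [this.1, this.2]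
  have key := norm_dz_le (u := U) (c := ζ) (R := r) (M := C * (2 + (ζ.re + r))) (K := K) (a := 0)
    hr0 (hU.mono fun w hw => (hre w hw).1) (fun w hw => by
      rw [sub_zero]
      refine (hC w (hre w hw).1).trans (mul_le_mul_of_nonneg_left ?_ hC0.le)
      linarith [(hre w hw).2]) (fun w hw => hK w (hre w hw).1)
  refine key.trans ?_
  have h1 : 9 * (C * (2 + (ζ.re + r))) / r = ε / 4 * (2 + (ζ.re + r)) := by
    rw [hr]; field_simp; ring
  rw [h1]
  rw [div_lt_iff₀ hε] at a3
  nlinarith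

lemma abs_sub_le_of_norm_dz_le {G : ℝ} (hU : ContDiffOn ℝ 2 U {ζ | T < ζ.re})
    {x : ℝ} (hx : T < x) (hG : ∀ ζ : ℂ, ζ.re = x → ‖dz (fun w => (U w : ℂ)) ζ‖ ≤ G) (a b : ℝ) :
    |U (x + a * Complex.I) - U (x + b * Complex.I)| ≤ 2 * G * |a - b| := by
  have hd : ∀ y : ℝ, DifferentiableAt ℝ U (x + y * Complex.I) := fun y =>
    (hU.of_le (by norm_num)).differentiableAt_of_mem (isOpen_re_gt T) (by
      change T < ((x : ℂ) + y * Complex.I).re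
      simpa using hx)
  have h := Convex.norm_image_sub_le_of_norm_hasDerivWithin_le
    (f := fun y : ℝ => (U (x + y * Complex.I) : ℂ)) (s := Set.univ) (C := 2 * G) (x := b) (y := a)
    (fun y _ => (hasDerivAt_vertical (g := fun w => (U w : ℂ)) (x := x) (y := y)
      (Complex.ofRealCLM.differentiableAt.comp _ (hd y))).hasDerivWithinAt)
    (fun y _ => by
      rw [← dz_ofReal U (hd y), norm_mul, Complex.norm_I, one_mul]
      refine (norm_sub_le _ _).trans ?_
      rw [RCLike.norm_conj]
      have := hG (x + y * Complex.I) (by simp)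
      linarith) convex_univ (Set.mem_univ _) (Set.mem_univ _)
  rwa [← Complex.ofReal_sub, Complex.norm_real] at h

end

section
variable {u : ℂ → ℝ} {R l : ℝ}

lemma mem_exp_of_log_lt (hR : 0 < R) {ζ : ℂ} (hζ : Real.log R < ζ.re) :
    R < ‖0 + Complex.exp ((1 : ℝ) * ζ)‖ := by
  rw [zero_add, Complex.norm_exp, ← Real.log_lt_iff_lt_exp hR]
  simpa using hζ

lemma exists_abs_endPull_le (hu : ContDiffOn ℝ 2 u {z | R < ‖z‖})
    (hl : ∀ z : ℂ, R < ‖z‖ → lapC u z = -2 * exp (u z)) (hi : Integrable (fun z => exp (u z)))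
    (hlim : Tendsto (cmd 0 u) atTop (𝓝 (-(4 * π * (1 + l))))) :
    ∃ T C : ℝ, 0 < C ∧ ∀ ζ : ℂ, T < ζ.re → endPull u 0 1 ζ ≤ Real.log 64 ∧
      |endPull u 0 1 ζ| ≤ C * (2 + ζ.re) := by
  obtain ⟨r, hr⟩ := exists_add_log_le hu hl hi
  obtain ⟨T1, hT1⟩ := exists_abs_sub_le_of_tendsto_deriv (f := cm 0 u) (t₀ := Real.log (max 1 R))
    (fun t ht => by
      rw [Real.log_lt_iff_lt_exp (by positivity)] at ht
      refine hasDerivAt_cm_real (isOpen_norm_gt R) (hu.of_le (by norm_num)) fun z hz => ?_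
      rw [mem_sphere_zero_iff_norm] at hz
      change R < ‖z‖
      rw [hz]
      exact (le_max_right _ _).trans_lt ht) hlim one_pos
  set R1 := max (max 1 R) (max r (exp (max T1 0))) with hR1
  have c1 : 1 ≤ R1 := (le_max_left _ _).trans (le_max_left _ _)
  have c2 : R ≤ R1 := (le_max_right _ _).trans (le_max_left _ _)
  have c3 : r ≤ R1 := (le_max_left _ _).trans (le_max_right _ _)
  have c4 : exp (max T1 0) ≤ R1 := (le_max_right _ _).trans (le_max_right _ _)
  have hlogC : ContDiffOn ℝ 2 (fun z : ℂ => Real.log ‖z - 0‖) {z | R1 < ‖z‖} :=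
    (contDiffOn_log_norm_sub 0).mono fun z hz => by
      have hz' : R1 < ‖z‖ := hz
      rw [Set.mem_compl_singleton_iff, ← norm_pos_iff]
      linarith
  have hu1 : ContDiffOn ℝ 2 u {z | R1 < ‖z‖} := hu.mono fun z hz => c2.trans_lt hz
  have hf1 : ContDiffOn ℝ 2 (fun z : ℂ => u z + 2 * Real.log ‖z - 0‖) {z | R1 < ‖z‖} :=
    hu1.add (contDiffOn_const.mul hlogC)
  have hf : ContDiffOn ℝ 2 (fun z : ℂ => Real.log 64 + (-1) * (u z + 2 * Real.log ‖z - 0‖))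
      {z | R1 < ‖z‖} := contDiffOn_const.add (contDiffOn_const.mul hf1)
  set A := 2 * π * Real.log 64 with hA
  have hA0 : 0 ≤ A := by have := Real.log_nonneg (show (1 : ℝ) ≤ 64 by norm_num); positivity
  set D := 4 * π * |1 + l| + 1 with hD
  have hD0 : 0 < D := by positivity
  have hlow : ∀ z : ℂ, 2 * R1 < ‖z‖ → Real.log 64 + (-1) * (u z + 2 * Real.log ‖z - 0‖)
      ≤ 2 * (A + D) * (2 + Real.log ‖z‖) := by
    intro z hz
    refine le_of_cm_le (u := fun z : ℂ => Real.log 64 + (-1) * (u z + 2 * Real.log ‖z - 0‖)) c1 hf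
      (fun w hw => ?_) (fun w hw => ?_) (by positivity) (fun t ht => ?_) hz
    · have hw0 : w ≠ 0 := by rw [← norm_pos_iff]; linarith
      rw [lapC_add (isOpen_norm_gt R1) contDiffOn_const (contDiffOn_const.mul hf1) hw, lapC_const,
        lapC_const_mul (isOpen_norm_gt R1) hf1 _ hw,
        lapC_add (isOpen_norm_gt R1) hu1 (contDiffOn_const.mul hlogC) hw,
        lapC_const_mul (isOpen_norm_gt R1) hlogC _ hw, lapC_log_norm_sub hw0,
        hl w (c2.trans_lt hw)]
      have := exp_pos (u w)
      linarith
    · have := hr w (c3.trans_lt hw)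
      rw [sub_zero]
      linarith
    · have hs : sphere (0 : ℂ) (exp t) ⊆ {z | R1 < ‖z‖} := fun w hw => by
        rw [mem_sphere_zero_iff_norm] at hw
        change R1 < ‖w‖
        rwa [hw]
      have ht1 : max T1 0 < t := exp_lt_exp.1 (c4.trans_lt ht)
      have h1 := hT1 t ((le_max_left _ _).trans_lt ht1)
      have ht0 : 0 < t := (le_max_right _ _).trans_lt ht1
      have e : cm 0 (fun z : ℂ => Real.log 64 + (-1) * (u z + 2 * Real.log ‖z - 0‖)) t
          = cm 0 (fun z : ℂ => (Real.log 64 - 2 * t) - u z) t := by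
        refine cm_congr fun w hw => ?_
        rw [mem_sphere, dist_eq_norm] at hw
        rw [hw, log_exp]; ring
      rw [e, cm_sub continuousOn_const (hu1.continuousOn.mono hs), cm_const, smul_eq_mul]
      have h2 := (abs_le.1 h1).1
      have h3 : -(4 * π * |1 + l|) * t ≤ -(4 * π * (1 + l)) * t := by
        have := le_abs_self (1 + l)
        have := pi_pos
        gcongr
      have h4 : (0 : ℝ) ≤ A * t := by positivity
      have h5 : (0 : ℝ) ≤ 4 * π * t := by positivity
      simp only [hD, hA] at *
      linarith
  refine ⟨Real.log (2 * R1), 2 * (A + D) + A + Real.log 64, by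
    have := Real.log_nonneg (show (1 : ℝ) ≤ 64 by norm_num)
    positivity, fun ζ hζ => ?_⟩
  have hn : 2 * R1 < ‖0 + Complex.exp ((1 : ℝ) * ζ)‖ := mem_exp_of_log_lt (by linarith) hζ
  have hlogn : Real.log ‖0 + Complex.exp ((1 : ℝ) * ζ)‖ = ζ.re := by
    rw [zero_add, Complex.norm_exp, log_exp]; simp
  have h1 := hr _ (show r < ‖0 + Complex.exp ((1 : ℝ) * ζ)‖ by linarith)
  have h2 := hlow _ hn
  rw [sub_zero] at h2
  rw [hlogn] at h1 h2
  have hre : 0 < ζ.re := (Real.log_pos (by linarith)).trans hζ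
  have h64 := Real.log_nonneg (show (1 : ℝ) ≤ 64 by norm_num)
  have hE : endPull u 0 1 ζ = u (0 + Complex.exp ((1 : ℝ) * ζ)) + 2 * ζ.re := by
    rw [endPull]; ring
  rw [hE]
  refine ⟨h1, abs_le.2 ⟨?_, ?_⟩⟩
  · have h3 : 0 ≤ A * (2 + ζ.re) := by positivity
    have h4 : 0 ≤ Real.log 64 * (2 + ζ.re) := by positivity
    linarith
  · have h3 : 0 ≤ A * (2 + ζ.re) := by positivity
    have h4 : 0 ≤ Real.log 64 * ζ.re := by positivity
    have h5 : 0 ≤ 2 * (A + D) * (2 + ζ.re) := by positivity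
    linarith

/-- A finite energy solution has logarithmic growth at infinity determined by its flux. -/
lemma exists_abs_add_log_le (hR : 0 < R) (hu : ContDiffOn ℝ 2 u {z | R < ‖z‖})
    (hl : ∀ z : ℂ, R < ‖z‖ → lapC u z = -2 * exp (u z)) (hi : Integrable (fun z => exp (u z)))
    (hlim : Tendsto (cmd 0 u) atTop (𝓝 (-(4 * π * (1 + l))))) {ε : ℝ} (hε : 0 < ε) :
    ∃ T', ∀ z : ℂ, T' < Real.log ‖z‖ →
      |u z + 2 * (1 + l) * Real.log ‖z‖| ≤ ε * Real.log ‖z‖ := by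
  obtain ⟨T, C, hC0, hTC⟩ := exists_abs_endPull_le hu hl hi hlim
  set T2 := max T (max 0 (Real.log R)) with hT2
  have hV : ∀ ζ : ℂ, T2 < ζ.re → (0 : ℂ) + Complex.exp ((1 : ℝ) * ζ) ∈ {z : ℂ | R < ‖z‖} :=
    fun ζ hζ => mem_exp_of_log_lt hR
      ((le_max_right _ _).trans_lt ((le_max_right _ _).trans_lt hζ))
  have hU : ContDiffOn ℝ 2 (endPull u 0 1) {ζ | T2 < ζ.re} := contDiffOn_endPull hu hV
  have hδ : 0 < ε / (16 * π) := by positivity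
  obtain ⟨T3, hT3⟩ := exists_norm_dz_le_mul_re (K := 128) hU (fun ζ hζ => by
      rw [lapC_endPull_of_liouville (isOpen_norm_gt R) hu (fun z hz => hl z hz) (by norm_num)
        (hV ζ hζ), abs_mul, abs_of_pos (exp_pos _)]
      have h := exp_le_exp.2 (hTC ζ ((le_max_left _ _).trans_lt hζ)).1
      rw [exp_log (by norm_num)] at h
      norm_num
      linarith)
    (fun ζ hζ => (hTC ζ ((le_max_left _ _).trans_lt hζ)).2) hC0 hδ
  obtain ⟨T4, hT4⟩ := exists_abs_sub_le_of_tendsto_deriv (f := cm 0 u) (t₀ := Real.log R)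
    (fun t ht => by
      rw [Real.log_lt_iff_lt_exp hR] at ht
      refine hasDerivAt_cm_real (isOpen_norm_gt R) (hu.of_le (by norm_num)) fun z hz => ?_
      rw [mem_sphere_zero_iff_norm] at hz
      change R < ‖z‖
      rwa [hz]) hlim hε
  refine ⟨max T2 (max T3 T4), fun z hz => ?_⟩
  set t := Real.log ‖z‖ with ht
  have d2 : T2 < t := (le_max_left _ _).trans_lt hz
  have d3 : T3 < t := (le_max_left _ _).trans_lt ((le_max_right _ _).trans_lt hz)
  have d4 : T4 < t := (le_max_right _ _).trans_lt ((le_max_right _ _).trans_lt hz)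
  have ht0 : 0 < t := (le_max_left _ _).trans_lt ((le_max_right _ _).trans_lt d2)
  have htR : R < exp t := by
    rw [← Real.log_lt_iff_lt_exp hR]
    exact (le_max_right _ _).trans_lt ((le_max_right _ _).trans_lt d2)
  have hz0 : z ≠ 0 := by
    rintro rfl
    simp [ht] at ht0
  have hnz : ‖z‖ = exp t := by rw [ht, exp_log (norm_pos_iff.2 hz0)]
  have hcoord : ∀ w : ℂ, ‖w‖ = exp t → u w = endPull u 0 1 (t + w.arg * Complex.I) - 2 * t := by
    intro w hw
    have hw0 : w ≠ 0 := by rw [← norm_pos_iff, hw]; exact exp_pos t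
    have e : Complex.exp ((1 : ℝ) * (t + w.arg * Complex.I)) = w := by
      rw [Complex.ofReal_one, one_mul]
      have : (t + w.arg * Complex.I : ℂ) = Complex.log w := by
        rw [Complex.log, hw, log_exp]
      rw [this, Complex.exp_log hw0]
    rw [endPull, e]
    simp
  have hosc : ∀ w : ℂ, ‖w‖ = exp t → |u w - u z| ≤ ε * t / 4 := by
    intro w hw
    rw [hcoord w hw, hcoord z hnz, sub_sub_sub_cancel_right]
    refine (abs_sub_le_of_norm_dz_le hU d2 (G := ε / (16 * π) * t) (fun ζ hζ => by
      have := hT3 ζ (by rwa [hζ])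
      rwa [hζ] at this) w.arg z.arg).trans ?_
    have h1 := Complex.abs_arg_le_pi w
    have h2 := Complex.abs_arg_le_pi z
    have h3 : |w.arg - z.arg| ≤ 2 * π := (abs_sub _ _).trans (by linarith)
    calc 2 * (ε / (16 * π) * t) * |w.arg - z.arg|
        ≤ 2 * (ε / (16 * π) * t) * (2 * π) := by gcongr
      _ = ε * t / 4 := by field_simp; ring
  have hs : sphere (0 : ℂ) (exp t) ⊆ {z | R < ‖z‖} := fun w hw => by
    rw [mem_sphere_zero_iff_norm] at hw
    change R < ‖w‖
    rwa [hw]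
  have h1 : ‖cm 0 (fun w => u w - u z) t‖ ≤ 2 * π * (ε * t / 4) := norm_cm_le fun w hw => by
    rw [mem_sphere_zero_iff_norm] at hw
    exact hosc w hw
  rw [cm_sub (hu.continuousOn.mono hs) continuousOn_const, cm_const, smul_eq_mul,
    Real.norm_eq_abs] at h1
  have h2 := hT4 t d4
  have h3 : |2 * π * (u z + 2 * (1 + l) * t)| ≤ 2 * π * (ε * t / 4) + ε * t := by
    have e : 2 * π * (u z + 2 * (1 + l) * t)
        = (cm 0 u t - -(4 * π * (1 + l)) * t) - (cm 0 u t - 2 * π * u z) := by ring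
    rw [e]
    refine (abs_sub _ _).trans ?_
    linarith
  rw [abs_mul, abs_of_pos (by positivity : 0 < 2 * π)] at h3
  have h4 : 0 < ε * t := by positivity
  have h5 : 2 * π * |u z + 2 * (1 + l) * t| ≤ 2 * π * (ε * t) := by
    nlinarith [pi_gt_three]
  exact le_of_mul_le_mul_left h5 (by positivity)

end

section
variable {u w : ℂ → ℝ} {c : ℂ} {a b : ℝ}

lemma tendsto_cmd_atTop_of_atBot (hw : ContDiffOn ℝ 2 w {c}ᶜ) (hi : Integrable (lapC w))
    (ha : Tendsto (cmd c w) atBot (𝓝 a)) :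
    Tendsto (cmd c w) atTop (𝓝 (a + ∫ z, lapC w z)) := by
  have hd : ∀ t, HasDerivAt (cmd c w) (exp (2 * t) * cm c (lapC w) t) t := fun t =>
    hasDerivAt_cmd isOpen_compl_singleton hw fun z hz => by
      have : z ≠ c := by
        rintro rfl
        simp [(exp_pos t).ne] at hz
      exact this
  obtain ⟨h1, h2⟩ := integrable_integral_cm hi c
  have h3 := tendsto_limUnder_of_hasDerivAt_of_integrableOn_Ioi (a := 0) (fun t _ => hd t)
    (by simpa [smul_eq_mul] using h1.integrableOn)
  have h4 := integral_of_hasDerivAt_of_tendsto hd (by simpa [smul_eq_mul] using h1) ha h3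
  simp only [smul_eq_mul] at h2
  rw [h2] at h4
  rw [h4]
  simpa using h3

lemma tendsto_cmd_atBot {R : ℝ} (hR : 0 < R) (hw : ContDiffOn ℝ 1 w (ball c R \ {c}))
    {l : ℂ} (h : Tendsto (fun z => (z - c) * dz (fun y => (w y : ℂ)) z) (𝓝[≠] c) (𝓝 l)) :
    Tendsto (cmd c w) atBot (𝓝 (4 * π * l.re)) := by
  set F : ℂ → ℂ := fun z => (z - c) * dz (fun y => (w y : ℂ)) z with hF
  have ho : IsOpen (ball c R \ {c}) := isOpen_ball.sdiff isClosed_singleton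
  have hc : ContinuousOn (Function.update F c l) (ball c R) := by
    intro z hz
    by_cases hzc : z = c
    · subst hzc
      exact (continuousAt_update_same.2 h).continuousWithinAt
    · have h1 : ContinuousAt F z :=
        ((continuousOn_id.sub continuousOn_const).mul
          (hw.complexOfReal.continuousOn_dz ho)).continuousAt (ho.mem_nhds ⟨hz, hzc⟩)
      exact ((continuousAt_update_of_ne hzc).2 h1).continuousWithinAt
  have h2 := tendsto_cm_atBot hR hc
  rw [Function.update_self] at h2
  have h3 : ∀ t, cm c (Function.update F c l) t = cm c F t := fun t => cm_congr fun z hz => by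
    have : z ≠ c := by
      rintro rfl
      simp [(exp_pos t).ne] at hz
    rw [Function.update_of_ne this]
  have h4 : Tendsto (fun t => 2 * (cm c F t).re) atBot (𝓝 (2 * ((2 * π) • l).re)) :=
    ((Complex.continuous_re.tendsto _).comp (h2.congr h3)).const_mul 2
  have h5 : 2 * ((2 * π) • l).re = 4 * π * l.re := by
    rw [Complex.smul_re, smul_eq_mul]; ring
  rw [h5] at h4
  exact h4

lemma cmd_congr {Ω : Set ℂ} (hΩ : IsOpen Ω) {t : ℝ} (h : Set.EqOn u w Ω)
    (hs : sphere c (exp t) ⊆ Ω) : cmd c u t = cmd c w t := by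
  unfold cmd
  congr 2
  refine cm_congr fun z hz => ?_
  congr 1
  exact dz_eq_of_eventuallyEq (by
    filter_upwards [hΩ.mem_nhds (hs hz)] with y hy
    rw [h hy])

lemma cmd_zero (t : ℝ) : cmd c (fun _ => 0) t = 0 := by
  have : cm c (fun z => (z - c) * dz (fun _ => ((0 : ℝ) : ℂ)) z) t = cm c (fun _ => (0 : ℂ)) t :=
    cm_congr fun z _ => by rw [dz_const, mul_zero]
  change 2 * (cm c (fun z => (z - c) * dz (fun _ => ((0 : ℝ) : ℂ)) z) t).re = 0
  rw [this, cm_const]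
  simp

lemma tendsto_cmd_atTop_of_punctures {l m : ℂ} (hu : ContDiffOn ℝ 2 u {0, 1}ᶜ)
    (hi : Integrable (lapC u))
    (h0 : Tendsto (fun z => (z - 0) * dz (fun y => (u y : ℂ)) z) (𝓝[≠] 0) (𝓝 l))
    (h1 : Tendsto (fun z => (z - 1) * dz (fun y => (u y : ℂ)) z) (𝓝[≠] 1) (𝓝 m)) :
    Tendsto (cmd 0 u) atTop (𝓝 (4 * π * (l.re + m.re) + ∫ z, lapC u z)) := by
  have ho : IsOpen ({0, 1}ᶜ : Set ℂ) := (Set.toFinite {0, 1}).isClosed.isOpen_compl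
  let κ : ContDiffBump (1 : ℂ) := ⟨1 / 4, 1 / 2, by norm_num, by norm_num⟩
  have hκ : ∀ {s : Set ℂ}, ContDiffOn ℝ 2 κ s := κ.contDiff.contDiffOn
  have hκ1 : ∀ z, ‖z - 1‖ < 1 / 4 → κ z = 1 := fun z hz =>
    κ.one_of_mem_closedBall (by rw [mem_closedBall, dist_eq_norm]; exact hz.le)
  have hκ0 : ∀ z, 1 / 2 < ‖z - 1‖ → κ z = 0 := fun z hz =>
    κ.zero_of_le_dist (by rw [dist_eq_norm]; exact hz.le)
  set w : ℂ → ℝ := fun z => κ z * u z with hw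
  set w' : ℂ → ℝ := fun z => (1 - κ z) * u z with hw'
  have hfar : IsOpen {z : ℂ | 1 / 2 < ‖z - 1‖} :=
    isOpen_lt continuous_const (continuous_id.sub continuous_const).norm
  have hnear : IsOpen {z : ℂ | ‖z - 1‖ < 1 / 4} :=
    isOpen_lt (continuous_id.sub continuous_const).norm continuous_const
  have ew : Set.EqOn w (fun _ => 0) {z : ℂ | 1 / 2 < ‖z - 1‖} := fun z hz => by
    simp [hw, hκ0 z hz]
  have ew' : Set.EqOn w' u {z : ℂ | 1 / 2 < ‖z - 1‖} := fun z hz => by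
    simp [hw', hκ0 z hz]
  have fw : Set.EqOn w u {z : ℂ | ‖z - 1‖ < 1 / 4} := fun z hz => by
    simp [hw, hκ1 z hz]
  have fw' : Set.EqOn w' (fun _ => 0) {z : ℂ | ‖z - 1‖ < 1 / 4} := fun z hz => by
    simp [hw', hκ1 z hz]
  have cw : ContDiffOn ℝ 2 w {0, 1}ᶜ := hκ.mul hu
  have cw' : ContDiffOn ℝ 2 w' {0, 1}ᶜ := (contDiffOn_const.sub hκ).mul hu
  have hw1 : ContDiffOn ℝ 2 w {1}ᶜ := by
    intro z hz
    by_cases h : z = 0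
    · refine (ContDiffAt.congr_of_eventuallyEq contDiffAt_const
        (Filter.eventuallyEq_of_mem (hfar.mem_nhds ?_) ew)).contDiffWithinAt
      change 1 / 2 < ‖z - 1‖
      rw [h]; norm_num
    · exact (cw.contDiffAt (ho.mem_nhds (by simp [h]; exact hz))).contDiffWithinAt
  have hw0 : ContDiffOn ℝ 2 w' {0}ᶜ := by
    intro z hz
    by_cases h : z = 1
    · refine (ContDiffAt.congr_of_eventuallyEq contDiffAt_const
        (Filter.eventuallyEq_of_mem (hnear.mem_nhds ?_) fw')).contDiffWithinAt
      change ‖z - 1‖ < 1 / 4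
      rw [h]; norm_num
    · exact (cw'.contDiffAt (ho.mem_nhds (by simp [h]; exact hz))).contDiffWithinAt
  have hae : ∀ᵐ z : ℂ, z ∈ ({0, 1}ᶜ : Set ℂ) :=
    (Set.toFinite ({0, 1} : Set ℂ)).countable.ae_notMem volume
  have hsum : ∀ᵐ z : ℂ, lapC u z = lapC w z + lapC w' z := by
    filter_upwards [hae] with z hz
    rw [← lapC_add ho cw cw' hz]
    refine lapC_eq_of_eventuallyEq (Eventually.of_forall fun y => ?_)
    simp only [hw, hw']; ring
  have iw : Integrable (lapC w) := by
    have hK : IsCompact (closedBall (1 : ℂ) (1 / 2) \ ball 1 (1 / 4)) :=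
      (isCompact_closedBall _ _).diff isOpen_ball
    have i1 : IntegrableOn (lapC w) (closedBall (1 : ℂ) (1 / 2) \ ball 1 (1 / 4)) := by
      refine ContinuousOn.integrableOn_compact hK
        ((continuousOn_lapC isOpen_compl_singleton hw1).mono ?_)
      rintro z ⟨-, hz⟩ rfl
      exact hz (mem_ball_self (by norm_num))
    have i2 : IntegrableOn (lapC w) (ball 1 (1 / 4)) := by
      refine hi.integrableOn.congr_fun (fun z hz => ?_) measurableSet_ball
      rw [mem_ball, dist_eq_norm] at hz
      exact (lapC_eq_of_eventuallyEq (Filter.eventuallyEq_of_mem (hnear.mem_nhds hz) fw)).symm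
    have i3 : IntegrableOn (lapC w) (closedBall 1 (1 / 2))ᶜ := by
      refine integrableOn_zero.congr_fun (fun z hz => ?_) measurableSet_closedBall.compl
      rw [Set.mem_compl_iff, mem_closedBall, dist_eq_norm, not_le] at hz
      rw [lapC_eq_of_eventuallyEq (Filter.eventuallyEq_of_mem (hfar.mem_nhds hz) ew),
        lapC_const]
    rw [← integrableOn_univ]
    refine ((i1.union i2).union i3).mono_set fun z _ => ?_
    by_cases hz : z ∈ closedBall (1 : ℂ) (1 / 2)
    · by_cases hz' : z ∈ ball (1 : ℂ) (1 / 4)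
      · exact Or.inl (Or.inr hz')
      · exact Or.inl (Or.inl ⟨hz, hz'⟩)
    · exact Or.inr hz
  have iw' : Integrable (lapC w') := by
    refine (hi.sub iw).congr ?_
    filter_upwards [hsum] with z hz
    simp [hz]
  have hdz : ∀ {v : ℂ → ℝ} {c : ℂ} {s : Set ℂ} {l : ℂ}, IsOpen s → c ∈ s → Set.EqOn u v s →
      Tendsto (fun z => (z - c) * dz (fun y => (u y : ℂ)) z) (𝓝[≠] c) (𝓝 l) →
      Tendsto (fun z => (z - c) * dz (fun y => (v y : ℂ)) z) (𝓝[≠] c) (𝓝 l) := by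
    intro v c s l hs hc he h
    refine h.congr' ?_
    filter_upwards [nhdsWithin_le_nhds (hs.mem_nhds hc)] with z hz
    congr 1
    refine dz_eq_of_eventuallyEq ?_
    filter_upwards [hs.mem_nhds hz] with y hy
    rw [he hy]
  have t1 := tendsto_cmd_atTop_of_atBot hw1 iw (tendsto_cmd_atBot one_pos
    ((hw1.of_le (by norm_num)).mono (by intro z hz; exact hz.2))
    (hdz hnear (by simp) fw.symm h1))
  have t2 := tendsto_cmd_atTop_of_atBot hw0 iw' (tendsto_cmd_atBot one_pos
    ((hw0.of_le (by norm_num)).mono (by intro z hz; exact hz.2))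
    (hdz hfar (by change 1 / 2 < ‖(0 : ℂ) - 1‖; norm_num) ew'.symm h0))
  have t3 : Tendsto (cmd 1 w) atTop (𝓝 0) := by
    refine tendsto_const_nhds.congr' ?_
    filter_upwards [eventually_gt_atTop 0] with t ht
    rw [cmd_congr hfar ew, cmd_zero]
    intro z hz
    rw [mem_sphere, dist_eq_norm] at hz
    change 1 / 2 < ‖z - 1‖
    rw [hz]
    linarith [Real.one_lt_exp_iff.2 ht]
  have e1 := tendsto_nhds_unique t1 t3
  have e2 : ∫ z, lapC u z = (∫ z, lapC w z) + ∫ z, lapC w' z := by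
    rw [← integral_add iw iw']
    exact integral_congr_ae hsum
  have e3 : 4 * π * (l.re + m.re) + ∫ z, lapC u z = 4 * π * l.re + ∫ z, lapC w' z := by
    rw [e2]; linarith
  rw [e3]
  refine t2.congr' ?_
  filter_upwards [eventually_gt_atTop 1] with t ht
  refine cmd_congr hfar ew' fun z hz => ?_
  rw [mem_sphere, dist_eq_norm, sub_zero] at hz
  change 1 / 2 < ‖z - 1‖
  have := norm_sub_norm_le z 1
  rw [hz, norm_one] at this
  linarith [Real.add_one_le_exp t]

lemma pos_of_tendsto_cmd {R l : ℝ} (hR : 0 < R) (hu : ContDiffOn ℝ 2 u {z | R < ‖z‖})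
    (hl : ∀ z : ℂ, R < ‖z‖ → lapC u z = -2 * exp (u z)) (hi : Integrable (fun z => exp (u z)))
    (hlim : Tendsto (cmd 0 u) atTop (𝓝 (-(4 * π * (1 + l))))) : 0 < l := by
  by_contra! h
  have hs : ∀ {t}, Real.log R < t → sphere (0 : ℂ) (exp t) ⊆ {z | R < ‖z‖} := by
    intro t ht z hz
    rw [mem_sphere, dist_eq_norm, sub_zero] at hz
    change R < ‖z‖
    rw [hz]
    exact (Real.log_lt_iff_lt_exp hR).1 ht
  have hd : ∀ t, Real.log R < t →
      HasDerivAt (cmd 0 u) (exp (2 * t) * cm 0 (lapC u) t) t := fun t ht =>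
    hasDerivAt_cmd (isOpen_norm_gt R) hu (hs ht)
  have hneg : ∀ t, Real.log R < t → exp (2 * t) * cm 0 (lapC u) t ≤ 0 := by
    intro t ht
    refine mul_nonpos_of_nonneg_of_nonpos (exp_pos _).le ?_
    have h1 : cm 0 (lapC u) t = cm 0 (fun z => -2 * exp (u z)) t :=
      cm_congr fun z hz => hl z (hs ht hz)
    rw [h1, cm_const_mul_real]
    have := cm_nonneg (f := fun z => exp (u z)) (c := 0) (t := t) fun z _ => (exp_pos _).le
    linarith
  have hanti : AntitoneOn (cmd 0 u) (Set.Ioi (Real.log R)) := by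
    refine antitoneOn_of_deriv_nonpos (convex_Ioi _)
      (fun t ht => (hd t ht).continuousAt.continuousWithinAt) ?_ ?_
    · rw [interior_Ioi]
      exact fun t ht => (hd t ht).differentiableAt.differentiableWithinAt
    · rw [interior_Ioi]
      intro t ht
      rw [(hd t ht).deriv]
      exact hneg t ht
  have hge : ∀ t, Real.log R < t → -(4 * π) ≤ cmd 0 u t := by
    intro t ht
    have h1 : -(4 * π * (1 + l)) ≤ cmd 0 u t := by
      refine le_of_tendsto hlim ?_
      filter_upwards [eventually_ge_atTop t] with s hst
      exact hanti ht (ht.trans_le hst) hst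
    nlinarith [pi_pos]
  have hm : MonotoneOn (fun t => cm 0 u t + 4 * π * t) (Set.Ioi (Real.log R)) := by
    have hd' : ∀ t, Real.log R < t →
        HasDerivAt (fun t => cm 0 u t + 4 * π * t) (cmd 0 u t + 4 * π) t := fun t ht => by
      have := (hasDerivAt_cm_real (isOpen_norm_gt R) (hu.of_le (by norm_num)) (hs ht)).add
        ((hasDerivAt_id t).const_mul (4 * π))
      refine this.congr_deriv ?_
      ring
    refine monotoneOn_of_deriv_nonneg (convex_Ioi _)
      (fun t ht => (hd' t ht).continuousAt.continuousWithinAt) ?_ ?_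
    · rw [interior_Ioi]
      exact fun t ht => (hd' t ht).differentiableAt.differentiableWithinAt
    · rw [interior_Ioi]
      intro t ht
      rw [(hd' t ht).deriv]
      linarith [hge t ht]
  set t₀ := Real.log R + 1 with ht₀
  set a := (cm 0 u t₀ + 4 * π * t₀) / (2 * π) with ha
  have hlow : ∀ t, t₀ ≤ t → 2 * π * exp a ≤ exp (2 * t) * cm 0 (fun z => exp (u z)) t := by
    intro t ht
    have h0 : Real.log R < t := by linarith
    have h1 : cm 0 u t₀ + 4 * π * t₀ ≤ cm 0 u t + 4 * π * t :=
      hm (by change Real.log R < t₀; linarith) h0 ht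
    have h2 := le_cm_exp (hu.continuousOn.mono (hs h0)) (a := a - 2 * t) (by
      have : 2 * π * a = cm 0 u t₀ + 4 * π * t₀ := by rw [ha]; field_simp
      linarith)
    calc 2 * π * exp a = exp (2 * t) * (2 * π * exp (a - 2 * t)) := by
          rw [Real.exp_sub]; field_simp
      _ ≤ _ := mul_le_mul_of_nonneg_left h2 (exp_pos _).le
  have hint := (integrable_integral_cm hi 0).1.integrableOn (s := Set.Ioi t₀)
  have hconst : IntegrableOn (fun _ : ℝ => 2 * π * exp a) (Set.Ioi t₀) := by
    refine Integrable.mono' hint aestronglyMeasurable_const ?_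
    filter_upwards [ae_restrict_mem measurableSet_Ioi] with t ht
    rw [Real.norm_of_nonneg (by positivity), smul_eq_mul]
    exact hlow t (le_of_lt ht)
  rw [integrableOn_const_iff] at hconst
  simp [pi_pos.ne', (exp_pos a).ne'] at hconst

end

section

lemma differentiableOn_update_of_tendsto {f : ℂ → ℂ} {s : Set ℂ} {c : ℂ} (hs : s ∈ 𝓝 c)
    (hd : DifferentiableOn ℂ f (s \ {c}))
    (h : Tendsto (fun z => (z - c) * f z) (𝓝[≠] c) (𝓝 0)) :
    DifferentiableOn ℂ (Function.update f c (limUnder (𝓝[≠] c) f)) s := by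
  refine Complex.differentiableOn_update_limUnder_of_isLittleO hs hd ?_
  rw [Asymptotics.isLittleO_iff_tendsto']
  · have h1 : Tendsto (fun z : ℂ => (z - c) * f c) (𝓝[≠] c) (𝓝 0) := by
      have : Continuous (fun z : ℂ => (z - c) * f c) := by fun_prop
      simpa using (this.tendsto c).mono_left nhdsWithin_le_nhds
    have h2 := h.sub h1
    rw [sub_zero] at h2
    refine h2.congr fun z => ?_
    rw [div_inv_eq_mul]; ring
  · filter_upwards [self_mem_nhdsWithin] with z hz h0
    exact absurd (inv_eq_zero.1 h0) (sub_ne_zero.2 hz)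

lemma eq_const_of_tendsto {R : ℂ → ℂ} {κ : ℂ} (hR : DifferentiableOn ℂ R {0, 1}ᶜ)
    (h0 : Tendsto (fun z => (z - 0) * R z) (𝓝[≠] 0) (𝓝 0))
    (h1 : Tendsto (fun z => (z - 1) * R z) (𝓝[≠] 1) (𝓝 0))
    (hi : Tendsto R (cocompact ℂ) (𝓝 κ)) {z : ℂ} (hz : z ∈ ({0, 1}ᶜ : Set ℂ)) : R z = κ := by
  set R₁ := Function.update R 0 (limUnder (𝓝[≠] 0) R) with hR₁
  set R₂ := Function.update R₁ 1 (limUnder (𝓝[≠] 1) R₁) with hR₂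
  have d1 : DifferentiableOn ℂ R₁ {1}ᶜ :=
    differentiableOn_update_of_tendsto (isOpen_compl_singleton.mem_nhds (by simp))
      (hR.mono (by rintro z ⟨h, h'⟩; simp_all)) h0
  have e1 : ∀ z, z ≠ 0 → R₁ z = R z := fun z h => Function.update_of_ne h _ _
  have e2 : ∀ z, z ≠ 1 → R₂ z = R₁ z := fun z h => Function.update_of_ne h _ _
  have h1' : Tendsto (fun z => (z - 1) * R₁ z) (𝓝[≠] 1) (𝓝 0) := by
    refine h1.congr' ?_
    filter_upwards [nhdsWithin_le_nhds (isOpen_compl_singleton.mem_nhds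
      (show (1 : ℂ) ∈ ({0}ᶜ : Set ℂ) by simp))] with z hz
    rw [e1 z hz]
  have d2 : DifferentiableOn ℂ R₂ Set.univ :=
    differentiableOn_update_of_tendsto univ_mem (d1.mono (by rintro z ⟨-, h⟩; exact h)) h1'
  have hz0 : z ≠ 0 := fun h => hz (by simp [h])
  have hz1 : z ≠ 1 := fun h => hz (by simp [h])
  have ht : Tendsto R₂ (cocompact ℂ) (𝓝 κ) := by
    refine hi.congr' ?_
    have hm : ({0, 1} : Set ℂ)ᶜ ∈ cocompact ℂ := (Set.toFinite _).isCompact.compl_mem_cocompact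
    filter_upwards [hm] with w hw
    have hw0 : w ≠ 0 := fun h => hw (by simp [h])
    have hw1 : w ≠ 1 := fun h => hw (by simp [h])
    rw [e2 w hw1, e1 w hw0]
  rw [← e1 z hz0, ← e2 z hz1]
  exact (differentiableOn_univ.1 d2).apply_eq_of_tendsto_cocompact z ht

/-- The potential `l² - l' + S / 2` with `l = (a - 1) / (2 z) + (b - 1) / (2 (z - 1))`. -/
def fuchsQ (S : ℂ → ℂ) (a b : ℝ) (z : ℂ) : ℂ :=
  ((a - 1) / (2 * z) + (b - 1) / (2 * (z - 1))) ^ 2 + (a - 1) / (2 * z ^ 2)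
    + (b - 1) / (2 * (z - 1) ^ 2) + S z / 2

lemma fuchsQ_eq {S : ℂ → ℂ} {n θ θ₃ : ℝ} (hS : DifferentiableOn ℂ S {0, 1}ᶜ)
    (h0 : Tendsto (fun z => (z - 0) ^ 2 * S z) (𝓝[≠] 0) (𝓝 ((1 - (n : ℂ) ^ 2) / 2)))
    (h1 : Tendsto (fun z => (z - 1) ^ 2 * S z) (𝓝[≠] 1) (𝓝 ((1 - (θ : ℂ) ^ 2) / 2)))
    (hi : Tendsto (fun z => z ^ 2 * S z) (cocompact ℂ) (𝓝 ((1 - (θ₃ : ℂ) ^ 2) / 2)))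
    {z : ℂ} (hz : z ∈ ({0, 1}ᶜ : Set ℂ)) :
    z * (z - 1) * fuchsQ S n θ z = ((n + θ - 1) ^ 2 - θ₃ ^ 2) / 4 := by
  have hne : ∀ {z : ℂ}, z ∈ ({0, 1}ᶜ : Set ℂ) → z ≠ 0 ∧ z - 1 ≠ 0 := fun {z} hz =>
    ⟨fun h => hz (by simp [h]), fun h => hz (by simp [sub_eq_zero.1 h])⟩
  have ho : IsOpen ({0, 1}ᶜ : Set ℂ) := (Set.toFinite {0, 1}).isClosed.isOpen_compl
  refine eq_const_of_tendsto (R := fun z => z * (z - 1) * fuchsQ S n θ z) ?_ ?_ ?_ ?_ hz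
  · unfold fuchsQ
    refine DifferentiableOn.mul (by fun_prop) (DifferentiableOn.add ?_ (hS.div_const 2))
    intro z hz
    obtain ⟨a1, a2⟩ := hne hz
    refine DifferentiableAt.differentiableWithinAt ?_
    have b1 : 2 * z ≠ 0 := mul_ne_zero two_ne_zero a1
    have b2 : 2 * (z - 1) ≠ 0 := mul_ne_zero two_ne_zero a2
    have b3 : 2 * z ^ 2 ≠ 0 := mul_ne_zero two_ne_zero (pow_ne_zero 2 a1)
    have b4 : 2 * (z - 1) ^ 2 ≠ 0 := mul_ne_zero two_ne_zero (pow_ne_zero 2 a2)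
    fun_prop (disch := assumption)
  · have hc : Tendsto (fun z : ℂ => z / (z - 1)) (𝓝[≠] 0) (𝓝 0) := by
      have : ContinuousAt (fun z : ℂ => z / (z - 1)) 0 :=
        continuousAt_id.div (by fun_prop) (by simp)
      simpa using this.tendsto.mono_left nhdsWithin_le_nhds
    have hid : Tendsto (fun z : ℂ => z - 1) (𝓝[≠] 0) (𝓝 (0 - 1)) :=
      ((continuous_id.sub continuous_const).tendsto (0 : ℂ)).mono_left nhdsWithin_le_nhds
    have key := hid.mul ((((tendsto_const_nhds (x := ((n : ℂ) - 1) / 2)).add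
      (hc.const_mul (((θ : ℂ) - 1) / 2))).pow 2).add
      ((tendsto_const_nhds (x := ((n : ℂ) - 1) / 2)).add
      (((hc.pow 2).const_mul (((θ : ℂ) - 1) / 2)).add (h0.div_const 2))))
    have e : ((0 : ℂ) - 1) * ((((n : ℂ) - 1) / 2 + ((θ : ℂ) - 1) / 2 * 0) ^ 2 + (((n : ℂ) - 1) / 2
      + (((θ : ℂ) - 1) / 2 * 0 ^ 2 + (1 - (n : ℂ) ^ 2) / 2 / 2))) = 0 := by ring
    rw [e] at key
    refine key.congr' ?_
    filter_upwards [self_mem_nhdsWithin, nhdsWithin_le_nhds (isOpen_compl_singleton.mem_nhds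
      (show (0 : ℂ) ∈ ({1}ᶜ : Set ℂ) by simp))] with z hz hz'
    have a1 : z ≠ 0 := hz
    have a2 : z - 1 ≠ 0 := sub_ne_zero.2 hz'
    simp only [fuchsQ]
    field_simp
    ring
  · have hc : Tendsto (fun z : ℂ => (z - 1) / z) (𝓝[≠] 1) (𝓝 0) := by
      have : ContinuousAt (fun z : ℂ => (z - 1) / z) 1 :=
        ContinuousAt.div (by fun_prop) continuousAt_id (by simp)
      simpa using this.tendsto.mono_left nhdsWithin_le_nhds
    have hid : Tendsto (fun z : ℂ => z) (𝓝[≠] 1) (𝓝 1) :=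
      (continuous_id.tendsto (1 : ℂ)).mono_left nhdsWithin_le_nhds
    have key := hid.mul ((((tendsto_const_nhds (x := ((θ : ℂ) - 1) / 2)).add
      (hc.const_mul (((n : ℂ) - 1) / 2))).pow 2).add
      ((tendsto_const_nhds (x := ((θ : ℂ) - 1) / 2)).add
      (((hc.pow 2).const_mul (((n : ℂ) - 1) / 2)).add (h1.div_const 2))))
    have e : (1 : ℂ) * ((((θ : ℂ) - 1) / 2 + ((n : ℂ) - 1) / 2 * 0) ^ 2 + (((θ : ℂ) - 1) / 2
      + (((n : ℂ) - 1) / 2 * 0 ^ 2 + (1 - (θ : ℂ) ^ 2) / 2 / 2))) = 0 := by ring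
    rw [e] at key
    refine key.congr' ?_
    filter_upwards [self_mem_nhdsWithin, nhdsWithin_le_nhds (isOpen_compl_singleton.mem_nhds
      (show (1 : ℂ) ∈ ({0}ᶜ : Set ℂ) by simp))] with z hz hz'
    have a1 : z ≠ 0 := hz'
    have a2 : z - 1 ≠ 0 := sub_ne_zero.2 hz
    simp only [fuchsQ]
    field_simp
    ring
  · have hinv : Tendsto (fun z : ℂ => z⁻¹) (cocompact ℂ) (𝓝 0) := by
      rw [← Metric.cobounded_eq_cocompact]
      exact tendsto_inv₀_cobounded
    have hm : ({0, 1} : Set ℂ)ᶜ ∈ cocompact ℂ := (Set.toFinite _).isCompact.compl_mem_cocompact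
    have ha : Tendsto (fun z : ℂ => 1 - z⁻¹) (cocompact ℂ) (𝓝 1) := by
      simpa using hinv.const_sub 1
    have hc : Tendsto (fun z : ℂ => (1 - z⁻¹)⁻¹) (cocompact ℂ) (𝓝 1) := by
      simpa using ha.inv₀ one_ne_zero
    have key := ha.mul ((((tendsto_const_nhds (x := ((n : ℂ) - 1) / 2)).add
      (hc.const_mul (((θ : ℂ) - 1) / 2))).pow 2).add
      ((tendsto_const_nhds (x := ((n : ℂ) - 1) / 2)).add
      (((hc.pow 2).const_mul (((θ : ℂ) - 1) / 2)).add (hi.div_const 2))))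
    have e : (1 : ℂ) * ((((n : ℂ) - 1) / 2 + ((θ : ℂ) - 1) / 2 * 1) ^ 2 + (((n : ℂ) - 1) / 2
      + (((θ : ℂ) - 1) / 2 * 1 ^ 2 + (1 - (θ₃ : ℂ) ^ 2) / 2 / 2)))
        = (((n : ℂ) + θ - 1) ^ 2 - θ₃ ^ 2) / 4 := by ring
    rw [e] at key
    refine key.congr' ?_
    filter_upwards [hm] with z hz
    obtain ⟨a1, a2⟩ := hne hz
    have a4 : 1 - z⁻¹ = (z - 1) / z := by field_simp
    simp only [fuchsQ, a4, inv_div]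
    field_simp
    ring

end

section
variable {u v : ℂ → ℝ} {Ω : Set ℂ} {z : ℂ}

/-- `u` with its logarithmic singularities `2 (a - 1) log |z|`, `2 (b - 1) log |z - 1|` removed. -/
def regPart (u : ℂ → ℝ) (a b : ℝ) (z : ℂ) : ℝ :=
  u z + (-(2 * (a - 1)) * Real.log ‖z - 0‖ + -(2 * (b - 1)) * Real.log ‖z - 1‖)

lemma isOpen_compl_zero_one : IsOpen ({0, 1}ᶜ : Set ℂ) :=
  (Set.toFinite {0, 1}).isClosed.isOpen_compl

lemma mem_compl_zero_one : z ∈ ({0, 1}ᶜ : Set ℂ) ↔ z ≠ 0 ∧ z ≠ 1 := by simp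

lemma contDiffOn_regPart (hu : ContDiffOn ℝ 2 u {0, 1}ᶜ) (a b : ℝ) :
    ContDiffOn ℝ 2 (regPart u a b) {0, 1}ᶜ :=
  hu.add ((contDiffOn_const.mul ((contDiffOn_log_norm_sub 0).mono fun _ h =>
    (mem_compl_zero_one.1 h).1)).add (contDiffOn_const.mul
      ((contDiffOn_log_norm_sub 1).mono fun _ h => (mem_compl_zero_one.1 h).2)))

lemma contDiffOn_three_regPart (hu : ContDiffOn ℝ 3 u {0, 1}ᶜ) (a b : ℝ) :
    ContDiffOn ℝ 3 (regPart u a b) {0, 1}ᶜ :=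
  hu.add ((contDiffOn_const.mul ((contDiffOn_log_norm_sub 0).mono fun _ h =>
    (mem_compl_zero_one.1 h).1)).add (contDiffOn_const.mul
      ((contDiffOn_log_norm_sub 1).mono fun _ h => (mem_compl_zero_one.1 h).2)))

lemma dz_regPart (hu : ContDiffOn ℝ 2 u {0, 1}ᶜ) (a b : ℝ) (hz : z ∈ ({0, 1}ᶜ : Set ℂ)) :
    dz (fun w => (regPart u a b w : ℂ)) z
      = dz (fun w => (u w : ℂ)) z - ((a - 1) / z + (b - 1) / (z - 1)) := by
  obtain ⟨h0, h1⟩ := mem_compl_zero_one.1 hz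
  have d0 : DifferentiableAt ℝ u z :=
    (hu.of_le (by norm_num)).differentiableAt_of_mem isOpen_compl_zero_one hz
  have d1 : DifferentiableAt ℝ (fun w : ℂ => Real.log ‖w - 0‖) z :=
    (contDiffOn_log_norm_sub (k := 1) 0).differentiableAt_of_mem isOpen_compl_singleton h0
  have d2 : DifferentiableAt ℝ (fun w : ℂ => Real.log ‖w - 1‖) z :=
    (contDiffOn_log_norm_sub (k := 1) 1).differentiableAt_of_mem isOpen_compl_singleton h1
  have d3 : DifferentiableAt ℝ (fun w : ℂ => -(2 * (a - 1)) * Real.log ‖w - 0‖) z :=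
    d1.const_mul _
  have d4 : DifferentiableAt ℝ (fun w : ℂ => -(2 * (b - 1)) * Real.log ‖w - 1‖) z :=
    d2.const_mul _
  have d5 : DifferentiableAt ℝ (fun w : ℂ =>
      -(2 * (a - 1)) * Real.log ‖w - 0‖ + -(2 * (b - 1)) * Real.log ‖w - 1‖) z := d3.add d4
  unfold regPart
  rw [dz_ofReal_add d0 d5, dz_ofReal_add d3 d4, dz_ofReal_const_mul d1,
    dz_ofReal_const_mul d2, dz_log_norm_sub h0, dz_log_norm_sub h1]
  have h1' : z - 1 ≠ 0 := sub_ne_zero.2 h1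
  push_cast
  rw [sub_zero]
  field_simp
  ring

lemma dz_dz_regPart (hu : ContDiffOn ℝ 2 u {0, 1}ᶜ) (a b : ℝ) (hz : z ∈ ({0, 1}ᶜ : Set ℂ)) :
    dz (dz (fun w => (regPart u a b w : ℂ))) z
      = dz (dz (fun w => (u w : ℂ))) z + ((a - 1) / z ^ 2 + (b - 1) / (z - 1) ^ 2) := by
  obtain ⟨h0, h1⟩ := mem_compl_zero_one.1 hz
  have h1' : z - 1 ≠ 0 := sub_ne_zero.2 h1
  have e : dz (fun w => (regPart u a b w : ℂ)) =ᶠ[𝓝 z] fun w =>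
      dz (fun w => (u w : ℂ)) w - (((a : ℂ) - 1) / w + (b - 1) / (w - 1)) := by
    filter_upwards [isOpen_compl_zero_one.mem_nhds hz] with w hw
    exact dz_regPart hu a b hw
  have hd : HasDerivAt (fun w : ℂ => ((a : ℂ) - 1) / w + (b - 1) / (w - 1))
      (-(((a : ℂ) - 1) / z ^ 2 + (b - 1) / (z - 1) ^ 2)) z := by
    have := ((hasDerivAt_id z).fun_inv h0).const_mul ((a : ℂ) - 1) |>.add
      ((((hasDerivAt_id z).sub_const 1).fun_inv h1').const_mul ((b : ℂ) - 1))
    refine (this.congr_deriv ?_).congr_of_eventuallyEq ?_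
    · simp only [id]; field_simp; ring
    · exact Eventually.of_forall fun w => by simp [div_eq_mul_inv]
  rw [dz_eq_of_eventuallyEq e, dz_sub
    ((hu.complexOfReal.dz_two isOpen_compl_zero_one).differentiableAt_of_mem isOpen_compl_zero_one
      hz) (hd.differentiableAt.restrictScalars ℝ), dz_of_holomorphic hd.differentiableAt, hd.deriv]
  ring

lemma dz_dz_exp_real (hΩ : IsOpen Ω) (hv : ContDiffOn ℝ 2 v Ω) (a : ℂ) (hz : z ∈ Ω) :
    dz (dz (fun w => Complex.exp (a * v w))) z
      = (a * dz (dz (fun w => (v w : ℂ))) z + a ^ 2 * dz (fun w => (v w : ℂ)) z ^ 2)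
        * Complex.exp (a * v z) := by
  have hv1 : ContDiffOn ℝ 1 v Ω := hv.of_le (by norm_num)
  have e : dz (fun w => Complex.exp (a * v w)) =ᶠ[𝓝 z] fun w =>
      (a * dz (fun w => (v w : ℂ)) w) * Complex.exp (a * v w) := by
    filter_upwards [hΩ.mem_nhds hz] with w hw
    exact dz_exp_real (hv1.differentiableAt_of_mem hΩ hw) a
  have d1 := (hv.complexOfReal.dz_two hΩ).differentiableAt_of_mem hΩ hz
  have d2 := (contDiffOn_exp_real hv1 a).differentiableAt_of_mem hΩ hz
  rw [dz_eq_of_eventuallyEq e, dz_mul (d1.const_mul a) d2, dz_mul (differentiableAt_const a) d1,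
    dz_const, dz_exp_real (hv1.differentiableAt_of_mem hΩ hz)]
  ring

lemma hypergeometric_exp_regPart (hu : ContDiffOn ℝ 2 u {0, 1}ᶜ) {a b : ℝ} {κ : ℂ}
    (hz : z ∈ ({0, 1}ᶜ : Set ℂ)) (hQ : z * (z - 1) * fuchsQ (schw u) a b z = κ) :
    z * (1 - z) * dz (dz (fun w => Complex.exp ((-1 / 2 : ℂ) * regPart u a b w))) z
      + ((1 - a) + (a + b - 2) * z)
        * dz (fun w => Complex.exp ((-1 / 2 : ℂ) * regPart u a b w)) z
      - κ * Complex.exp ((-1 / 2 : ℂ) * regPart u a b z) = 0 := by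
  obtain ⟨h0, h1⟩ := mem_compl_zero_one.1 hz
  have h1' : z - 1 ≠ 0 := sub_ne_zero.2 h1
  have hv := contDiffOn_regPart hu a b
  rw [dz_dz_exp_real isOpen_compl_zero_one hv _ hz, dz_exp_real
    ((hv.of_le (by norm_num)).differentiableAt_of_mem isOpen_compl_zero_one hz),
    dz_regPart hu a b hz, dz_dz_regPart hu a b hz, ← hQ]
  simp only [fuchsQ, schw]
  field_simp
  ring

end

section
variable {b : ℕ → ℂ} {C ρ : ℝ}

lemma norm_mul_pow_le (hρ : 0 < ρ) (hb : ∀ k, ‖b k‖ ≤ C * ρ ^ k) (k : ℕ) {z : ℂ}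
    (hz : z ∈ ball (0 : ℂ) (1 / (2 * ρ))) : ‖b k * z ^ k‖ ≤ C * (1 / 2) ^ k := by
  rw [mem_ball_zero_iff] at hz
  rw [norm_mul, norm_pow]
  calc ‖b k‖ * ‖z‖ ^ k ≤ (C * ρ ^ k) * (1 / (2 * ρ)) ^ k :=
        mul_le_mul (hb k) (pow_le_pow_left₀ (norm_nonneg _) hz.le k) (by positivity)
          ((norm_nonneg _).trans (hb k))
    _ = C * (1 / 2) ^ k := by rw [mul_assoc, ← mul_pow]; congr 2; field_simp

lemma hasSum_mul_pow (hρ : 0 < ρ) (hb : ∀ k, ‖b k‖ ≤ C * ρ ^ k) {z : ℂ}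
    (hz : z ∈ ball (0 : ℂ) (1 / (2 * ρ))) :
    HasSum (fun k => b k * z ^ k) (∑' k, b k * z ^ k) :=
  (Summable.of_norm_bounded (summable_geometric_two.mul_left C)
    fun k => norm_mul_pow_le hρ hb k hz).hasSum

lemma differentiableOn_tsum_mul_pow (hρ : 0 < ρ) (hb : ∀ k, ‖b k‖ ≤ C * ρ ^ k) :
    DifferentiableOn ℂ (fun z => ∑' k, b k * z ^ k) (ball 0 (1 / (2 * ρ))) :=
  Complex.differentiableOn_tsum_of_summable_norm (summable_geometric_two.mul_left C)
    (fun k => by fun_prop) isOpen_ball fun k _ hz => norm_mul_pow_le hρ hb k hz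

lemma deriv_tsum_mul_pow (hρ : 0 < ρ) (hb : ∀ k, ‖b k‖ ≤ C * ρ ^ k) {z : ℂ}
    (hz : z ∈ ball (0 : ℂ) (1 / (2 * ρ))) :
    deriv (fun z => ∑' k, b k * z ^ k) z = ∑' k, (k + 1) * b (k + 1) * z ^ k := by
  have h := Complex.hasSum_deriv_of_summable_norm (F := fun k z => b k * z ^ k)
    (summable_geometric_two.mul_left C)
    (fun k => by fun_prop) isOpen_ball (fun k _ hz => norm_mul_pow_le hρ hb k hz) hz
  have e : ∀ k, deriv (fun z => b k * z ^ k) z = b k * (k * z ^ (k - 1)) := fun k => by simp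
  simp only [e] at h
  have h2 := (hasSum_nat_add_iff' 1).2 h
  simp only [Finset.range_one, Finset.sum_singleton, Nat.cast_zero, zero_mul, mul_zero, sub_zero,
    Nat.add_sub_cancel] at h2
  rw [← h2.tsum_eq]
  refine tsum_congr fun k => ?_
  push_cast; ring

lemma norm_succ_mul_le (hb : ∀ k, ‖b k‖ ≤ C * ρ ^ k) (k : ℕ) :
    ‖((k : ℂ) + 1) * b (k + 1)‖ ≤ (C * ρ) * (2 * ρ) ^ k := by
  have h1 : ‖(k : ℂ) + 1‖ ≤ 2 ^ k := by
    have : ((k : ℂ) + 1) = ((k + 1 : ℕ) : ℂ) := by push_cast; ring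
    rw [this, Complex.norm_natCast]
    exact_mod_cast Nat.lt_two_pow_self
  rw [norm_mul]
  calc ‖(k : ℂ) + 1‖ * ‖b (k + 1)‖ ≤ 2 ^ k * (C * ρ ^ (k + 1)) :=
        mul_le_mul h1 (hb _) (norm_nonneg _) (by positivity)
    _ = (C * ρ) * (2 * ρ) ^ k := by rw [mul_pow]; ring

lemma hasSum_shift {f g : ℕ → ℂ} {z S : ℂ} (h : HasSum (fun k => f k * z ^ k) S) (h0 : g 0 = 0)
    (h1 : ∀ k, g (k + 1) = f k) : HasSum (fun k => g k * z ^ k) (z * S) := by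
  refine (hasSum_nat_add_iff' 1).1 ?_
  simp only [Finset.range_one, Finset.sum_singleton, h0, zero_mul, sub_zero]
  refine (h.mul_left z).congr_fun fun k => ?_
  rw [h1]; ring

/-- Coefficients of the hypergeometric series `F(A, B; n + 1; z)`. -/
def hyperCoeff (A B : ℂ) (n : ℕ) : ℕ → ℂ
  | 0 => 1
  | k + 1 => (A + k) * (B + k) / ((k + 1) * (n + 1 + k)) * hyperCoeff A B n k

lemma hyperCoeff_rec (A B : ℂ) (n k : ℕ) :
    (k + 1) * (n + 1 + k) * hyperCoeff A B n (k + 1)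
      = (A + k) * (B + k) * hyperCoeff A B n k := by
  have h1 : (k : ℂ) + 1 ≠ 0 := by exact_mod_cast k.succ_ne_zero
  have h2 : (n : ℂ) + 1 + k ≠ 0 := by
    have : ((n + 1 + k : ℕ) : ℂ) ≠ 0 := Nat.cast_ne_zero.2 (by omega)
    exact_mod_cast this
  rw [hyperCoeff]
  field_simp

lemma norm_hyperCoeff_le (A B : ℂ) (n k : ℕ) :
    ‖hyperCoeff A B n k‖ ≤ 1 * ((‖A‖ + 1) * (‖B‖ + 1)) ^ k := by
  rw [one_mul]
  induction k with
  | zero => simp [hyperCoeff]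
  | succ k ih =>
    have hA : ∀ A : ℂ, ‖A + k‖ ≤ (‖A‖ + 1) * (k + 1) := fun A => by
      have h := norm_add_le A k
      rw [Complex.norm_natCast] at h
      nlinarith [norm_nonneg A, (Nat.cast_nonneg k : (0 : ℝ) ≤ k)]
    have h1 : ‖((k : ℂ) + 1) * (n + 1 + k)‖ = (k + 1) * (n + 1 + k) := by
      have : ((k : ℂ) + 1) * (n + 1 + k) = (((k + 1) * (n + 1 + k) : ℕ) : ℂ) := by push_cast; ring
      rw [this, Complex.norm_natCast]; push_cast; ring
    rw [hyperCoeff, norm_mul, norm_div, norm_mul, h1, pow_succ, mul_comm _ ((‖A‖ + 1) * (‖B‖ + 1))]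
    refine mul_le_mul ?_ ih (norm_nonneg _) (by positivity)
    rw [div_le_iff₀ (by positivity)]
    calc ‖A + k‖ * ‖B + k‖ ≤ ((‖A‖ + 1) * (k + 1)) * ((‖B‖ + 1) * (k + 1)) :=
          mul_le_mul (hA A) (hA B) (norm_nonneg _) (by positivity)
      _ = (‖A‖ + 1) * (‖B‖ + 1) * ((k + 1) * (k + 1)) := by ring
      _ ≤ (‖A‖ + 1) * (‖B‖ + 1) * ((k + 1) * (n + 1 + k)) := by
          refine mul_le_mul_of_nonneg_left (mul_le_mul_of_nonneg_left ?_ (by positivity))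
            (by positivity)
          linarith [(Nat.cast_nonneg n : (0 : ℝ) ≤ n)]

lemma exists_hypergeometric (A B : ℂ) (n : ℕ) :
    ∃ r > (0 : ℝ), ∃ h : ℂ → ℂ, DifferentiableOn ℂ h (ball 0 r) ∧ h 0 = 1 ∧
      ∀ z ∈ ball (0 : ℂ) r, z * (1 - z) * deriv (deriv h) z
        + ((n + 1) - (A + B + 1) * z) * deriv h z - A * B * h z = 0 := by
  set ρ := (‖A‖ + 1) * (‖B‖ + 1) with hρ
  have hρ0 : 0 < ρ := by positivity
  set b := hyperCoeff A B n with hb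
  have hb0 : ∀ k, ‖b k‖ ≤ 1 * ρ ^ k := norm_hyperCoeff_le A B n
  have hb1 := norm_succ_mul_le hb0
  have hb2 := norm_succ_mul_le (b := fun k => ((k : ℂ) + 1) * b (k + 1)) hb1
  have hρ2 : 0 < 2 * ρ := by positivity
  have hρ4 : 0 < 2 * (2 * ρ) := by positivity
  have s1 : ball (0 : ℂ) (1 / (2 * (2 * ρ))) ⊆ ball 0 (1 / (2 * ρ)) :=
    ball_subset_ball (one_div_le_one_div_of_le hρ2 (by linarith))
  have s2 : ball (0 : ℂ) (1 / (2 * (2 * (2 * ρ)))) ⊆ ball 0 (1 / (2 * (2 * ρ))) :=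
    ball_subset_ball (one_div_le_one_div_of_le hρ4 (by linarith))
  refine ⟨1 / (2 * (2 * (2 * ρ))), by positivity, fun z => ∑' k, b k * z ^ k,
    (differentiableOn_tsum_mul_pow hρ0 hb0).mono (s2.trans s1), ?_, fun z hz => ?_⟩
  · change ∑' k, b k * (0 : ℂ) ^ k = 1
    rw [tsum_eq_single 0 fun k hk => by simp [hk]]
    simp [hb, hyperCoeff]
  · have e1 : deriv (fun z => ∑' k, b k * z ^ k) =ᶠ[𝓝 z]
        fun z => ∑' k : ℕ, ((k : ℂ) + 1) * b (k + 1) * z ^ k := by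
      filter_upwards [isOpen_ball.mem_nhds (s1 (s2 hz))] with w hw
      exact deriv_tsum_mul_pow hρ0 hb0 hw
    rw [e1.deriv_eq, e1.eq_of_nhds,
      deriv_tsum_mul_pow (b := fun k => ((k : ℂ) + 1) * b (k + 1)) hρ2 hb1 (s2 hz)]
    have t0 := hasSum_mul_pow hρ0 hb0 (s1 (s2 hz))
    have t1 := hasSum_mul_pow hρ2 hb1 (s2 hz)
    have t2 := hasSum_mul_pow hρ4 hb2 hz
    push_cast at t2 ⊢
    have t3 := hasSum_shift (g := fun k : ℕ => (k : ℂ) * b k) t1 (by simp)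
      (fun k => by push_cast; ring)
    have t4 := hasSum_shift (g := fun k : ℕ => (k : ℂ) * (k + 1) * b (k + 1)) t2 (by simp)
      (fun k => by push_cast; ring_nf)
    have t5 := hasSum_shift (g := fun k : ℕ => (k : ℂ) * (k - 1) * b k) t4 (by simp)
      (fun k => by push_cast; ring)
    have t6 := (((t4.sub t5).add (t1.mul_left ((n : ℂ) + 1))).sub (t3.mul_left (A + B + 1))).sub
      (t0.mul_left (A * B))
    have hz0 : ∀ k : ℕ, (k * (k + 1) * b (k + 1) * z ^ k - k * (k - 1) * b k * z ^ k
        + (n + 1) * ((k + 1) * b (k + 1) * z ^ k) - (A + B + 1) * (k * b k * z ^ k)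
        - A * B * (b k * z ^ k)) = 0 := fun k => by
      have := hyperCoeff_rec A B n k
      rw [← hb] at this
      linear_combination z ^ k * this
    simp only [hz0] at t6
    have t7 := t6.unique hasSum_zero
    rw [← t7]
    ring

end

section

lemma exists_add_eq_zero_of_hypergeometric {r : ℝ} (hr : 0 < r) (m : ℕ) (A B : ℂ) (F : ℂ → ℂ)
    (hF : DifferentiableOn ℂ F (ball 0 r)) (h0 : F 0 ≠ 0)
    (hE : ∀ z ∈ ball (0 : ℂ) r, z * (1 - z) * deriv (deriv F) z
      + (-m - (A + B + 1) * z) * deriv F z - A * B * F z = 0) :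
    ∃ j ≤ m, A + j = 0 ∨ B + j = 0 := by
  induction m generalizing A B F with
  | zero =>
    have h := hE 0 (mem_ball_self hr)
    simp only [Nat.cast_zero, mul_zero, zero_mul, neg_zero, sub_zero, add_zero, zero_sub,
      neg_eq_zero, mul_eq_zero, h0, or_false] at h
    exact ⟨0, le_rfl, by simpa using h⟩
  | succ m ih =>
    by_cases hAB : A * B = 0
    · exact ⟨0, Nat.zero_le _, by simpa using hAB⟩
    have h := hE 0 (mem_ball_self hr)
    have hF' := hF.deriv isOpen_ball
    have hF'' := hF'.deriv isOpen_ball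
    have h1 : deriv F 0 ≠ 0 := by
      intro h1
      rw [h1] at h
      simp only [zero_mul, mul_zero, zero_add, zero_sub, neg_eq_zero] at h
      exact (mul_ne_zero hAB h0) h
    obtain ⟨j, hj, hj'⟩ := ih (A + 1) (B + 1) (deriv F) hF' h1 fun z hz => by
      have hn := isOpen_ball.mem_nhds hz
      have d0 := (hF.differentiableAt hn).hasDerivAt
      have d1 := (hF'.differentiableAt hn).hasDerivAt
      have d2 := (hF''.differentiableAt hn).hasDerivAt
      have i := hasDerivAt_id z
      have key := (((i.mul (i.const_sub 1)).mul d2).add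
        (((i.const_mul (A + B + 1)).const_sub (-((m + 1 : ℕ) : ℂ))).mul d1)).sub
        (d0.const_mul (A * B))
      have e := key.unique ((hasDerivAt_const z (0 : ℂ)).congr_of_eventuallyEq (by
        filter_upwards [hn] with w hw
        exact hE w hw))
      simp only [id, Pi.mul_apply] at e
      push_cast at e
      linear_combination e
    refine ⟨j + 1, by omega, hj'.imp ?_ ?_⟩ <;> intro h <;> push_cast <;> linear_combination h

lemma exists_add_eq_zero_of_real_solution {r M δ : ℝ} (hr : 0 < r) (hδ : 0 < δ) (m : ℕ) (A B : ℝ)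
    {Y : ℂ → ℂ} (hY : ContDiffOn ℝ 3 Y (ball 0 r \ {0}))
    (hreal : ∀ z, starRingEnd ℂ (Y z) = Y z)
    (hE : ∀ z ∈ ball (0 : ℂ) r \ {0}, z * (1 - z) * dz (dz Y) z
      + (-m - (A + B + 1) * z) * dz Y z - A * B * Y z = 0)
    (hlim : Tendsto (fun z => z * dz Y z) (𝓝[≠] 0) (𝓝 0))
    (hδY : ∀ z ∈ ball (0 : ℂ) r \ {0}, δ ≤ ‖Y z‖)
    (hM : ∀ z ∈ ball (0 : ℂ) r \ {0}, ‖Y z‖ ≤ M) :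
    ∃ j ≤ m, A + j = 0 ∨ B + j = 0 := by
  obtain ⟨ρ, hρ, h, hd, h0, hh⟩ := exists_hypergeometric (1 - A) (1 - B) (m + 1)
  set R := min r ρ with hR
  have hR0 : 0 < R := lt_min hr hρ
  set D := ball (0 : ℂ) R \ {0} with hD
  have hDo : IsOpen D := isOpen_ball.sdiff isClosed_singleton
  have hDr : D ⊆ ball (0 : ℂ) r \ {0} := fun z hz =>
    ⟨ball_subset_ball (min_le_left _ _) hz.1, hz.2⟩
  have hBρ : ball (0 : ℂ) R ⊆ ball 0 ρ := ball_subset_ball (min_le_right _ _)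
  have hDn : D ∈ 𝓝[≠] (0 : ℂ) := by
    rw [hD, Set.sdiff_eq, Set.inter_comm]
    exact inter_mem_nhdsWithin _ (ball_mem_nhds _ hR0)
  set g₁ : ℂ → ℂ := fun z => z * (1 - z) * h z with hg₁
  set g₂ : ℂ → ℂ := fun z => (1 - 2 * z) * h z + z * (1 - z) * deriv h z
    + (m + (A + B + 1) * z) * h z with hg₂
  have hd' := hd.deriv isOpen_ball
  have hd'' := hd'.deriv isOpen_ball
  have dg₁ : ∀ z ∈ ball (0 : ℂ) R,
      HasDerivAt g₁ ((1 - 2 * z) * h z + z * (1 - z) * deriv h z) z := by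
    intro z hz
    have a0 := (hd.differentiableAt (isOpen_ball.mem_nhds (hBρ hz))).hasDerivAt
    have i := hasDerivAt_id z
    refine ((i.mul (i.const_sub 1)).mul a0).congr_deriv ?_
    simp only [id, Pi.mul_apply]; ring
  have dg₂ : ∀ z ∈ ball (0 : ℂ) R, HasDerivAt g₂ (A * B * h z) z := by
    intro z hz
    have a0 := (hd.differentiableAt (isOpen_ball.mem_nhds (hBρ hz))).hasDerivAt
    have a1 := (hd'.differentiableAt (isOpen_ball.mem_nhds (hBρ hz))).hasDerivAt
    have i := hasDerivAt_id z
    refine (((((i.const_mul 2).const_sub 1).mul a0).add ((i.mul (i.const_sub 1)).mul a1)).add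
      (((i.const_mul ((A : ℂ) + B + 1)).const_add (m : ℂ)).mul a0)).congr_deriv ?_
    have := hh z (hBρ hz)
    push_cast at this
    simp only [id, Pi.mul_apply]
    linear_combination this
  have yd : ∀ z ∈ D, DifferentiableAt ℝ Y z := fun z hz =>
    ((hY.of_le (by norm_num)).mono hDr).differentiableAt_of_mem hDo hz
  have hY3 := hY.mono hDr
  have hY2 : ContDiffOn ℝ 2 Y D := hY3.of_le (by norm_num)
  have c1 := hY3.dz_three hDo
  have c1b := hY3.dzb_three hDo
  have c2 := c1.dz_two hDo
  have c2b := c1b.dz_two hDo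
  have yd1 : ∀ z ∈ D, DifferentiableAt ℝ (dz Y) z := fun z hz =>
    (c1.of_le (by norm_num)).differentiableAt_of_mem hDo hz
  have yd1b : ∀ z ∈ D, DifferentiableAt ℝ (dzb Y) z := fun z hz =>
    (c1b.of_le (by norm_num)).differentiableAt_of_mem hDo hz
  have yd2 : ∀ z ∈ D, DifferentiableAt ℝ (dz (dz Y)) z := fun z hz =>
    c2.differentiableAt_of_mem hDo hz
  have yd2b : ∀ z ∈ D, DifferentiableAt ℝ (dz (dzb Y)) z := fun z hz =>
    c2b.differentiableAt_of_mem hDo hz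
  have hconj : ∀ z ∈ D, dzb Y z = starRingEnd ℂ (dz Y z) := fun z hz => by
    rw [← dzb_conj (yd z hz)]
    simp only [hreal]
  set K : ℂ → ℂ := fun z => g₁ z * dz Y z - g₂ z * Y z with hK
  set p : ℂ → ℂ := fun z => starRingEnd ℂ (g₁ z) with hp
  set q : ℂ → ℂ := fun z => starRingEnd ℂ (g₂ z) with hq
  set H : ℂ → ℂ := fun z => p z * dzb Y z - q z * Y z with hH
  have dg₁' : ∀ z ∈ D, DifferentiableAt ℂ g₁ z := fun z hz => (dg₁ z hz.1).differentiableAt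
  have dg₂' : ∀ z ∈ D, DifferentiableAt ℂ g₂ z := fun z hz => (dg₂ z hz.1).differentiableAt
  have rg₁ : ∀ z ∈ D, DifferentiableAt ℝ g₁ z := fun z hz => (dg₁' z hz).restrictScalars ℝ
  have rg₂ : ∀ z ∈ D, DifferentiableAt ℝ g₂ z := fun z hz => (dg₂' z hz).restrictScalars ℝ
  have dp : ∀ z ∈ D, DifferentiableAt ℝ p z := fun z hz => differentiableAt_conj (rg₁ z hz)
  have dq : ∀ z ∈ D, DifferentiableAt ℝ q z := fun z hz => differentiableAt_conj (rg₂ z hz)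
  have p0 : ∀ z ∈ D, dz p z = 0 := fun z hz => by
    rw [hp, dz_conj (rg₁ z hz), dzb_of_holomorphic (dg₁' z hz), map_zero]
  have q0 : ∀ z ∈ D, dz q z = 0 := fun z hz => by
    rw [hq, dz_conj (rg₂ z hz), dzb_of_holomorphic (dg₂' z hz), map_zero]
  have dK : ∀ z ∈ D, DifferentiableAt ℝ K z := fun z hz =>
    ((rg₁ z hz).mul (yd1 z hz)).sub ((rg₂ z hz).mul (yd z hz))
  have dzK : ∀ z ∈ D, dz K z = 0 := fun z hz => by
    have m1 : DifferentiableAt ℝ (fun z => g₁ z * dz Y z) z := (rg₁ z hz).mul (yd1 z hz)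
    have m2 : DifferentiableAt ℝ (fun z => g₂ z * Y z) z := (rg₂ z hz).mul (yd z hz)
    rw [hK, dz_sub m1 m2, dz_mul (rg₁ z hz) (yd1 z hz), dz_mul (rg₂ z hz) (yd z hz),
      dz_of_holomorphic (dg₁' z hz), dz_of_holomorphic (dg₂' z hz), (dg₁ z hz.1).deriv,
      (dg₂ z hz.1).deriv]
    simp only [hg₁, hg₂]
    linear_combination h z * hE z (hDr hz)
  have hHK : ∀ z ∈ D, H z = starRingEnd ℂ (K z) := fun z hz => by
    simp only [hH, hK, hp, hq, map_sub, map_mul, hreal, hconj z hz]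
  have dH : ∀ z ∈ D, DifferentiableAt ℝ H z := fun z hz =>
    ((dp z hz).mul (yd1b z hz)).sub ((dq z hz).mul (yd z hz))
  have hHd : DifferentiableOn ℂ H D := fun z hz => by
    refine (differentiableAt_of_dzb_eq_zero (dH z hz) ?_).differentiableWithinAt
    have e : H =ᶠ[𝓝 z] fun w => starRingEnd ℂ (K w) := by
      filter_upwards [hDo.mem_nhds hz] with w hw using hHK w hw
    rw [dzb_eq_of_eventuallyEq e, dzb_conj (dK z hz), dzK z hz, map_zero]
  have H1 : ∀ z ∈ D, deriv H z = p z * dz (dzb Y) z - q z * dz Y z := fun z hz => by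
    have m1 : DifferentiableAt ℝ (fun z => p z * dzb Y z) z := (dp z hz).mul (yd1b z hz)
    have m2 : DifferentiableAt ℝ (fun z => q z * Y z) z := (dq z hz).mul (yd z hz)
    rw [← dz_of_holomorphic (hHd.differentiableAt (hDo.mem_nhds hz)), hH, dz_sub m1 m2,
      dz_mul (dp z hz) (yd1b z hz), dz_mul (dq z hz) (yd z hz), p0 z hz, q0 z hz]
    ring
  have H2 : ∀ z ∈ D, deriv (deriv H) z = p z * dzb (dz (dz Y)) z - q z * dz (dz Y) z :=
    fun z hz => by
    have m1 : DifferentiableAt ℝ (fun z => p z * dz (dzb Y) z) z := (dp z hz).mul (yd2b z hz)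
    have m2 : DifferentiableAt ℝ (fun z => q z * dz Y z) z := (dq z hz).mul (yd1 z hz)
    have e : deriv H =ᶠ[𝓝 z] fun z => p z * dz (dzb Y) z - q z * dz Y z := by
      filter_upwards [hDo.mem_nhds hz] with w hw using H1 w hw
    have e' : dz (dzb Y) =ᶠ[𝓝 z] dzb (dz Y) := by
      filter_upwards [hDo.mem_nhds hz] with w hw using dz_dzb_comm hDo hY2 hw
    rw [← dz_of_holomorphic ((hHd.deriv hDo).differentiableAt (hDo.mem_nhds hz)),
      dz_eq_of_eventuallyEq e, dz_sub m1 m2,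
      dz_mul (dp z hz) (yd2b z hz), dz_mul (dq z hz) (yd1 z hz), p0 z hz, q0 z hz,
      dz_eq_of_eventuallyEq e', dz_dzb_comm hDo c1 hz]
    ring
  have hEb : ∀ z ∈ D, z * (1 - z) * dzb (dz (dz Y)) z
      + (-m - (A + B + 1) * z) * dzb (dz Y) z - A * B * dzb Y z = 0 := fun z hz => by
    have b1 : DifferentiableAt ℂ (fun z : ℂ => z * (1 - z)) z := by fun_prop
    have b2 : DifferentiableAt ℂ (fun z : ℂ => -(m : ℂ) - ((A : ℂ) + B + 1) * z) z := by fun_prop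
    have b3 : DifferentiableAt ℂ (fun _ : ℂ => (A : ℂ) * B) z := by fun_prop
    have m1 : DifferentiableAt ℝ (fun z => z * (1 - z) * dz (dz Y) z) z :=
      (b1.restrictScalars ℝ).mul (yd2 z hz)
    have m2 : DifferentiableAt ℝ (fun z => (-(m : ℂ) - ((A : ℂ) + B + 1) * z) * dz Y z) z :=
      (b2.restrictScalars ℝ).mul (yd1 z hz)
    have m3 : DifferentiableAt ℝ (fun z => (A : ℂ) * B * Y z) z :=
      (b3.restrictScalars ℝ).mul (yd z hz)
    have m4 : DifferentiableAt ℝ (fun z => z * (1 - z) * dz (dz Y) z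
      + (-(m : ℂ) - ((A : ℂ) + B + 1) * z) * dz Y z) z := m1.add m2
    rw [← dzb_holomorphic_mul b1 (yd2 z hz), ← dzb_holomorphic_mul b2 (yd1 z hz),
      ← dzb_holomorphic_mul b3 (yd z hz), ← dzb_add m1 m2, ← dzb_sub m4 m3, ← dzb_const 0 z]
    refine dzb_eq_of_eventuallyEq ?_
    filter_upwards [hDo.mem_nhds hz] with w hw using hE w (hDr hw)
  have hEH : ∀ z ∈ D, z * (1 - z) * deriv (deriv H) z
      + (-m - (A + B + 1) * z) * deriv H z - A * B * H z = 0 := fun z hz => by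
    rw [H1 z hz, H2 z hz, dz_dzb_comm hDo hY2 hz]
    simp only [hH]
    linear_combination p z * hEb z hz - q z * hE z (hDr hz)
  have hB0 : (0 : ℂ) ∈ ball (0 : ℂ) R := mem_ball_self hR0
  have hh0 : Tendsto h (𝓝[≠] 0) (𝓝 1) := by
    have := (hd.differentiableAt (isOpen_ball.mem_nhds (hBρ hB0))).continuousAt.tendsto
    rw [h0] at this
    exact this.mono_left nhdsWithin_le_nhds
  have hg₂0 : Tendsto g₂ (𝓝[≠] 0) (𝓝 (m + 1)) := by
    have := (dg₂ 0 hB0).continuousAt.tendsto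
    have e : g₂ 0 = m + 1 := by simp only [hg₂, h0]; ring
    rw [e] at this
    exact this.mono_left nhdsWithin_le_nhds
  have hid : Tendsto (fun z : ℂ => z) (𝓝[≠] 0) (𝓝 0) :=
    (continuous_id.tendsto (0 : ℂ)).mono_left nhdsWithin_le_nhds
  have hgY : Tendsto (fun z => g₁ z * dz Y z) (𝓝[≠] 0) (𝓝 0) := by
    have := ((hid.const_sub 1).mul hh0).mul hlim
    rw [mul_zero] at this
    refine this.congr fun z => ?_
    simp only [hg₁]; ring
  have hzH : Tendsto (fun z => (z - 0) * H z) (𝓝[≠] 0) (𝓝 0) := by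
    have hb : Tendsto (fun z : ℂ => ‖z‖ * (‖g₁ z * dz Y z‖ + ‖g₂ z‖ * M)) (𝓝[≠] 0) (𝓝 0) := by
      have := hid.norm.mul (hgY.norm.add (hg₂0.norm.mul_const M))
      simpa using this
    refine squeeze_zero_norm' ?_ hb
    filter_upwards [hDn] with z hz
    rw [sub_zero, norm_mul, hHK z hz, RCLike.norm_conj]
    refine mul_le_mul_of_nonneg_left ((norm_sub_le _ _).trans ?_) (norm_nonneg _)
    rw [norm_mul (g₂ z)]
    gcongr
    exact hM z (hDr hz)
  set F := Function.update H 0 (limUnder (𝓝[≠] 0) H) with hF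
  have hFd : DifferentiableOn ℂ F (ball 0 R) :=
    differentiableOn_update_of_tendsto (ball_mem_nhds _ hR0) hHd hzH
  have hFH : ∀ z ∈ D, F z = H z := fun z hz => Function.update_of_ne hz.2 _ _
  have hFH' : ∀ z ∈ D, F =ᶠ[𝓝 z] H := fun z hz => by
    filter_upwards [hDo.mem_nhds hz] with w hw using hFH w hw
  have hFc := (hFd.differentiableAt (ball_mem_nhds _ hR0)).continuousAt
  have hF0 : F 0 ≠ 0 := by
    have a1 : Tendsto (fun z => ‖F z‖) (𝓝[≠] 0) (𝓝 ‖F 0‖) :=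
      (hFc.tendsto.mono_left nhdsWithin_le_nhds).norm
    have a2 : Tendsto (fun z => ‖g₂ z‖ * δ - ‖g₁ z * dz Y z‖) (𝓝[≠] 0)
        (𝓝 (‖(m + 1 : ℂ)‖ * δ - ‖(0 : ℂ)‖)) :=
      (hg₂0.norm.mul_const δ).sub hgY.norm
    have a3 := le_of_tendsto_of_tendsto a2 a1 (by
      filter_upwards [hDn] with z hz
      rw [hFH z hz, hHK z hz, RCLike.norm_conj]
      have b1 := norm_sub_norm_le (g₂ z * Y z) (g₁ z * dz Y z)
      rw [norm_sub_rev, norm_mul (g₂ z)] at b1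
      have b2 := mul_le_mul_of_nonneg_left (hδY z (hDr hz)) (norm_nonneg (g₂ z))
      change _ ≤ ‖g₁ z * dz Y z - g₂ z * Y z‖
      linarith)
    have a4 : ‖(m + 1 : ℂ)‖ = m + 1 := by
      have : (m + 1 : ℂ) = ((m + 1 : ℕ) : ℂ) := by push_cast; ring
      rw [this, Complex.norm_natCast]; push_cast; ring
    rw [a4, norm_zero, sub_zero] at a3
    have : 0 < ((m : ℝ) + 1) * δ := by positivity
    exact norm_pos_iff.1 (this.trans_le a3)
  have hFE : ∀ z ∈ ball (0 : ℂ) R, z * (1 - z) * deriv (deriv F) z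
      + (-m - (A + B + 1) * z) * deriv F z - A * B * F z = 0 := by
    have hD' : ∀ z ∈ D, z * (1 - z) * deriv (deriv F) z
        + (-m - (A + B + 1) * z) * deriv F z - A * B * F z = 0 := fun z hz => by
      rw [(hFH' z hz).deriv.deriv_eq, (hFH' z hz).deriv_eq, hFH z hz, hEH z hz]
    intro z hz
    by_cases hz0 : z = 0
    · subst hz0
      have hF1 := (hFd.deriv isOpen_ball)
      have k1 := (hF1.differentiableAt (ball_mem_nhds _ hR0)).continuousAt
      have k2 := ((hF1.deriv isOpen_ball).differentiableAt (ball_mem_nhds _ hR0)).continuousAt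
      have k : ContinuousAt (fun z => z * (1 - z) * deriv (deriv F) z
        + (-m - (A + B + 1) * z) * deriv F z - A * B * F z) 0 := by fun_prop
      have k' := k.tendsto.mono_left (nhdsWithin_le_nhds (s := {0}ᶜ))
      refine tendsto_nhds_unique k' (tendsto_const_nhds.congr' ?_)
      filter_upwards [hDn] with w hw using (hD' w hw).symm
    · exact hD' z ⟨hz, hz0⟩
  obtain ⟨j, hj, hj'⟩ := exists_add_eq_zero_of_hypergeometric hR0 m A B F hFd hF0 hFE
  exact ⟨j, hj, by exact_mod_cast hj'⟩

end

section
variable {u : ℂ → ℝ}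

lemma integrable_lapC_of_liouville (hl : ∀ z ∈ ({0, 1}ᶜ : Set ℂ), lapC u z = -2 * exp (u z))
    (hi : Integrable (fun z => exp (u z))) :
    Integrable (lapC u) ∧ ∫ z, lapC u z = -2 * ∫ z, exp (u z) := by
  have h : (fun z => -2 * exp (u z)) =ᵐ[volume] lapC u := by
    filter_upwards [compl_mem_ae_iff.2 ((Set.toFinite ({0, 1} : Set ℂ)).measure_zero volume)]
      with z hz using (hl z hz).symm
  exact ⟨(hi.const_mul _).congr h, by rw [← integral_congr_ae h, integral_const_mul]⟩

/-- The exponent at infinity of a finite energy solution with singularities at `0` and `1`. -/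
lemma exponent_at_infinity {a b : ℝ} (hu : ContDiffOn ℝ 2 u {0, 1}ᶜ)
    (hl : ∀ z ∈ ({0, 1}ᶜ : Set ℂ), lapC u z = -2 * exp (u z))
    (hi : Integrable (fun z => exp (u z)))
    (h0 : Tendsto (fun z => (z - 0) * dz (fun y => (u y : ℂ)) z) (𝓝[≠] 0) (𝓝 ((a : ℂ) - 1)))
    (h1 : Tendsto (fun z => (z - 1) * dz (fun y => (u y : ℂ)) z) (𝓝[≠] 1) (𝓝 ((b : ℂ) - 1)))
    {l : ℝ} (hl' : 1 / (2 * π) * ∫ z, exp (u z) = a + b + l - 1) :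
    0 < l ∧ Tendsto (fun z => z ^ 2 * schw u z) (cocompact ℂ) (𝓝 ((1 - (l : ℂ) ^ 2) / 2)) := by
  have hsub : ∀ z : ℂ, 1 < ‖z‖ → z ∈ ({0, 1}ᶜ : Set ℂ) := fun z hz => by
    rw [mem_compl_zero_one]
    constructor <;> rintro rfl <;> norm_num at hz
  have hu1 : ContDiffOn ℝ 2 u {z | 1 < ‖z‖} := hu.mono hsub
  obtain ⟨hil, hint⟩ := integrable_lapC_of_liouville hl hi
  have hc : Tendsto (cmd 0 u) atTop (𝓝 (-(4 * π * (1 + l)))) := by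
    convert tendsto_cmd_atTop_of_punctures hu hil h0 h1 using 2
    rw [hint]
    have : ∫ z, exp (u z) = 2 * π * (a + b + l - 1) := by
      rw [← hl']; field_simp
    rw [this]
    simp
    ring
  have hpos := pos_of_tendsto_cmd one_pos hu1 (fun z hz => hl z (hsub z hz)) hi hc
  exact ⟨hpos, tendsto_of_end isOpen_compl_zero_one hu hl hpos one_pos hsub fun ε hε =>
    exists_abs_add_log_le one_pos hu1 (fun z hz => hl z (hsub z hz)) hi hc hε⟩

lemma abs_log_norm_sub_one_le {z : ℂ} (hz : ‖z‖ ≤ 1 / 2) : |Real.log ‖z - 1‖| ≤ 1 := by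
  have h1 : 1 / 2 ≤ ‖z - 1‖ := by
    have := norm_sub_norm_le (1 : ℂ) z
    rw [norm_sub_rev, norm_one] at this
    linarith
  have h2 : ‖z - 1‖ ≤ 2 := by
    have := norm_sub_le z 1
    rw [norm_one] at this
    linarith
  have h2' : Real.log 2 ≤ 1 := by linarith [Real.log_two_lt_d9]
  rw [abs_le]
  constructor
  · have := Real.log_le_log (by norm_num) h1
    rw [one_div, Real.log_inv] at this
    linarith
  · exact (Real.log_le_log (by linarith) h2).trans h2'

lemma abs_regPart_le {a b r M : ℝ} (hr : r ≤ 1 / 2)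
    (hM : ∀ z, z ≠ 0 → ‖z - 0‖ < r → |u z - 2 * (a - 1) * Real.log ‖z - 0‖| ≤ M) {z : ℂ}
    (hz : z ∈ ball (0 : ℂ) r \ {0}) : |regPart u a b z| ≤ M + |2 * (b - 1)| := by
  have hz1 : ‖z‖ < r := by simpa using hz.1
  have h1 := hM z hz.2 (by rwa [sub_zero])
  have h2 : |2 * (b - 1) * Real.log ‖z - 1‖| ≤ |2 * (b - 1)| := by
    rw [abs_mul]
    exact mul_le_of_le_one_right (abs_nonneg _) (abs_log_norm_sub_one_le (hz1.le.trans hr))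
  have h3 : regPart u a b z = (u z - 2 * (a - 1) * Real.log ‖z - 0‖)
      - 2 * (b - 1) * Real.log ‖z - 1‖ := by
    rw [regPart]; ring
  rw [h3]
  exact (abs_sub _ _).trans (add_le_add h1 h2)

lemma tendsto_mul_dz_regPart {a b : ℝ} (hu : ContDiffOn ℝ 2 u {0, 1}ᶜ)
    (h0 : Tendsto (fun z => (z - 0) * dz (fun y => (u y : ℂ)) z) (𝓝[≠] 0) (𝓝 ((a : ℂ) - 1))) :
    Tendsto (fun z => z * dz (fun y => (regPart u a b y : ℂ)) z) (𝓝[≠] 0) (𝓝 0) := by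
  have hc : ContinuousAt (fun z : ℂ => z * ((b - 1) / (z - 1))) 0 := by
    have : (0 : ℂ) - 1 ≠ 0 := by norm_num
    fun_prop (disch := assumption)
  have hc' := hc.tendsto.mono_left (nhdsWithin_le_nhds (s := {0}ᶜ))
  have hk := (h0.sub_const ((a : ℂ) - 1)).sub hc'
  simp only [zero_mul, sub_self] at hk
  refine hk.congr' ?_
  filter_upwards [self_mem_nhdsWithin, nhdsWithin_le_nhds (ball_mem_nhds (0 : ℂ) one_pos)]
    with z hz hz1
  have hz1' : z ∈ ({0, 1}ᶜ : Set ℂ) := mem_compl_zero_one.2 ⟨hz, by rintro rfl; simp at hz1⟩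
  rw [dz_regPart hu a b hz1']
  have : z ≠ 0 := hz
  field_simp
  ring

lemma exists_sub_or_add_eq {n : ℕ} {θ θ₃ ε M : ℝ} (hn : 0 < n)
    (hu : ContDiffOn ℝ 2 u {0, 1}ᶜ)
    (hl : ∀ z ∈ ({0, 1}ᶜ : Set ℂ), lapC u z = -2 * exp (u z))
    (h0 : Tendsto (fun z => (z - 0) * dz (fun y => (u y : ℂ)) z) (𝓝[≠] 0) (𝓝 ((n : ℝ) - 1 : ℂ)))
    (hQ : ∀ z ∈ ({0, 1}ᶜ : Set ℂ),
      z * (z - 1) * fuchsQ (schw u) n θ z = (((n : ℝ) + θ - 1) ^ 2 - θ₃ ^ 2 : ℂ) / 4)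
    (hε : 0 < ε)
    (hM : ∀ z, z ≠ 0 → ‖z - 0‖ < ε → |u z - 2 * ((n : ℝ) - 1) * Real.log ‖z - 0‖| ≤ M) :
    ∃ j : ℕ, j ≤ n - 1 ∧ (θ + θ₃ = 2 * j - (n - 1) ∨ θ - θ₃ = 2 * j - (n - 1)) := by
  set r := min ε (1 / 2) with hr
  have hr0 : 0 < r := by positivity
  have hr1 : r ≤ 1 / 2 := min_le_right _ _
  have hsub : ball (0 : ℂ) r \ {0} ⊆ {0, 1}ᶜ := fun z hz => by
    refine mem_compl_zero_one.2 ⟨hz.2, ?_⟩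
    rintro rfl
    have := hz.1
    rw [mem_ball_zero_iff, norm_one] at this
    linarith
  set v := regPart u n θ with hv
  set C := M + |2 * (θ - 1)| with hC
  have hvC : ∀ z ∈ ball (0 : ℂ) r \ {0}, |v z| ≤ C := fun z hz =>
    abs_regPart_le hr1 (fun z h1 h2 => hM z h1 (h2.trans_le (min_le_left _ _))) hz
  have hv3 := contDiffOn_three_regPart
    (contDiffOn_three_of_liouville isOpen_compl_zero_one hu hl) n θ
  have hvd : ∀ z ∈ ball (0 : ℂ) r \ {0}, DifferentiableAt ℝ v z := fun z hz =>
    ((contDiffOn_regPart hu n θ).of_le (by norm_num)).differentiableAt_of_mem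
      isOpen_compl_zero_one (hsub hz)
  set Y : ℂ → ℂ := fun w => Complex.exp ((-1 / 2 : ℂ) * v w) with hY
  have hYr : ∀ z, Y z = ((exp (-1 / 2 * v z) : ℝ) : ℂ) := fun z => by simp [hY]
  have hYn : ∀ z, ‖Y z‖ = exp (-1 / 2 * v z) := fun z => by
    rw [hYr, Complex.norm_real, Real.norm_of_nonneg (exp_pos _).le]
  have hYM : ∀ z ∈ ball (0 : ℂ) r \ {0}, ‖Y z‖ ≤ exp (C / 2) := fun z hz => by
    rw [hYn, exp_le_exp]
    have := (abs_le.1 (hvC z hz)).1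
    linarith
  have hYδ : ∀ z ∈ ball (0 : ℂ) r \ {0}, exp (-(C / 2)) ≤ ‖Y z‖ := fun z hz => by
    rw [hYn, exp_le_exp]
    have := (abs_le.1 (hvC z hz)).2
    linarith
  have hn1 : ((n - 1 : ℕ) : ℂ) = n - 1 := by rw [Nat.cast_sub hn, Nat.cast_one]
  have hn1' : ((n - 1 : ℕ) : ℝ) = n - 1 := by rw [Nat.cast_sub hn, Nat.cast_one]
  obtain ⟨j, hj, hj'⟩ := exists_add_eq_zero_of_real_solution hr0 (exp_pos _) (n - 1)
    ((-(n + θ - 1) - θ₃) / 2) ((-(n + θ - 1) + θ₃) / 2) (Y := Y)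
    ((contDiffOn_exp_real hv3 (-1 / 2)).mono hsub)
    (fun z => by rw [hYr, Complex.conj_ofReal])
    (fun z hz => by
      have := hypergeometric_exp_regPart hu (hsub hz) (hQ z (hsub hz))
      rw [← this, hn1]
      push_cast
      ring)
    (by
      have hb := (tendsto_mul_dz_regPart (b := θ) hu h0).const_mul (-1 / 2 : ℂ)
      rw [mul_zero] at hb
      have hmem : ball (0 : ℂ) r \ {0} ∈ 𝓝[≠] (0 : ℂ) :=
        sdiff_mem_nhdsWithin_compl (ball_mem_nhds _ hr0) _
      refine squeeze_zero_norm' (a := fun z => ‖(-1 / 2 : ℂ) *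
        (z * dz (fun y => (v y : ℂ)) z)‖ * exp (C / 2)) ?_ (by simpa using hb.norm.mul_const _)
      filter_upwards [hmem] with z hz
      rw [hY, dz_exp_real (hvd z hz), show z * (-1 / 2 * dz (fun w => (v w : ℂ)) z *
        Complex.exp (-1 / 2 * v z)) = (-1 / 2 : ℂ) * (z * dz (fun y => (v y : ℂ)) z) * Y z by
        rw [hY]; ring, norm_mul]
      exact mul_le_mul_of_nonneg_left (hYM z hz) (norm_nonneg _))
    hYδ hYM
  refine ⟨j, hj, ?_⟩
  rcases hj' with h | h
  · left; linarith
  · right; linarith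

lemma exists_nat_of_eq_two_mul_sub {n j : ℕ} {θ θ₃ : ℝ} (hn : 0 < n) (hθ : 0 < θ) (hθ₃ : 0 < θ₃)
    (hj : j ≤ n - 1) (h : θ + θ₃ = 2 * j - (n - 1) ∨ θ - θ₃ = 2 * j - (n - 1)) :
    ∃ m : ℕ, (m : ℝ) ≤ (n : ℝ) - 1 ∧ Odd (m + n) ∧ (θ + θ₃ = (m : ℝ) ∨ |θ - θ₃| = (m : ℝ)) := by
  refine ⟨(2 * (j : ℤ) - (n - 1)).natAbs, ?_, ?_, ?_⟩
  · have : (2 * (j : ℤ) - (n - 1)).natAbs + 1 ≤ n := by omega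
    have : ((2 * (j : ℤ) - (n - 1)).natAbs : ℝ) + 1 ≤ n := by exact_mod_cast this
    linarith
  · rw [Nat.odd_iff]; omega
  · have e : ((2 * (j : ℤ) - (n - 1)).natAbs : ℝ) = |2 * (j : ℝ) - (n - 1)| := by
      rw [Nat.cast_natAbs]; push_cast; rfl
    rw [e]
    rcases h with h | h
    · left; rw [← h, abs_of_pos (by positivity)]
    · right; rw [h]

/-- The theorem for singularities at `0` and `1` in the complex plane. -/
theorem liouville_complex {n : ℕ} {θ : ℝ} (hn : 0 < n) (hθ : 0 < θ)
    (hu : ContDiffOn ℝ 2 u {0, 1}ᶜ)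
    (hl : ∀ z ∈ ({0, 1}ᶜ : Set ℂ), lapC u z = -2 * exp (u z))
    (h0 : ∃ ε > 0, ∃ M, ∀ z, z ≠ 0 → ‖z - 0‖ < ε →
      |u z - 2 * ((n : ℝ) - 1) * Real.log ‖z - 0‖| ≤ M)
    (h1 : ∃ ε > 0, ∃ M, ∀ z, z ≠ 1 → ‖z - 1‖ < ε →
      |u z - 2 * (θ - 1) * Real.log ‖z - 1‖| ≤ M)
    (hi : Integrable (fun z => exp (u z))) :
    ∃ θ₃ : ℝ, 0 < θ₃ ∧ (1 / (2 * π)) * (∫ z, exp (u z)) = (n : ℝ) + θ + θ₃ - 1 ∧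
      ∃ m : ℕ, (m : ℝ) ≤ (n : ℝ) - 1 ∧ Odd (m + n) ∧
        (θ + θ₃ = (m : ℝ) ∨ |θ - θ₃| = (m : ℝ)) := by
  obtain ⟨ε₀, hε₀, M₀, hM₀⟩ := h0
  obtain ⟨ε₁, hε₁, M₁, hM₁⟩ := h1
  have hn' : (0 : ℝ) < (n : ℝ) := Nat.cast_pos.2 hn
  obtain ⟨d0, s0⟩ := tendsto_of_puncture (c := 0) isOpen_compl_zero_one hu hl hn'
    (lt_min hε₀ one_pos) (fun z hz hz' => mem_compl_zero_one.2 ⟨hz, by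
      rintro rfl
      have := hz'.trans_le (min_le_right _ _)
      norm_num at this⟩) (fun z hz hz' => hM₀ z hz (hz'.trans_le (min_le_left _ _)))
  obtain ⟨d1, s1⟩ := tendsto_of_puncture (c := 1) isOpen_compl_zero_one hu hl hθ
    (lt_min hε₁ one_pos) (fun z hz hz' => mem_compl_zero_one.2 ⟨by
      rintro rfl
      have := hz'.trans_le (min_le_right _ _)
      norm_num at this, hz⟩) (fun z hz hz' => hM₁ z hz (hz'.trans_le (min_le_left _ _)))
  set θ₃ := 1 / (2 * π) * (∫ z, exp (u z)) - (n + θ - 1) with hθ₃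
  have hmass : 1 / (2 * π) * (∫ z, exp (u z)) = (n : ℝ) + θ + θ₃ - 1 := by rw [hθ₃]; ring
  obtain ⟨hpos, hinf⟩ := exponent_at_infinity hu hl hi d0 d1 hmass
  obtain ⟨j, hj, hj'⟩ := exists_sub_or_add_eq (θ := θ) (θ₃ := θ₃) hn hu hl d0 (fun z hz =>
    fuchsQ_eq (differentiableOn_schw isOpen_compl_zero_one hu hl) s0 s1 hinf hz) hε₀ hM₀
  exact ⟨θ₃, hpos, hmass, exists_nat_of_eq_two_mul_sub hn hθ hpos hj hj'⟩

end

section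
variable {w : ℂ → ℝ} {Ω : Set ℂ} {z : ℂ}

lemma dzb_const_mul {f : ℂ → ℂ} (hf : DifferentiableAt ℝ f z) (a : ℂ) :
    dzb (fun y => a * f y) z = a * dzb f z := by
  rw [dzb_mul (differentiableAt_const a) hf, dzb_const, zero_mul, zero_add]

lemma lapC_eq_fderiv (hΩ : IsOpen Ω) (hw : ContDiffOn ℝ 2 w Ω) (hz : z ∈ Ω) :
    lapC w z = fderiv ℝ (fun y => fderiv ℝ w y 1) z 1
      + fderiv ℝ (fun y => fderiv ℝ w y Complex.I) z Complex.I := by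
  have hp : ∀ v, DifferentiableAt ℝ (fun y => fderiv ℝ w y v) z := fun v =>
    (((hw.fderiv_of_isOpen hΩ (m := 1) (by norm_num)).contDiffAt (hΩ.mem_nhds hz)).differentiableAt
      (by norm_num)).clm_apply (differentiableAt_const v)
  have hof : ∀ {f : ℂ → ℝ} {y : ℂ}, DifferentiableAt ℝ f y → ∀ v,
      fderiv ℝ (fun x => (f x : ℂ)) y v = (fderiv ℝ f y v : ℂ) := fun {f y} hf v => by
    have h : HasFDerivAt (fun x => (f x : ℂ)) (Complex.ofRealCLM.comp (fderiv ℝ f y)) y :=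
      Complex.ofRealCLM.hasFDerivAt.comp y hf.hasFDerivAt
    rw [h.fderiv]; rfl
  have hev : dz (fun y => (w y : ℂ)) =ᶠ[𝓝 z] fun y => (1 / 2 : ℂ) * (fderiv ℝ w y 1 : ℂ)
      + (-Complex.I / 2) * (fderiv ℝ w y Complex.I : ℂ) := by
    filter_upwards [hΩ.mem_nhds hz] with y hy
    have hd := (hw.of_le (by norm_num)).differentiableAt_of_mem hΩ hy
    rw [dz, hof hd, hof hd]
    ring
  have hpC : ∀ v, DifferentiableAt ℝ (fun y => (fderiv ℝ w y v : ℂ)) z := fun v =>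
    Complex.ofRealCLM.differentiableAt.comp z (hp v)
  rw [lapC, dzb_eq_of_eventuallyEq hev, dzb_add ((hpC 1).const_mul _)
    ((hpC Complex.I).const_mul _), dzb_const_mul (hpC 1), dzb_const_mul (hpC Complex.I), dzb, dzb,
    hof (hp 1), hof (hp 1), hof (hp _), hof (hp _)]
  simp
  ring

lemma lapC_affine (hΩ : IsOpen Ω) (hw : ContDiffOn ℝ 2 w Ω) (c a : ℂ) (k : ℝ)
    (hz : c + a * z ∈ Ω) :
    lapC (fun y => w (c + a * y) + k) z = ‖a‖ ^ 2 * lapC w (c + a * z) := by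
  have hφ : ∀ z, HasDerivAt (fun y : ℂ => c + a * y) a z := fun z => by
    simpa using ((hasDerivAt_id z).const_mul a).const_add c
  have hφd : ∀ z, DifferentiableAt ℝ (fun y : ℂ => c + a * y) z := fun z => by fun_prop
  have hV : IsOpen {y : ℂ | c + a * y ∈ Ω} := hΩ.preimage (by fun_prop)
  have hev : dz (fun y => ((w (c + a * y) + k : ℝ) : ℂ)) =ᶠ[𝓝 z] fun y =>
      a * dz (fun x => (w x : ℂ)) (c + a * y) := by
    filter_upwards [hV.mem_nhds hz] with y hy
    have hd : DifferentiableAt ℝ (fun x => (w x : ℂ)) (c + a * y) :=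
      (hw.complexOfReal.of_le (by norm_num)).differentiableAt_of_mem hΩ hy
    have h1 := dz_comp_holomorphic (f := fun y => c + a * y) (z := y) hd (hφ y).differentiableAt
    rw [(hφ y).deriv] at h1
    have e : (fun y => ((w (c + a * y) + k : ℝ) : ℂ)) = fun y => (w (c + a * y) : ℂ) + (k : ℂ) := by
      funext y; push_cast; rfl
    have hd' : DifferentiableAt ℝ (fun y => (w (c + a * y) : ℂ)) y := hd.comp y (hφd y)
    rw [e, dz_add hd' (differentiableAt_const _), dz_const, add_zero, h1]
  have hg := (hw.complexOfReal.dz_two hΩ).differentiableAt_of_mem hΩ hz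
  have hg' : DifferentiableAt ℝ (fun y => dz (fun x => (w x : ℂ)) (c + a * y)) z :=
    DifferentiableAt.comp (g := dz fun x => (w x : ℂ)) z hg (hφd z)
  have h2 := dzb_comp_holomorphic (f := fun y => c + a * y) (z := z) hg (hφ z).differentiableAt
  rw [(hφ z).deriv] at h2
  rw [lapC, dzb_eq_of_eventuallyEq hev, dzb_const_mul hg', h2,
    show 4 * (a * (starRingEnd ℂ a * dzb (dz fun x => (w x : ℂ)) (c + a * z)))
      = ((‖a‖ ^ 2 : ℝ) : ℂ) * (4 * dzb (dz fun x => (w x : ℂ)) (c + a * z)) by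
      rw [Complex.ofReal_pow, ← Complex.mul_conj']; ring, Complex.re_ofReal_mul, lapC]

end

/-- The standard isometry from the complex plane to `ℝ²`. -/
abbrev complexIso : ℂ ≃ₗᵢ[ℝ] E2 := Complex.orthonormalBasisOneI.repr

lemma complexIso_one : complexIso 1 = EuclideanSpace.single 0 1 := by
  simpa using Complex.orthonormalBasisOneI.repr_self 0

lemma complexIso_I : complexIso Complex.I = EuclideanSpace.single 1 1 := by
  simpa using Complex.orthonormalBasisOneI.repr_self 1

lemma lapC_comp_complexIso {u : E2 → ℝ} {Ω : Set E2} (hΩ : IsOpen Ω) (hu : ContDiffOn ℝ 2 u Ω)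
    {z : ℂ} (hz : complexIso z ∈ Ω) :
    lapC (fun y => u (complexIso y)) z = lap u (complexIso z) := by
  have hf : ∀ (f : E2 → ℝ) (y v : ℂ), fderiv ℝ (fun y => f (complexIso y)) y v
      = fderiv ℝ f (complexIso y) (complexIso v) := fun f y v => by
    have := complexIso.toContinuousLinearEquiv.comp_right_fderiv (f := f) (x := y)
    exact congrArg (fun L => L v) this
  have hw : ContDiffOn ℝ 2 (fun y => u (complexIso y)) (complexIso ⁻¹' Ω) :=
    hu.comp complexIso.contDiff.contDiffOn fun _ h => h
  rw [lapC_eq_fderiv (hΩ.preimage complexIso.continuous) hw hz]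
  simp only [hf]
  rw [hf (fun x => fderiv ℝ u x (complexIso 1)), hf (fun x => fderiv ℝ u x (complexIso Complex.I)),
    lap, Fin.sum_univ_two, complexIso_one, complexIso_I]

lemma integrable_and_integral_comp_similarity {f : E2 → ℝ} (hf : Integrable f) (p : E2)
    {a : ℂ} (ha : a ≠ 0) :
    Integrable (fun z : ℂ => f (p + complexIso (a * z))) ∧
      ∫ z : ℂ, f (p + complexIso (a * z)) = (‖a‖ ^ 2)⁻¹ * ∫ x, f x := by
  have hn : ‖a‖ ≠ 0 := norm_ne_zero_iff.2 ha
  obtain ⟨ω, hω⟩ : ∃ ω : Circle, (ω : ℂ) = a / ‖a‖ :=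
    ⟨⟨a / ‖a‖, mem_sphere_zero_iff_norm.2 (by simp [hn])⟩, rfl⟩
  set E : ℂ ≃ₗᵢ[ℝ] E2 := (rotation ω).trans complexIso with hE
  have he : ∀ z : ℂ, complexIso (a * z) = E (‖a‖ • z) := fun z => by
    have : (‖a‖ : ℂ) ≠ 0 := by exact_mod_cast hn
    rw [hE, LinearIsometryEquiv.trans_apply, rotation_apply, hω]
    congr 1
    rw [Complex.real_smul]
    field_simp
  simp only [he]
  have hp := hf.comp_add_left p
  have hEi : Integrable (fun z => f (p + E z)) :=
    (E.measurePreserving.integrable_comp_emb E.toHomeomorph.measurableEmbedding).2 hp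
  refine ⟨hEi.comp_smul hn, ?_⟩
  rw [Measure.integral_comp_smul volume (fun z => f (p + E z)), Complex.finrank_real_complex,
    E.measurePreserving.integral_comp E.toHomeomorph.measurableEmbedding (fun x => f (p + x)),
    integral_add_left_eq_self, smul_eq_mul, abs_of_nonneg (by positivity)]

/-- Theorem A-1 (after Eremenko): for a solution of
`Δu + 2eᵘ = 4π(θ₁−1)δ_{p₁} + 4π(θ₂−1)δ_{p₂}` with `θ₁` a positive integer, `θ₂ > 0` not an
integer and finite energy, the total mass is `θ₁ + θ₂ + θ₃ − 1` for some `θ₃ > 0`, and either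
`θ₂ + θ₃` or `|θ₂ − θ₃|` is an integer `m ≤ θ₁ − 1` of parity opposite to `θ₁`. -/
theorem eremenko_one_integer_singularity
    (p₁ p₂ : E2) (hp : p₁ ≠ p₂) (θ₁ : ℕ) (hθ₁ : 0 < θ₁)
    (θ₂ : ℝ) (hθ₂ : 0 < θ₂) (hθ₂ni : ∀ n : ℤ, θ₂ ≠ (n : ℝ))
    (u : E2 → ℝ)
    (hreg : ContDiffOn ℝ 2 u ({p₁, p₂}ᶜ))
    (hpde : ∀ x : E2, x ≠ p₁ → x ≠ p₂ → lap u x + 2 * exp (u x) = 0)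
    (hsing1 : ∃ ε > (0:ℝ), ∃ M : ℝ, ∀ x : E2, x ≠ p₁ → dist x p₁ < ε →
      |u x - 2 * ((θ₁ : ℝ) - 1) * Real.log ‖x - p₁‖| ≤ M)
    (hsing2 : ∃ ε > (0:ℝ), ∃ M : ℝ, ∀ x : E2, x ≠ p₂ → dist x p₂ < ε →
      |u x - 2 * (θ₂ - 1) * Real.log ‖x - p₂‖| ≤ M)
    (hint : Integrable (fun x : E2 => exp (u x))) :
    ∃ θ₃ : ℝ, 0 < θ₃ ∧
      (1 / (2 * π)) * (∫ x : E2, exp (u x)) = (θ₁ : ℝ) + θ₂ + θ₃ - 1 ∧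
      ∃ m : ℕ, (m : ℝ) ≤ (θ₁ : ℝ) - 1 ∧ Odd (m + θ₁) ∧
        (θ₂ + θ₃ = (m : ℝ) ∨ |θ₂ - θ₃| = (m : ℝ)) := by
  obtain ⟨c, rfl⟩ := complexIso.surjective p₁
  obtain ⟨b, rfl⟩ := complexIso.surjective p₂
  obtain ⟨a, rfl⟩ : ∃ a, b = c + a := ⟨b - c, by ring⟩
  have ha : a ≠ 0 := by rintro rfl; simp at hp
  have hn : 0 < ‖a‖ := norm_pos_iff.2 ha
  have hΩ : IsOpen ({complexIso c, complexIso (c + a)}ᶜ : Set E2) :=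
    (Set.toFinite _).isClosed.isOpen_compl
  have hmem : ∀ z ∈ ({0, 1}ᶜ : Set ℂ),
      complexIso (c + a * z) ∈ ({complexIso c, complexIso (c + a)}ᶜ : Set E2) := fun z hz => by
    have := mem_compl_zero_one.1 hz
    simp [ha, this]
  have hw : ContDiffOn ℝ 2 (fun y => u (complexIso y))
      (complexIso ⁻¹' {complexIso c, complexIso (c + a)}ᶜ) :=
    hreg.comp complexIso.contDiff.contDiffOn fun _ h => h
  set v : ℂ → ℝ := fun z => u (complexIso (c + a * z)) + 2 * Real.log ‖a‖ with hv
  have hexp : ∀ z, exp (v z) = ‖a‖ ^ 2 * exp (u (complexIso c + complexIso (a * z))) := fun z => by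
    rw [hv, ← map_add]
    simp only
    rw [exp_add, mul_comm, two_mul, exp_add, exp_log hn]
    ring
  have hsing : ∀ (β : ℝ) (q : ℂ), (∃ ε > (0:ℝ), ∃ M : ℝ, ∀ x : E2, x ≠ complexIso (c + a * q) →
      dist x (complexIso (c + a * q)) < ε →
      |u x - 2 * (β - 1) * Real.log ‖x - complexIso (c + a * q)‖| ≤ M) →
      ∃ ε > 0, ∃ M, ∀ z, z ≠ q → ‖z - q‖ < ε →
        |v z - 2 * (β - 1) * Real.log ‖z - q‖| ≤ M := by
    rintro β q ⟨ε, hε, M, hM⟩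
    refine ⟨ε / ‖a‖, by positivity, M + |2 * β * Real.log ‖a‖|, fun z hz hzε => ?_⟩
    have hd : ‖complexIso (c + a * z) - complexIso (c + a * q)‖ = ‖a‖ * ‖z - q‖ := by
      rw [← map_sub, LinearIsometryEquiv.norm_map, ← norm_mul]
      congr 1
      ring
    have h := hM (complexIso (c + a * z)) (by simpa [ha] using hz) (by
      rw [dist_eq_norm, hd, mul_comm]
      exact (lt_div_iff₀ hn).1 hzε)
    rw [hd, Real.log_mul hn.ne' (norm_ne_zero_iff.2 (sub_ne_zero.2 hz))] at h
    have e : v z - 2 * (β - 1) * Real.log ‖z - q‖ = (u (complexIso (c + a * z))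
        - 2 * (β - 1) * (Real.log ‖a‖ + Real.log ‖z - q‖)) + 2 * β * Real.log ‖a‖ := by
      rw [hv]; ring
    rw [e]
    exact (abs_add_le _ _).trans (add_le_add_left h _)
  obtain ⟨hi, hI⟩ := integrable_and_integral_comp_similarity hint (complexIso c) ha
  have hvI : ∫ z, exp (v z) = ∫ x, exp (u x) := by
    simp only [hexp]
    rw [integral_const_mul, hI, mul_inv_cancel_left₀ (by positivity)]
  rw [← hvI]
  refine liouville_complex hθ₁ hθ₂ ?_ (fun z hz => ?_) (hsing θ₁ 0 (by simpa using hsing1))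
    (hsing θ₂ 1 (by simpa using hsing2)) ?_
  · exact ((hw.comp (by fun_prop : ContDiff ℝ 2 fun z : ℂ => c + a * z).contDiffOn hmem)).add
      contDiffOn_const
  · have h1 := hpde (complexIso (c + a * z)) (fun h => hmem z hz (Or.inl h))
      (fun h => hmem z hz (Or.inr h))
    rw [hv, lapC_affine (hΩ.preimage complexIso.continuous) hw c a _ (hmem z hz),
      lapC_comp_complexIso hΩ hreg (hmem z hz), ← hv, hexp, ← map_add]
    linear_combination ‖a‖ ^ 2 * h1
  · simp only [hexp]
    exact hi.const_mul _
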